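/- Let H and f₁, f₂, … be multipliers of the Dirichlet space 𝒟 such that (a) the column operator M_F^C has norm at most 1, and (b) |H(z)|² ≤ ∑_{j=1}^∞ |f_j(z)|² for all z in the open unit disk 𝔻. Then there exist multipliers g₁, g₂, … of 𝒟 such that ∑_{j=1}^∞ f_j(z) g_j(z) = H(z)³ for all z ∈ 𝔻 and the column operator M_G^C associated to G = (g₁, g₂, …) is bounded; moreover one may take ‖M_G^C‖ ≤ √(144‖M_H‖² + 73104). -/

import Mathlib

open Metric MeasureTheory Complex

/-- Taylor coefficient at 0. -/
noncomputable def dirCoeff (f : ℂ → ℂ) (n : ℕ) : ℂ :=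
  iteratedDeriv n f 0 / (n.factorial : ℂ)

/-- Membership in the Dirichlet space. -/
def MemDirichlet (f : ℂ → ℂ) : Prop :=
  DifferentiableOn ℂ f (ball (0:ℂ) 1) ∧
  Summable (fun n : ℕ => ((n : ℝ) + 1) * ‖dirCoeff f n‖ ^ 2)

/-- Squared Dirichlet norm. -/
noncomputable def dirNormSq (f : ℂ → ℂ) : ℝ :=
  ∑' n : ℕ, ((n : ℝ) + 1) * ‖dirCoeff f n‖ ^ 2

/-- Multiplier of the Dirichlet space. -/
def IsMultiplier (φ : ℂ → ℂ) : Prop :=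
  DifferentiableOn ℂ φ (ball (0:ℂ) 1) ∧
  ∀ f, MemDirichlet f → MemDirichlet (fun z => φ z * f z)

/-- Operator norm of the multiplication operator. -/
noncomputable def multNorm (φ : ℂ → ℂ) : ℝ :=
  sInf {C : ℝ | 0 ≤ C ∧ ∀ f, MemDirichlet f →
    dirNormSq (fun z => φ z * f z) ≤ C ^ 2 * dirNormSq f}

/-- The column operator of `F` has norm at most `C`. -/
def ColNormLE (F : ℕ → ℂ → ℂ) (C : ℝ) : Prop :=
  ∀ h, MemDirichlet h →
    Summable (fun j : ℕ => dirNormSq (fun z => F j z * h z)) ∧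
    (∑' j : ℕ, dirNormSq (fun z => F j z * h z)) ≤ C ^ 2 * dirNormSq h

open Finset.HasAntidiagonal

/-- A Hermitian positive semidefinite kernel on `ℕ` is the Gram matrix of a sequence of vectors in
a Hilbert space. -/
theorem exists_gram_vectors (L : ℕ → ℕ → ℂ) (hL : ∀ m n, star (L m n) = L n m)
    (hpos : ∀ c : ℕ →₀ ℂ, 0 ≤ (c.sum fun m x => c.sum fun n y => star x * y * L m n).re) :
    ∃ (K : Type) (_ : NormedAddCommGroup K) (_ : InnerProductSpace ℂ K) (_ : CompleteSpace K)
      (R : ℕ → K), ∀ m n, inner ℂ (R m) (R n) = L m n := by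
  let k : Matrix ℕ ℕ (ℂ →L[ℂ] ℂ) := fun m n => L m n • ContinuousLinearMap.id ℂ ℂ
  have hk : k.PosSemidef := by
    have key := (RKHS.posSemidef_tfae (K := k)).out 0 2
    refine key.mpr ⟨?_, fun v => ?_⟩
    · ext m n
      change (star (L n m • ContinuousLinearMap.id ℂ ℂ)) 1 = _
      rw [star_smul, hL, ContinuousLinearMap.star_eq_adjoint, ContinuousLinearMap.adjoint_id]
    · convert hpos v using 2
      simp only [Finsupp.sum, k, RCLike.re_to_complex]
      congr 1
      refine Finset.sum_congr rfl fun m _ => Finset.sum_congr rfl fun n _ => ?_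
      have := hL n m
      simp only [RCLike.star_def] at this
      simp [this, mul_comm, mul_left_comm]
  have : Fact k.PosSemidef := ⟨hk⟩
  refine ⟨RKHS.OfKernel k, inferInstance, inferInstance, inferInstance,
    fun n => RKHS.kerFun (RKHS.OfKernel k) n (1 : ℂ), fun m n => ?_⟩
  rw [← RKHS.kernel_inner, RKHS.OfKernel.kernel_ofKernel]
  simp [k, ← hL m n]

/-- A linear relation with norm domination extends to a contraction. -/
theorem exists_contraction_of_norm_le {E F : Type*} [NormedAddCommGroup E] [InnerProductSpace ℂ E]
    [CompleteSpace E] [NormedAddCommGroup F] [InnerProductSpace ℂ F] [CompleteSpace F]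
    (a : ℕ → E) (b : ℕ → F)
    (h : ∀ c : ℕ →₀ ℂ, ‖Finsupp.linearCombination ℂ b c‖ ≤ ‖Finsupp.linearCombination ℂ a c‖) :
    ∃ V : E →L[ℂ] F, (∀ x, ‖V x‖ ≤ ‖x‖) ∧ ∀ n, V (a n) = b n := by
  set la := Finsupp.linearCombination ℂ a
  set lb := Finsupp.linearCombination ℂ b
  let p := (LinearMap.range la).topologicalClosure
  have hp : ∀ c, la c ∈ p := fun c => Submodule.le_topologicalClosure _ ⟨c, rfl⟩
  let e : (ℕ →₀ ℂ) →ₗ[ℂ] p := la.codRestrict p hp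
  have hd : DenseRange e := by
    intro x
    rw [closure_subtype]
    have : (Subtype.val '' Set.range e) = (LinearMap.range la : Set E) := by
      ext y
      simp [e]
    rw [this]
    exact x.2
  have hn : ∀ c, ‖lb c‖ ≤ 1 * ‖e c‖ := fun c => by simpa [e] using h c
  have : CompleteSpace p := (Submodule.isClosed_topologicalClosure _).completeSpace_coe
  refine ⟨(lb.extendOfNorm e).comp p.orthogonalProjectionOnto, fun x => ?_, fun n => ?_⟩
  · have h1 := LinearMap.norm_extendOfNorm_apply_le hd 1 hn (p.orthogonalProjectionOnto x)
    rw [one_mul] at h1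
    exact h1.trans (p.norm_orthogonalProjectionOnto_apply_le x)
  · have h1 : a n = (e (Finsupp.single n 1) : E) := by simp [e, la]
    rw [h1, ContinuousLinearMap.comp_apply, Submodule.orthogonalProjectionOnto_mem_subspace_eq_self,
      LinearMap.extendOfNorm_eq hd ⟨1, hn⟩]
    simp [lb]

theorem exists_eq_of_causal {α : Type*} [Inhabited α] (T : ℕ → (ℕ → α) → α)
    (hT : ∀ n y y', (∀ j < n, y j = y' j) → T n y = T n y') : ∃ y : ℕ → α, ∀ n, y n = T n y := by
  let F : (n : ℕ) → ((m : ℕ) → m < n → α) → α :=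
    fun n r => T n fun j => if h : j < n then r j h else default
  refine ⟨fun n => WellFounded.fix Nat.lt_wfRel.wf F n, fun n => ?_⟩
  change WellFounded.fix Nat.lt_wfRel.wf F n = _
  rw [WellFounded.fix_eq]
  exact hT _ _ _ fun j hj => dif_pos hj

/-- Kaluza's lemma for the sequence `1 / (n + 1)`. -/
theorem exists_kaluza : ∃ d : ℕ → ℝ, (∀ k, 0 ≤ d k) ∧
    ∀ l : ℕ, ∑ p ∈ Finset.HasAntidiagonal.antidiagonal l, d p.1 * (1 / ((p.2 : ℝ) + 1)) =
      1 / ((l : ℝ) + 2) := by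
  obtain ⟨d, hd⟩ := exists_eq_of_causal
    (fun l (d : ℕ → ℝ) => 1 / ((l : ℝ) + 2) -
      ∑ i ∈ Finset.range l, d i * (1 / (((l - i : ℕ) : ℝ) + 1)))
    (fun n y y' h => by
      congr 1
      exact Finset.sum_congr rfl fun i hi => by rw [h i (Finset.mem_range.1 hi)])
  have hsum : ∀ l : ℕ, ∑ i ∈ Finset.range (l + 1), d i * (1 / (((l - i : ℕ) : ℝ) + 1))
      = 1 / ((l : ℝ) + 2) := fun l => by
    rw [Finset.sum_range_succ, hd l]
    simp
  refine ⟨d, fun k => ?_, fun l => ?_⟩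
  · induction k using Nat.strong_induction_on with
    | _ l ih =>
      rw [hd l, sub_nonneg]
      rcases l with _ | l
      · simp
      · have h1 : ∀ i ∈ Finset.range (l + 1), d i * (1 / (((l + 1 - i : ℕ) : ℝ) + 1)) ≤
            (((l : ℝ) + 2) / (l + 3)) * (d i * (1 / (((l - i : ℕ) : ℝ) + 1))) := fun i hi => by
          have hi' := Finset.mem_range.1 hi
          have h2 : 1 / (((l + 1 - i : ℕ) : ℝ) + 1) ≤
            (((l : ℝ) + 2) / (l + 3)) * (1 / (((l - i : ℕ) : ℝ) + 1)) := by
            rw [Nat.cast_sub hi'.le, Nat.cast_sub (by omega : i ≤ l)]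
            have : (i : ℝ) ≤ l := by exact_mod_cast (by omega : i ≤ l)
            have h0 : (0 : ℝ) ≤ i := by positivity
            have h3 : (0 : ℝ) < l - i + 1 := by linarith
            push_cast
            rw [div_mul_div_comm, div_le_div_iff₀ (by linarith) (by positivity)]
            nlinarith
          nlinarith [mul_le_mul_of_nonneg_left h2 (ih i hi')]
        refine (Finset.sum_le_sum h1).trans ?_
        rw [← Finset.mul_sum, hsum]
        have : (0 : ℝ) ≤ l := by positivity
        push_cast
        apply le_of_eq
        field_simp
        ring
  · rw [Finset.Nat.sum_antidiagonal_eq_sum_range_succ (fun i j => d i * (1 / ((j : ℝ) + 1)))]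
    exact hsum l

theorem norm_linearCombination_eq_of_gram_eq {E F : Type*} [NormedAddCommGroup E]
    [InnerProductSpace ℂ E] [NormedAddCommGroup F] [InnerProductSpace ℂ F] (a : ℕ → E) (b : ℕ → F)
    (h : ∀ m n, inner ℂ (b m) (b n) = inner ℂ (a m) (a n)) (c : ℕ →₀ ℂ) :
    ‖Finsupp.linearCombination ℂ b c‖ = ‖Finsupp.linearCombination ℂ a c‖ := by
  rw [← sq_eq_sq₀ (norm_nonneg _) (norm_nonneg _), ← inner_self_eq_norm_sq (𝕜 := ℂ),
    ← inner_self_eq_norm_sq (𝕜 := ℂ)]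
  congr 1
  simp only [Finsupp.linearCombination_apply, Finsupp.sum, sum_inner, inner_sum, inner_smul_left,
    inner_smul_right, h]

theorem exists_colligation {E K : Type*} [NormedAddCommGroup E] [InnerProductSpace ℂ E]
    [CompleteSpace E] [NormedAddCommGroup K] [InnerProductSpace ℂ K] [CompleteSpace K]
    (Fc : ℕ → E) (Φ : ℕ → ℂ) (C : ℝ) (R : ℕ → K) (e : ℕ → ℝ)
    (hG : ∀ m n, Φ m * star (Φ n) + inner ℂ (R m) (R n) = (C : ℂ) ^ 2 * inner ℂ (Fc m) (Fc n) +
      ∑ k ∈ Finset.range (min m n), (e k : ℂ) ^ 2 * inner ℂ (R (m - 1 - k)) (R (n - 1 - k))) :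
    ∃ (W₁ : ℂ × K →ₗ[ℂ] E) (W₂ : ℂ × K →ₗ[ℂ] (ℕ → K)),
      (∀ p N, ‖W₁ p‖ ^ 2 + ∑ k ∈ Finset.range N, ‖W₂ p k‖ ^ 2 ≤ ‖p.1‖ ^ 2 + ‖p.2‖ ^ 2) ∧
      ∀ n p, Φ n * p.1 + inner ℂ (R n) p.2 = C * inner ℂ (Fc n) (W₁ p) +
        ∑ k ∈ Finset.range n, (e k : ℂ) * inner ℂ (R (n - 1 - k)) (W₂ p k) := by
  let a : ℕ → WithLp 2 (E × lp (fun _ : ℕ => K) 2) := fun n => WithLp.toLp 2 ((C : ℂ) • Fc n,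
    ∑ k ∈ Finset.range n, lp.single 2 k ((e k : ℂ) • R (n - 1 - k)))
  let b : ℕ → WithLp 2 (ℂ × K) := fun n => WithLp.toLp 2 (star (Φ n), R n)
  have hin : ∀ n (y : WithLp 2 (E × lp (fun _ : ℕ => K) 2)), inner ℂ (a n) y =
      C * inner ℂ (Fc n) y.fst +
        ∑ k ∈ Finset.range n, (e k : ℂ) * inner ℂ (R (n - 1 - k)) (y.snd k) := fun n y => by
    rw [WithLp.prod_inner_apply]
    simp only [a, sum_inner, lp.inner_single_left, inner_smul_left, Complex.conj_ofReal]
    rfl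
  have hg : ∀ m n, inner ℂ (b m) (b n) = inner ℂ (a m) (a n) := fun m n => by
    rw [hin, WithLp.prod_inner_apply]
    have h1 : ∀ k, (a n).snd k = if k < n then (e k : ℂ) • R (n - 1 - k) else 0 := fun k => by
      change (∑ i ∈ Finset.range n, lp.single 2 i ((e i : ℂ) • R (n - 1 - i)) :
        lp (fun _ : ℕ => K) 2) k = _
      rw [lp.coeFn_sum, Finset.sum_apply]
      simp only [lp.single_apply, Pi.single_apply]
      simp
    have h2 := hG m n
    simp only [b, RCLike.inner_apply, RCLike.star_def, Complex.conj_conj, h1] at h2 ⊢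
    rw [mul_comm, h2]
    congr 1
    · simp only [a, WithLp.toLp_fst, inner_smul_right]; ring
    · rw [← Finset.sum_subset (Finset.range_subset_range.2 (min_le_left m n))]
      · refine Finset.sum_congr rfl fun k hk => ?_
        have : k < n := (Finset.mem_range.1 hk).trans_le (min_le_right _ _)
        simp only [this, if_true, inner_smul_right]; ring
      · intro k hk hk'
        have : ¬ k < n := by
          rw [Finset.mem_range] at hk hk'; omega
        simp [this]
  obtain ⟨V, hV, hVa⟩ := exists_contraction_of_norm_le a b fun c =>
    (norm_linearCombination_eq_of_gram_eq a b hg c).le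
  let W := ContinuousLinearMap.adjoint V
  have hW : ∀ p, ‖W p‖ ≤ ‖p‖ := fun p => by
    have h1 : ‖V‖ ≤ 1 := V.opNorm_le_bound zero_le_one fun x => by simpa using hV x
    have h2 : ‖W‖ ≤ 1 := by rw [LinearIsometryEquiv.norm_map]; exact h1
    simpa using W.le_of_opNorm_le h2 p
  let T := W.toLinearMap ∘ₗ (WithLp.linearEquiv 2 ℂ (ℂ × K)).symm.toLinearMap
  let S₂ : WithLp 2 (E × lp (fun _ : ℕ => K) 2) →ₗ[ℂ] (ℕ → K) :=
    { toFun := fun y => y.snd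
      map_add' := fun _ _ => rfl
      map_smul' := fun _ _ => rfl }
  refine ⟨WithLp.fstₗ 2 ℂ E _ ∘ₗ T, S₂ ∘ₗ T, fun p N => ?_, fun n p => ?_⟩
  · have h1 := pow_le_pow_left₀ (norm_nonneg _) (hW (WithLp.toLp 2 p)) 2
    rw [WithLp.prod_norm_sq_eq_of_L2, WithLp.prod_norm_sq_eq_of_L2] at h1
    refine le_trans (add_le_add_right ?_ _) h1
    have h2 := lp.sum_rpow_le_norm_rpow (p := 2) (by norm_num) (W (WithLp.toLp 2 p)).snd
      (Finset.range N)
    simp only [ENNReal.toReal_ofNat, Real.rpow_ofNat] at h2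
    exact h2
  · have h1 := ContinuousLinearMap.adjoint_inner_right V (a n) (WithLp.toLp 2 p)
    rw [hVa, hin, WithLp.prod_inner_apply] at h1
    have h2 : Φ n * p.1 + inner ℂ (R n) p.2 = inner ℂ (star (Φ n)) p.1 + inner ℂ (R n) p.2 := by
      simp [mul_comm]
    rw [h2]
    exact h1.symm

theorem sum_antidiagonal_assoc {M : Type*} [AddCommMonoid M] (f : ℕ → ℕ → ℕ → M) (l : ℕ) :
    ∑ p ∈ antidiagonal l, ∑ q ∈ antidiagonal p.2, f p.1 q.1 q.2 =
      ∑ p ∈ antidiagonal l, ∑ q ∈ antidiagonal p.1, f q.1 q.2 p.2 := by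
  simp only [Finset.sum_sigma']
  refine Finset.sum_nbij' (fun x => ⟨(x.1.1 + x.2.1, x.2.2), (x.1.1, x.2.1)⟩)
    (fun x => ⟨(x.2.1, x.2.2 + x.1.2), (x.2.2, x.1.2)⟩) ?_ ?_ ?_ ?_ ?_
  all_goals
    rintro ⟨⟨i, j⟩, ⟨k, l⟩⟩ h
    simp only [Finset.mem_sigma, mem_antidiagonal] at h ⊢
  · exact ⟨by omega, trivial⟩
  · exact ⟨by omega, trivial⟩
  · obtain ⟨h1, rfl⟩ := h; rfl
  · obtain ⟨h1, rfl⟩ := h; rfl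

theorem sum_antidiagonal_comm {M : Type*} [AddCommMonoid M] (f : ℕ → ℕ → M) (l : ℕ) :
    ∑ p ∈ antidiagonal l, f p.1 p.2 = ∑ p ∈ antidiagonal l, f p.2 p.1 :=
  (Finset.Nat.sum_antidiagonal_swap (f := fun p => f p.1 p.2) (n := l)).symm

theorem sum_range_eq_sum_antidiagonal {M : Type*} [AddCommMonoid M] (f : ℕ → ℕ → M) (n : ℕ) :
    ∑ k ∈ Finset.range (n + 1), f k (n - k) = ∑ p ∈ antidiagonal n, f p.1 p.2 :=
  (Finset.Nat.sum_antidiagonal_eq_sum_range_succ f n).symm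

/-- The row operator given by the Kaluza weights is a contraction from the direct sum of shifted
Dirichlet norms. -/
theorem sum_weighted_row_le {K : Type*} [NormedAddCommGroup K] [NormedSpace ℂ K] (d : ℕ → ℝ)
    (hd : ∀ k, 0 ≤ d k)
    (hd' : ∀ l : ℕ, ∑ p ∈ antidiagonal l, d p.1 * (1 / ((p.2 : ℝ) + 1)) = 1 / ((l : ℝ) + 2))
    (y : ℕ → ℕ → K) (N : ℕ) :
    ∑ m ∈ Finset.range N,
      ((m : ℝ) + 2) * ‖∑ p ∈ antidiagonal m, (√(d p.1) : ℂ) • y p.2 p.1‖ ^ 2 ≤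
      ∑ m ∈ Finset.range N, ((m : ℝ) + 1) * ∑ k ∈ Finset.range N, ‖y m k‖ ^ 2 := by
  have h1 : ∀ m : ℕ, ((m : ℝ) + 2) * ‖∑ p ∈ antidiagonal m, (√(d p.1) : ℂ) • y p.2 p.1‖ ^ 2 ≤
      ∑ p ∈ antidiagonal m, ((p.2 : ℝ) + 1) * ‖y p.2 p.1‖ ^ 2 := fun m => by
    have h2 : ‖∑ p ∈ antidiagonal m, (√(d p.1) : ℂ) • y p.2 p.1‖ ≤
        ∑ p ∈ antidiagonal m, (√(d p.1) * √(1 / ((p.2 : ℝ) + 1))) *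
          (√((p.2 : ℝ) + 1) * ‖y p.2 p.1‖) := by
      refine (norm_sum_le _ _).trans (Finset.sum_le_sum fun p _ => le_of_eq ?_)
      rw [norm_smul, Complex.norm_real, Real.norm_of_nonneg (Real.sqrt_nonneg _)]
      have : √(1 / ((p.2 : ℝ) + 1)) * √((p.2 : ℝ) + 1) = 1 := by
        rw [← Real.sqrt_mul (by positivity), one_div_mul_cancel (by positivity), Real.sqrt_one]
      linear_combination (-(√(d p.1) * ‖y p.2 p.1‖)) * this
    have h3 := (pow_le_pow_left₀ (norm_nonneg _) h2 2).trans (Finset.sum_mul_sq_le_sq_mul_sq _ _ _)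
    have h4 : ∑ p ∈ antidiagonal m, (√(d p.1) * √(1 / ((p.2 : ℝ) + 1))) ^ 2 =
        1 / ((m : ℝ) + 2) := by
      rw [← hd']
      refine Finset.sum_congr rfl fun p _ => ?_
      rw [mul_pow, Real.sq_sqrt (hd _), Real.sq_sqrt (by positivity)]
    have h5 : ∑ p ∈ antidiagonal m, (√((p.2 : ℝ) + 1) * ‖y p.2 p.1‖) ^ 2 =
        ∑ p ∈ antidiagonal m, ((p.2 : ℝ) + 1) * ‖y p.2 p.1‖ ^ 2 :=
      Finset.sum_congr rfl fun p _ => by rw [mul_pow, Real.sq_sqrt (by positivity)]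
    rw [h4, h5] at h3
    calc _ ≤ ((m : ℝ) + 2) * _ := mul_le_mul_of_nonneg_left h3 (by positivity)
      _ = _ := by field_simp
  refine (Finset.sum_le_sum fun m _ => h1 m).trans ?_
  simp only [Finset.mul_sum]
  rw [Finset.sum_sigma', ← Finset.sum_product' (Finset.range N) (Finset.range N)
    (fun m k => ((m : ℝ) + 1) * ‖y m k‖ ^ 2)]
  have hinj : Set.InjOn (fun x : Σ _ : ℕ, ℕ × ℕ => (x.2.2, x.2.1))
      ((Finset.range N).sigma fun m => antidiagonal m : Finset (Σ _ : ℕ, ℕ × ℕ)) := by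
    rintro ⟨m, a, b⟩ h ⟨m', a', b'⟩ h' he
    simp only [Finset.coe_sigma, Set.mem_sigma_iff, Finset.mem_coe, mem_antidiagonal] at h h'
    simp only [Prod.mk.injEq] at he
    obtain ⟨rfl, rfl⟩ := he
    obtain ⟨-, rfl⟩ := h
    obtain ⟨-, rfl⟩ := h'
    rfl
  rw [← Finset.sum_image (f := fun x : ℕ × ℕ => ((x.1 : ℝ) + 1) * ‖y x.1 x.2‖ ^ 2) hinj]
  refine Finset.sum_le_sum_of_subset_of_nonneg ?_ fun _ _ _ => by positivity
  intro x hx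
  simp only [Finset.mem_image, Finset.mem_sigma, Finset.mem_range, mem_antidiagonal] at hx
  obtain ⟨⟨m, a, b⟩, ⟨h1, h2⟩, rfl⟩ := hx
  simp only [Finset.mem_product, Finset.mem_range] at h1 h2 ⊢
  omega

theorem exists_multiplier_of_gram {E K : Type*} [NormedAddCommGroup E] [InnerProductSpace ℂ E]
    [CompleteSpace E] [NormedAddCommGroup K] [InnerProductSpace ℂ K] [CompleteSpace K]
    (Fc : ℕ → E) (Φ : ℕ → ℂ) (C : ℝ) (R : ℕ → K) (d : ℕ → ℝ) (hd : ∀ k, 0 ≤ d k)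
    (hd' : ∀ l : ℕ, ∑ p ∈ antidiagonal l, d p.1 * (1 / ((p.2 : ℝ) + 1)) = 1 / ((l : ℝ) + 2))
    (hG : ∀ m n, Φ m * star (Φ n) + inner ℂ (R m) (R n) = (C : ℂ) ^ 2 * inner ℂ (Fc m) (Fc n) +
      ∑ k ∈ Finset.range (min m n), (d k : ℂ) * inner ℂ (R (m - 1 - k)) (R (n - 1 - k))) :
    ∃ G : ℕ → E, (∀ l, ∑ p ∈ antidiagonal l, C * inner ℂ (Fc p.1) (G p.2) = Φ l) ∧
      ∀ (h : ℕ → ℂ) N, ∑ n ∈ Finset.range N,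
        ((n : ℝ) + 1) * ‖∑ p ∈ antidiagonal n, h p.1 • G p.2‖ ^ 2 ≤
        ∑ n ∈ Finset.range N, ((n : ℝ) + 1) * ‖h n‖ ^ 2 := by
  obtain ⟨W₁, W₂, hW, hid⟩ := exists_colligation Fc Φ C R (fun k => √(d k)) fun m n => by
    rw [hG m n]
    congr 1
    refine Finset.sum_congr rfl fun k _ => ?_
    rw [← Complex.ofReal_pow, Real.sq_sqrt (hd k)]
  let st : ℕ → (ℕ → ℕ → K) → K := fun n y => match n with
    | 0 => 0
    | m + 1 => ∑ p ∈ antidiagonal m, (√(d p.1) : ℂ) • y p.2 p.1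
  let δ : ℕ → ℂ := fun n => if n = 0 then 1 else 0
  have : Inhabited K := ⟨0⟩
  obtain ⟨y, hy⟩ := exists_eq_of_causal (fun n (y : ℕ → ℕ → K) => W₂ (δ n, st n y))
    (fun n y y' h => by
      rcases n with _ | m
      · rfl
      · have : st (m + 1) y = st (m + 1) y' := Finset.sum_congr rfl fun p hp => by
          rw [h p.2 (by have := mem_antidiagonal.1 hp; omega)]
        simp only [this])
  let G : ℕ → E := fun n => W₁ (δ n, st n y)
  refine ⟨G, fun l => ?_, fun h N => ?_⟩
  · have h1 : ∑ p ∈ antidiagonal l, (Φ p.1 * δ p.2 + inner ℂ (R p.1) (st p.2 y)) =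
        ∑ p ∈ antidiagonal l, (C * inner ℂ (Fc p.1) (G p.2) + ∑ k ∈ Finset.range p.1,
          (√(d k) : ℂ) * inner ℂ (R (p.1 - 1 - k)) (y p.2 k)) :=
      Finset.sum_congr rfl fun p _ => by rw [hid p.1 (δ p.2, st p.2 y), hy p.2]
    rw [Finset.sum_add_distrib, Finset.sum_add_distrib] at h1
    have h2 : ∑ p ∈ antidiagonal l, Φ p.1 * δ p.2 = Φ l := by
      rw [Finset.sum_eq_single (l, 0)]
      · simp [δ]
      · rintro ⟨a, b⟩ hp hne
        rw [mem_antidiagonal] at hp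
        have : b ≠ 0 := by rintro rfl; simp_all
        simp [δ, this]
      · simp
    have h3 : ∑ p ∈ antidiagonal l, inner ℂ (R p.1) (st p.2 y) =
        ∑ p ∈ antidiagonal l, ∑ k ∈ Finset.range p.1,
          (√(d k) : ℂ) * inner ℂ (R (p.1 - 1 - k)) (y p.2 k) := by
      rcases l with _ | l
      · simp [st]
      · rw [Finset.Nat.sum_antidiagonal_succ', Finset.Nat.sum_antidiagonal_succ]
        simp only [st, inner_zero_right, Finset.range_zero, Finset.sum_empty, zero_add,
          inner_sum, inner_smul_right]
        have e : ∀ a m, ∑ k ∈ Finset.range (a + 1), (√(d k) : ℂ) * inner ℂ (R (a - k)) (y m k) =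
            ∑ q ∈ antidiagonal a, (√(d q.1) : ℂ) * inner ℂ (R q.2) (y m q.1) := fun a m =>
          sum_range_eq_sum_antidiagonal (fun k i => (√(d k) : ℂ) * inner ℂ (R i) (y m k)) a
        simp only [Nat.add_sub_cancel, e]
        rw [sum_antidiagonal_assoc fun n k j => (√(d k) : ℂ) * inner ℂ (R n) (y j k)]
        refine Finset.sum_congr rfl fun p _ => ?_
        exact sum_antidiagonal_comm (fun n k => (√(d k) : ℂ) * inner ℂ (R n) (y p.2 k)) _
    rw [h2, h3] at h1
    exact (add_right_cancel h1).symm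
  · let yh : ℕ → ℕ → K := fun n => ∑ p ∈ antidiagonal n, h p.1 • y p.2
    have hst : ∀ n, ∑ p ∈ antidiagonal n, h p.1 • st p.2 y = st n yh := fun n => by
      rcases n with _ | n
      · simp [st]
      · rw [Finset.Nat.sum_antidiagonal_succ']
        simp only [st, smul_zero, zero_add, yh, Finset.sum_apply, Finset.smul_sum, Pi.smul_apply]
        simp only [smul_comm (h _)]
        rw [sum_antidiagonal_assoc fun n k j => (√(d k) : ℂ) • h n • y j k,
          sum_antidiagonal_assoc fun k n j => (√(d k) : ℂ) • h n • y j k]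
        refine Finset.sum_congr rfl fun p _ => ?_
        exact sum_antidiagonal_comm (fun n k => (√(d k) : ℂ) • h n • y p.2 k) _
    have hδ : ∀ n, ∑ p ∈ antidiagonal n, h p.1 • δ p.2 = h n := fun n => by
      rw [Finset.sum_eq_single (n, 0)]
      · simp [δ]
      · rintro ⟨a, b⟩ hp hne
        rw [mem_antidiagonal] at hp
        have : b ≠ 0 := by rintro rfl; simp_all
        simp [δ, this]
      · simp
    have hp : ∀ n, ∑ p ∈ antidiagonal n, h p.1 • ((δ p.2, st p.2 y) : ℂ × K) = (h n, st n yh) :=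
      fun n => by
        ext
        · rw [Prod.fst_sum]; exact hδ n
        · rw [Prod.snd_sum]; exact hst n
    have hGn : ∀ n, ∑ p ∈ antidiagonal n, h p.1 • G p.2 = W₁ (h n, st n yh) := fun n => by
      rw [← hp, map_sum]
      exact Finset.sum_congr rfl fun p _ => (map_smul _ _ _).symm
    have hyn : ∀ n, yh n = W₂ (h n, st n yh) := fun n => by
      rw [← hp, map_sum]
      exact Finset.sum_congr rfl fun p _ => by rw [map_smul, ← hy p.2]
    have h1 : ∀ n, ‖∑ p ∈ antidiagonal n, h p.1 • G p.2‖ ^ 2 + ∑ k ∈ Finset.range N, ‖yh n k‖ ^ 2 ≤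
        ‖h n‖ ^ 2 + ‖st n yh‖ ^ 2 := fun n => by
      rw [hGn, hyn]
      exact hW (h n, st n yh) N
    have h2 : ∑ n ∈ Finset.range N, ((n : ℝ) + 1) * ‖st n yh‖ ^ 2 ≤
        ∑ n ∈ Finset.range N, ((n : ℝ) + 1) * ∑ k ∈ Finset.range N, ‖yh n k‖ ^ 2 := by
      refine le_trans ?_ (sum_weighted_row_le d hd hd' yh N)
      rcases N with _ | N
      · simp
      · rw [Finset.sum_range_succ', Finset.sum_range_succ]
        simp only [st, norm_zero]
        norm_num [add_assoc]
        positivity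
    have h3 := Finset.sum_le_sum fun n (_ : n ∈ Finset.range N) =>
      mul_le_mul_of_nonneg_left (h1 n) (by positivity : 0 ≤ (n : ℝ) + 1)
    simp only [mul_add, Finset.sum_add_distrib] at h3
    linarith

/-- Gram kernel of the Dirichlet-weighted Toeplitz rows of a sequence of vectors. -/
noncomputable def rowKernel {E : Type*} [NormedAddCommGroup E] [InnerProductSpace ℂ E] (A : ℕ → E)
    (m n : ℕ) : ℂ :=
  ∑ l ∈ Finset.range (min m n + 1), (1 / ((l : ℂ) + 1)) * inner ℂ (A (m - l)) (A (n - l))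

section rowKernel

variable {E : Type*} [NormedAddCommGroup E] [InnerProductSpace ℂ E]

theorem star_rowKernel (A : ℕ → E) (m n : ℕ) : star (rowKernel A m n) = rowKernel A n m := by
  simp only [rowKernel, star_sum, min_comm n m, RCLike.star_def, map_mul, inner_conj_symm]
  simp

theorem rowKernel_add (A : ℕ → E) {p q : ℕ} (h : min p q = 0) (s : ℕ) :
    rowKernel A (p + s) (q + s) = ∑ x ∈ antidiagonal s,
      (1 / ((x.1 : ℂ) + 1)) * inner ℂ (A (p + x.2)) (A (q + x.2)) := by
  rw [← sum_range_eq_sum_antidiagonal fun a b =>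
    (1 / ((a : ℂ) + 1)) * inner ℂ (A (p + b)) (A (q + b)), rowKernel,
    show min (p + s) (q + s) = s by omega]
  refine Finset.sum_congr rfl fun l hl => ?_
  have := Finset.mem_range.1 hl
  rw [Nat.add_sub_assoc (by omega), Nat.add_sub_assoc (by omega)]

theorem rowKernel_rec (d : ℕ → ℝ)
    (hd' : ∀ l : ℕ, ∑ p ∈ antidiagonal l, d p.1 * (1 / ((p.2 : ℝ) + 1)) = 1 / ((l : ℝ) + 2))
    (A : ℕ → E) (m n : ℕ) :
    rowKernel A m n = inner ℂ (A m) (A n) +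
      ∑ k ∈ Finset.range (min m n), (d k : ℂ) * rowKernel A (m - 1 - k) (n - 1 - k) := by
  obtain ⟨p, q, s, rfl, rfl, h⟩ : ∃ p q s, m = p + s ∧ n = q + s ∧ min p q = 0 :=
    ⟨m - min m n, n - min m n, min m n, by omega, by omega, by omega⟩
  rw [show min (p + s) (q + s) = s by omega, rowKernel_add A h]
  rcases s with _ | s
  · simp
  · have e : ∀ k ∈ Finset.range (s + 1), (d k : ℂ) *
        rowKernel A (p + (s + 1) - 1 - k) (q + (s + 1) - 1 - k) =
        d k * rowKernel A (p + (s - k)) (q + (s - k)) := fun k hk => by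
      have := Finset.mem_range.1 hk
      rw [show p + (s + 1) - 1 - k = p + (s - k) by omega,
        show q + (s + 1) - 1 - k = q + (s - k) by omega]
    rw [Finset.sum_congr rfl e, Finset.Nat.sum_antidiagonal_succ,
      sum_range_eq_sum_antidiagonal (fun k t => (d k : ℂ) * rowKernel A (p + t) (q + t))]
    simp only [rowKernel_add A h, Finset.mul_sum]
    rw [sum_antidiagonal_assoc fun k i b =>
      (d k : ℂ) * ((1 / ((i : ℂ) + 1)) * inner ℂ (A (p + b)) (A (q + b)))]
    congr 1
    · simp
    · refine Finset.sum_congr rfl fun x _ => ?_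
      have h1 : (1 / (((x.1 + 1 : ℕ) : ℂ) + 1)) =
          ∑ p ∈ antidiagonal x.1, (d p.1 : ℂ) * (1 / ((p.2 : ℂ) + 1)) := by
        have := congrArg (fun t : ℝ => (t : ℂ)) (hd' x.1)
        push_cast at this ⊢
        rw [this]
        congr 1
        ring
      rw [h1, Finset.sum_mul]
      exact Finset.sum_congr rfl fun _ _ => by ring

theorem sum_rowKernel (A : ℕ → E) (c : ℕ → ℂ) (N : ℕ) :
    ∑ m ∈ Finset.range N, ∑ n ∈ Finset.range N, star (c m) * c n * rowKernel A m n =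
      ((∑ l ∈ Finset.range N, 1 / ((l : ℝ) + 1) *
        ‖∑ n ∈ Finset.range N, c n • (if l ≤ n then A (n - l) else 0)‖ ^ 2 : ℝ) : ℂ) := by
  have h1 : ∀ m ∈ Finset.range N, ∀ n ∈ Finset.range N, rowKernel A m n =
      ∑ l ∈ Finset.range N, (1 / ((l : ℂ) + 1)) * inner ℂ (if l ≤ m then A (m - l) else 0)
        (if l ≤ n then A (n - l) else 0) := fun m hm n hn => by
    rw [Finset.mem_range] at hm hn
    rw [rowKernel]
    refine Finset.sum_subset_zero_on_sdiff (Finset.range_subset_range.2 (by omega)) ?_ ?_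
    · intro l hl
      simp only [Finset.mem_sdiff, Finset.mem_range] at hl
      by_cases h : l ≤ m
      · have : ¬ l ≤ n := by omega
        simp [this]
      · simp [h]
    · intro l hl
      have := Finset.mem_range.1 hl
      rw [if_pos (by omega), if_pos (by omega)]
  have h2 : ∀ l, ((‖∑ n ∈ Finset.range N, c n • (if l ≤ n then A (n - l) else 0)‖ : ℂ)) ^ 2 =
      ∑ m ∈ Finset.range N, ∑ n ∈ Finset.range N, star (c m) * c n *
        inner ℂ (if l ≤ m then A (m - l) else 0) (if l ≤ n then A (n - l) else 0) := fun l => by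
    rw [← Complex.coe_algebraMap, ← inner_self_eq_norm_sq_to_K]
    simp only [sum_inner, inner_sum, inner_smul_left, inner_smul_right, mul_assoc, RCLike.star_def]
    simp only [Finset.mul_sum]
    rw [Finset.sum_comm]
    exact Finset.sum_congr rfl fun _ _ => Finset.sum_congr rfl fun _ _ => by ring
  push_cast
  simp only [h2, Finset.mul_sum]
  symm
  rw [Finset.sum_comm]
  refine Finset.sum_congr rfl fun m hm => ?_
  rw [Finset.sum_comm]
  refine Finset.sum_congr rfl fun n hn => ?_
  rw [h1 m hm n hn, Finset.mul_sum]
  exact Finset.sum_congr rfl fun _ _ => by ring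

end rowKernel

/-- A Leech-type factorization theorem for the Dirichlet space, at the level of coefficients. -/
theorem exists_multiplier_of_range_inclusion {E : Type*} [NormedAddCommGroup E]
    [InnerProductSpace ℂ E] [CompleteSpace E] (Fc : ℕ → E) (Φ : ℕ → ℂ) (C : ℝ)
    (hle : ∀ N (c : ℕ → ℂ), ∑ l ∈ Finset.range N, 1 / ((l : ℝ) + 1) *
        ‖∑ n ∈ Finset.range N, c n • (if l ≤ n then star (Φ (n - l)) else 0)‖ ^ 2 ≤
      C ^ 2 * ∑ l ∈ Finset.range N, 1 / ((l : ℝ) + 1) *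
        ‖∑ n ∈ Finset.range N, c n • (if l ≤ n then Fc (n - l) else 0)‖ ^ 2) :
    ∃ G : ℕ → E, (∀ l, ∑ p ∈ antidiagonal l, C * inner ℂ (Fc p.1) (G p.2) = Φ l) ∧
      ∀ (h : ℕ → ℂ) N, ∑ n ∈ Finset.range N,
        ((n : ℝ) + 1) * ‖∑ p ∈ antidiagonal n, h p.1 • G p.2‖ ^ 2 ≤
        ∑ n ∈ Finset.range N, ((n : ℝ) + 1) * ‖h n‖ ^ 2 := by
  obtain ⟨d, hd, hd'⟩ := exists_kaluza
  let Φ' : ℕ → ℂ := fun n => star (Φ n)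
  obtain ⟨K, _, _, _, R, hR⟩ := exists_gram_vectors
    (fun m n => (C : ℂ) ^ 2 * rowKernel Fc m n - rowKernel Φ' m n)
    (fun m n => by
      rw [star_sub, star_mul', star_rowKernel, star_rowKernel, star_pow]
      simp)
    (fun c => by
      obtain ⟨N, hN⟩ : ∃ N, c.support ⊆ Finset.range N :=
        ⟨c.support.sup id + 1, fun x hx => Finset.mem_range.2
          (Nat.lt_succ_of_le (Finset.le_sup (f := id) hx))⟩
      have h1 : (c.sum fun m x => c.sum fun n y => star x * y *
          ((C : ℂ) ^ 2 * rowKernel Fc m n - rowKernel Φ' m n)) =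
          (C : ℂ) ^ 2 * ∑ m ∈ Finset.range N, ∑ n ∈ Finset.range N,
            star (c m) * c n * rowKernel Fc m n -
          ∑ m ∈ Finset.range N, ∑ n ∈ Finset.range N, star (c m) * c n * rowKernel Φ' m n := by
        rw [Finsupp.sum_of_support_subset c hN _ (by simp)]
        simp only [Finset.mul_sum, ← Finset.sum_sub_distrib]
        refine Finset.sum_congr rfl fun m _ => ?_
        rw [Finsupp.sum_of_support_subset c hN _ (by simp)]
        exact Finset.sum_congr rfl fun n _ => by ring
      rw [h1, sum_rowKernel, sum_rowKernel, ← Complex.ofReal_pow, ← Complex.ofReal_mul,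
        ← Complex.ofReal_sub, Complex.ofReal_re, sub_nonneg]
      exact hle N c)
  refine exists_multiplier_of_gram Fc Φ C R d hd hd' fun m n => ?_
  simp only [hR]
  have h1 : Φ m * star (Φ n) = inner ℂ (Φ' m) (Φ' n) := by
    simp [Φ', RCLike.inner_apply, mul_comm]
  rw [h1, rowKernel_rec d hd' Fc m n, rowKernel_rec d hd' Φ' m n]
  simp only [mul_sub, Finset.sum_sub_distrib, mul_add, Finset.mul_sum]
  have h2 : ∀ k, (C : ℂ) ^ 2 * (d k * rowKernel Fc (m - 1 - k) (n - 1 - k)) =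
    d k * ((C : ℂ) ^ 2 * rowKernel Fc (m - 1 - k) (n - 1 - k)) := fun k => by ring
  simp only [h2]
  ring

/-- Normalized area measure on the unit disk. -/
noncomputable def diskMeasure : Measure ℂ :=
  ENNReal.ofReal Real.pi⁻¹ • (volume.restrict (ball (0 : ℂ) 1))

/-- Normalized arc length on the unit circle. -/
noncomputable def arcMeasure : Measure ℂ :=
  Measure.map (fun θ : ℝ => exp (θ * I))
    (ENNReal.ofReal (2 * Real.pi)⁻¹ • (volume.restrict (Set.Ioc (-Real.pi) Real.pi)))

instance : IsFiniteMeasure diskMeasure := by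
  have : IsFiniteMeasure ((volume : Measure ℂ).restrict (ball (0 : ℂ) 1)) :=
    ⟨by rw [Measure.restrict_apply_univ]; exact measure_ball_lt_top⟩
  exact Measure.smul_finite _ ENNReal.ofReal_ne_top

instance : IsFiniteMeasure arcMeasure := by
  have : IsFiniteMeasure (ENNReal.ofReal (2 * Real.pi)⁻¹ •
    ((volume : Measure ℝ).restrict (Set.Ioc (-Real.pi) Real.pi))) :=
    Measure.smul_finite _ ENNReal.ofReal_ne_top
  exact Measure.isFiniteMeasure_map _ _

theorem ae_diskMeasure : ∀ᵐ z ∂diskMeasure, ‖z‖ ≤ 1 := by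
  refine Measure.ae_smul_measure ?_ _
  filter_upwards [ae_restrict_mem measurableSet_ball] with z hz
  exact (mem_ball_zero_iff.1 hz).le

theorem continuous_expMulI : Continuous fun θ : ℝ => exp (θ * I) := by fun_prop

theorem ae_arcMeasure : ∀ᵐ z ∂arcMeasure, ‖z‖ = 1 := by
  refine (ae_map_iff continuous_expMulI.aemeasurable ?_).2 ?_
  · exact (isClosed_eq continuous_norm continuous_const).measurableSet
  · exact Filter.Eventually.of_forall fun θ => norm_exp_ofReal_mul_I θ

theorem ae_arcMeasure_le : ∀ᵐ z ∂arcMeasure, ‖z‖ ≤ 1 := ae_arcMeasure.mono fun _ h => h.le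

theorem integrable_of_continuous {E : Type*} [NormedAddCommGroup E] {ν : Measure ℂ}
    [IsFiniteMeasure ν] (hν : ∀ᵐ z ∂ν, ‖z‖ ≤ 1) {V : ℂ → E} (hV : Continuous V) :
    Integrable V ν := by
  have h : ν.restrict (closedBall 0 1) = ν :=
    Measure.restrict_eq_self_of_ae_mem (hν.mono fun z hz => mem_closedBall_zero_iff.2 hz)
  have := hV.continuousOn.integrableOn_compact (μ := ν) (isCompact_closedBall (0 : ℂ) 1)
  rwa [IntegrableOn, h] at this

theorem integral_arcMeasure {V : ℂ → ℂ} (hV : Continuous V) : ∫ z, V z ∂arcMeasure =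
    ((2 * Real.pi)⁻¹ : ℝ) * ∫ θ in (-Real.pi)..Real.pi, V (exp (θ * I)) := by
  rw [arcMeasure, integral_map continuous_expMulI.aemeasurable hV.aestronglyMeasurable,
    integral_smul_measure, intervalIntegral.integral_of_le (by linarith [Real.pi_pos]),
    ENNReal.toReal_ofReal (by positivity), Complex.real_smul]

theorem integral_diskMeasure {V : ℂ → ℂ} (hV : Continuous V) : ∫ z, V z ∂diskMeasure =
    (Real.pi⁻¹ : ℝ) * ∫ r in (0 : ℝ)..1, ∫ θ in (-Real.pi)..Real.pi,
      (r : ℂ) * V (r * exp (θ * I)) := by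
  rw [diskMeasure, integral_smul_measure, ENNReal.toReal_ofReal (by positivity), Complex.real_smul]
  congr 1
  rw [← integral_indicator measurableSet_ball, ← Complex.integral_comp_polarCoord_symm,
    show _root_.polarCoord.target = Set.Ioi (0 : ℝ) ×ˢ Set.Ioo (-Real.pi) Real.pi from rfl]
  have h1 : ∀ p ∈ Set.Ioi (0 : ℝ) ×ˢ Set.Ioo (-Real.pi) Real.pi,
      p.1 • (ball (0 : ℂ) 1).indicator V (Complex.polarCoord.symm p) =
      (Set.Ioo (0 : ℝ) 1 ×ˢ Set.Ioo (-Real.pi) Real.pi).indicator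
        (fun p : ℝ × ℝ => (p.1 : ℂ) * V (p.1 * exp (p.2 * I))) p := by
    rintro ⟨r, θ⟩ ⟨hr, hθ⟩
    simp only [Set.mem_Ioi] at hr
    have h2 : Complex.polarCoord.symm (r, θ) = r * exp (θ * I) := by
      rw [Complex.polarCoord_symm_apply, Complex.exp_mul_I]; simp
    rw [h2]
    by_cases hr1 : r < 1
    · rw [Set.indicator_of_mem, Set.indicator_of_mem, Complex.real_smul]
      · exact ⟨⟨hr, hr1⟩, hθ⟩
      · simp [norm_exp_ofReal_mul_I, abs_of_pos hr, hr1]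
    · rw [Set.indicator_of_notMem, Set.indicator_of_notMem, smul_zero]
      · exact fun h => hr1 h.1.2
      · simpa [norm_exp_ofReal_mul_I, abs_of_pos hr] using hr1
  rw [setIntegral_congr_fun (measurableSet_Ioi.prod measurableSet_Ioo) h1,
    setIntegral_indicator (measurableSet_Ioo.prod measurableSet_Ioo),
    Set.inter_eq_right.2 (Set.prod_mono (fun x hx => hx.1) le_rfl), Measure.volume_eq_prod,
    setIntegral_prod]
  · simp only [intervalIntegral.integral_of_le (zero_le_one (α := ℝ)),
      intervalIntegral.integral_of_le (show -Real.pi ≤ Real.pi by linarith [Real.pi_pos]),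
      integral_Ioc_eq_integral_Ioo]
  · refine IntegrableOn.mono_set (t := Set.Icc (0 : ℝ) 1 ×ˢ Set.Icc (-Real.pi) Real.pi) ?_
      (Set.prod_mono Set.Ioo_subset_Icc_self Set.Ioo_subset_Icc_self)
    exact ContinuousOn.integrableOn_compact (isCompact_Icc.prod isCompact_Icc)
      (Continuous.continuousOn (by fun_prop))

/-- `V` is real differentiable with Wirtinger derivatives `∂V = P` and `∂̄V = Q`. -/
def HasWirtinger (V P Q : ℂ → ℂ) : Prop :=
  ∀ z, HasFDerivAt V
    (P z • ContinuousLinearMap.id ℝ ℂ + Q z • (conjCLE : ℂ →L[ℝ] ℂ)) z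

namespace HasWirtinger

variable {V P Q V' P' Q' : ℂ → ℂ}

theorem continuous (h : HasWirtinger V P Q) : Continuous V :=
  continuous_iff_continuousAt.2 fun z => (h z).continuousAt

theorem comp_hasDerivAt (h : HasWirtinger V P Q) {γ : ℝ → ℂ} {γ' : ℂ} {t : ℝ}
    (hγ : HasDerivAt γ γ' t) :
    HasDerivAt (fun s => V (γ s)) (P (γ t) * γ' + Q (γ t) * (starRingEnd ℂ) γ') t := by
  have := (h (γ t)).comp_hasDerivAt t hγ
  exact this.congr_deriv (by simp)

theorem congr (h : HasWirtinger V P Q) (hP : ∀ z, P z = P' z) (hQ : ∀ z, Q z = Q' z) :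
    HasWirtinger V P' Q' := by
  obtain rfl : P = P' := funext hP
  obtain rfl : Q = Q' := funext hQ
  exact h

theorem mul (h : HasWirtinger V P Q) (h' : HasWirtinger V' P' Q') :
    HasWirtinger (fun z => V z * V' z) (fun z => P z * V' z + V z * P' z)
      (fun z => Q z * V' z + V z * Q' z) := fun z => by
  exact ((h z).mul (h' z)).congr_fderiv (ContinuousLinearMap.ext fun w => by simp; ring)

theorem conj (h : HasWirtinger V P Q) :
    HasWirtinger (fun z => (starRingEnd ℂ) (V z)) (fun z => (starRingEnd ℂ) (Q z))
      (fun z => (starRingEnd ℂ) (P z)) := fun z => by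
  exact ((conjCLE : ℂ →L[ℝ] ℂ).hasFDerivAt.comp z (h z)).congr_fderiv
    (ContinuousLinearMap.ext fun w => by simp; ring)

theorem sum {ι : Type*} (s : Finset ι) {V P Q : ι → ℂ → ℂ}
    (h : ∀ i ∈ s, HasWirtinger (V i) (P i) (Q i)) :
    HasWirtinger (fun z => ∑ i ∈ s, V i z) (fun z => ∑ i ∈ s, P i z)
      (fun z => ∑ i ∈ s, Q i z) := fun z => by
  exact (HasFDerivAt.fun_sum fun i hi => h i hi z).congr_fderiv
    (ContinuousLinearMap.ext fun w => by
      simp [Finset.sum_mul, Finset.sum_add_distrib])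

theorem inv (h : HasWirtinger V P Q) (h0 : ∀ z, V z ≠ 0) :
    HasWirtinger (fun z => (V z)⁻¹) (fun z => -P z / V z ^ 2) (fun z => -Q z / V z ^ 2) :=
  fun z => by
  have h1 := ((hasDerivAt_inv (h0 z)).hasFDerivAt.restrictScalars ℝ).comp z (h z)
  exact h1.congr_fderiv (ContinuousLinearMap.ext fun w => by simp; ring)

theorem polynomial (p : Polynomial ℂ) :
    HasWirtinger (fun z => p.eval z) (fun z => p.derivative.eval z) (fun _ => 0) := fun z => by
  exact ((p.hasDerivAt z).hasFDerivAt.restrictScalars ℝ).congr_fderiv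
    (ContinuousLinearMap.ext fun w => by simp [mul_comm])

end HasWirtinger

theorem hasDerivAt_expMulI (θ : ℝ) :
    HasDerivAt (fun θ : ℝ => exp (θ * I)) (I * exp (θ * I)) θ := by
  have h := ((hasDerivAt_id (θ : ℂ)).mul_const I).cexp.comp_ofReal
  simpa [mul_comm] using h

/-- Green's formula on the unit disk. -/
theorem HasWirtinger.green {V P Q : ℂ → ℂ} (h : HasWirtinger V P Q) (hP : Continuous P)
    (hQ : Continuous Q) : ∫ z, z * V z ∂arcMeasure = ∫ z, Q z ∂diskMeasure := by
  have hV := h.continuous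
  rw [integral_arcMeasure (by fun_prop), integral_diskMeasure hQ]
  have hE : Continuous fun θ : ℝ => exp (θ * I) := continuous_expMulI
  have hEE : ∀ θ : ℝ, exp (θ * I) * (starRingEnd ℂ) (exp (θ * I)) = 1 := fun θ => by
    rw [mul_conj, normSq_eq_norm_sq, norm_exp_ofReal_mul_I]; simp
  have hE' := hasDerivAt_expMulI
  have hper : exp ((Real.pi : ℝ) * I) = exp ((-Real.pi : ℝ) * I) := by simp [exp_neg]
  obtain ⟨E, hEdef⟩ : ∃ E : ℝ → ℂ, E = fun θ : ℝ => exp (θ * I) := ⟨_, rfl⟩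
  have hEθ : ∀ θ : ℝ, exp (θ * I) = E θ := fun θ => (congrFun hEdef θ).symm
  simp only [hEθ] at hE hEE hE' hper ⊢
  clear hEdef hEθ
  obtain ⟨Ar, hArd⟩ : ∃ Ar : ℝ → ℝ → ℂ, ∀ r θ, Ar r θ = E θ * V (r * E θ) + r * E θ *
    (P (r * E θ) * E θ + Q (r * E θ) * (starRingEnd ℂ) (E θ)) := ⟨_, fun _ _ => rfl⟩
  obtain ⟨Bt, hBtd⟩ : ∃ Bt : ℝ → ℝ → ℂ, ∀ r θ, Bt r θ = I * (I * E θ) * V (r * E θ) + I * E θ *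
    (P (r * E θ) * (r * (I * E θ)) + Q (r * E θ) * (starRingEnd ℂ) (r * (I * E θ))) :=
    ⟨_, fun _ _ => rfl⟩
  have hA : ∀ r θ : ℝ, HasDerivAt (fun r : ℝ => r * E θ * V (r * E θ)) (Ar r θ) r := fun r θ => by
    have h1 : HasDerivAt (fun r : ℝ => (r : ℂ) * E θ) (E θ) r := by
      simpa using (ofRealCLM.hasDerivAt (x := r)).mul_const (E θ)
    exact (h1.mul (h.comp_hasDerivAt h1)).congr_deriv (by simp only [hArd])
  have hB : ∀ r θ : ℝ, HasDerivAt (fun θ : ℝ => I * E θ * V (r * E θ)) (Bt r θ) θ := fun r θ => by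
    have h1 := hE' θ
    have h2 : HasDerivAt (fun θ : ℝ => (r : ℂ) * E θ) (r * (I * E θ)) θ := h1.const_mul _
    exact ((h1.const_mul I).mul (h.comp_hasDerivAt h2)).congr_deriv (by simp only [hBtd])
  have hAB : ∀ r θ : ℝ, 2 * (r * Q (r * E θ)) = Ar r θ + Bt r θ := fun r θ => by
    simp only [hArd, hBtd, map_mul, conj_ofReal, conj_I]
    linear_combination (-(2 * r * Q (r * E θ)) : ℂ) * hEE θ +
      (-(E θ * V (r * E θ) + r * P (r * E θ) * E θ ^ 2
        - r * Q (r * E θ) * (E θ * (starRingEnd ℂ) (E θ)))) * I_sq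
  have hAc : Continuous (Function.uncurry Ar) := by
    simp only [Function.uncurry_def, hArd]; fun_prop
  have hBc : Continuous (Function.uncurry Bt) := by
    simp only [Function.uncurry_def, hBtd]; fun_prop
  have hAr : ∀ r, Continuous (Ar r) := fun r => hAc.comp (by fun_prop : Continuous fun θ => (r, θ))
  have hBr : ∀ r, Continuous (Bt r) := fun r => hBc.comp (by fun_prop : Continuous fun θ => (r, θ))
  have h1 : ∀ r : ℝ, ∫ θ in (-Real.pi)..Real.pi, (r : ℂ) * Q (r * E θ) =
      (1 / 2 : ℂ) * ∫ θ in (-Real.pi)..Real.pi, Ar r θ := fun r => by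
    have h2 : ∫ θ in (-Real.pi)..Real.pi, Bt r θ = 0 := by
      rw [intervalIntegral.integral_eq_sub_of_hasDerivAt (fun θ _ => hB r θ)
        ((hBr r).intervalIntegrable _ _)]
      rw [hper, sub_self]
    have h3 : ∫ θ in (-Real.pi)..Real.pi, 2 * ((r : ℂ) * Q (r * E θ)) =
        ∫ θ in (-Real.pi)..Real.pi, Ar r θ := by
      simp only [hAB]
      rw [intervalIntegral.integral_add ((hAr r).intervalIntegrable _ _)
        ((hBr r).intervalIntegrable _ _), h2, add_zero]
    rw [intervalIntegral.integral_const_mul] at h3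
    rw [← h3]; ring
  have h4 : ∫ r in (0 : ℝ)..1, ∫ θ in (-Real.pi)..Real.pi, Ar r θ =
      ∫ θ in (-Real.pi)..Real.pi, E θ * V (E θ) := by
    rw [intervalIntegral_intervalIntegral_swap]
    · refine intervalIntegral.integral_congr fun θ _ => ?_
      rw [intervalIntegral.integral_eq_sub_of_hasDerivAt (fun r _ => hA r θ)]
      · simp
      · exact (hAc.comp (by fun_prop : Continuous fun r => (r, θ))).intervalIntegrable _ _
    · refine IntegrableOn.mono_set (t := Set.uIcc (0 : ℝ) 1 ×ˢ Set.uIcc (-Real.pi) Real.pi) ?_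
        (Set.prod_mono Set.uIoc_subset_uIcc Set.uIoc_subset_uIcc)
      exact ContinuousOn.integrableOn_compact (isCompact_uIcc.prod isCompact_uIcc) hAc.continuousOn
  have h5 : ∫ r in (0 : ℝ)..1, ∫ θ in (-Real.pi)..Real.pi, (r : ℂ) * Q (r * E θ) =
      (1 / 2 : ℂ) * ∫ θ in (-Real.pi)..Real.pi, E θ * V (E θ) := by
    simp only [h1]
    rw [intervalIntegral.integral_const_mul, h4]
  rw [h5]
  push_cast
  ring

theorem HasWirtinger.green_conj {V P Q : ℂ → ℂ} (h : HasWirtinger V P Q) (hP : Continuous P)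
    (hQ : Continuous Q) :
    ∫ z, (starRingEnd ℂ) z * V z ∂arcMeasure = ∫ z, P z ∂diskMeasure := by
  have h1 := congrArg (starRingEnd ℂ) (h.conj.green (by fun_prop) (by fun_prop))
  rw [← integral_conj, ← integral_conj] at h1
  simpa using h1

theorem integral_arcMeasure_one : ∫ _, (1 : ℂ) ∂arcMeasure = 1 := by
  rw [integral_arcMeasure continuous_const]
  simp only [intervalIntegral.integral_const, sub_neg_eq_add, real_smul, mul_one]
  rw [← Complex.ofReal_mul]
  have := Real.pi_ne_zero
  norm_cast
  field_simp
  norm_num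

theorem hasWirtinger_pow (n : ℕ) : HasWirtinger (fun z => z ^ n) (fun z => n * z ^ (n - 1))
    fun _ => 0 := by
  simpa [Polynomial.derivative_X_pow] using HasWirtinger.polynomial (Polynomial.X ^ n)

theorem integral_disk_pow_mul (a b : ℕ) :
    ((b : ℂ) + 1) * ∫ z, z ^ a * (starRingEnd ℂ) z ^ b ∂diskMeasure =
      ∫ z, z ^ (a + 1) * (starRingEnd ℂ) z ^ (b + 1) ∂arcMeasure := by
  have h := ((hasWirtinger_pow a).mul (hasWirtinger_pow (b + 1)).conj).green (by fun_prop)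
    (by fun_prop)
  rw [← integral_const_mul]
  simp only [Nat.add_sub_cancel, map_mul, map_pow, zero_mul, zero_add, map_natCast] at h
  rw [integral_congr_ae, ← h, integral_congr_ae]
  · exact Filter.Eventually.of_forall fun z => by simp only []; ring
  · exact Filter.Eventually.of_forall fun z => by simp only []; push_cast; ring

theorem integral_arc_pow_pos (a : ℕ) : ∫ z, z ^ (a + 1) ∂arcMeasure = 0 := by
  have h := (hasWirtinger_pow a).green (by fun_prop) (by fun_prop)
  simp only [integral_zero] at h
  simpa [pow_succ'] using h

theorem integral_arc_pow_mul (a b : ℕ) :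
    ∫ z, z ^ a * (starRingEnd ℂ) z ^ b ∂arcMeasure = if a = b then 1 else 0 := by
  have key : ∀ a k : ℕ, ∫ z, z ^ (a + k) * (starRingEnd ℂ) z ^ a ∂arcMeasure =
      ∫ z, z ^ k ∂arcMeasure := fun a k => integral_congr_ae <| by
    filter_upwards [ae_arcMeasure] with z hz
    have : z * (starRingEnd ℂ) z = 1 := by rw [mul_conj, normSq_eq_norm_sq, hz]; simp
    rw [pow_add, mul_right_comm, ← mul_pow, this, one_pow, one_mul]
  rcases lt_trichotomy a b with h | rfl | h
  · obtain ⟨k, rfl⟩ := Nat.exists_eq_add_of_lt h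
    rw [if_neg (by omega)]
    have h1 := congrArg (starRingEnd ℂ) (key a (k + 1))
    rw [integral_arc_pow_pos, map_zero, ← integral_conj] at h1
    rw [← h1]
    exact integral_congr_ae (Filter.Eventually.of_forall fun z => by
      simp only [map_mul, map_pow, conj_conj]; ring)
  · rw [if_pos rfl, ← integral_arcMeasure_one]
    simpa only [add_zero, pow_zero] using key a 0
  · obtain ⟨k, rfl⟩ := Nat.exists_eq_add_of_lt h
    rw [if_neg (by omega), add_assoc, key, integral_arc_pow_pos]

theorem integral_disk_pow (a b : ℕ) :
    ∫ z, z ^ a * (starRingEnd ℂ) z ^ b ∂diskMeasure = if a = b then 1 / ((a : ℂ) + 1) else 0 := by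
  have h := integral_disk_pow_mul a b
  rw [integral_arc_pow_mul] at h
  have hb : (b : ℂ) + 1 ≠ 0 := by exact_mod_cast Nat.succ_ne_zero b
  rw [mul_comm, ← eq_div_iff hb] at h
  rw [h]
  by_cases hab : a = b
  · simp [hab]
  · simp [hab]

section Orthogonal

variable {ν : Measure ℂ} [IsFiniteMeasure ν] {φ : ℕ → ℂ → ℂ} {γ : ℕ → ℝ}

theorem integral_normSq_sum (hν : ∀ᵐ z ∂ν, ‖z‖ ≤ 1) (hφ : ∀ n, Continuous (φ n))
    (hort : ∀ a b, ∫ z, φ a z * (starRingEnd ℂ) (φ b z) ∂ν = if a = b then (γ a : ℂ) else 0)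
    (c : ℕ → ℂ) (s : Finset ℕ) :
    ∫ z, ‖∑ n ∈ s, c n * φ n z‖ ^ 2 ∂ν = ∑ n ∈ s, ‖c n‖ ^ 2 * γ n := by
  apply Complex.ofReal_injective
  refine (integral_ofReal (𝕜 := ℂ)).symm.trans ?_
  have h1 : ∀ z, ((‖∑ n ∈ s, c n * φ n z‖ ^ 2 : ℝ) : ℂ) =
      ∑ a ∈ s, ∑ b ∈ s, c a * (starRingEnd ℂ) (c b) * (φ a z * (starRingEnd ℂ) (φ b z)) :=
    fun z => by
    rw [ofReal_pow, ← mul_conj', map_sum, Finset.sum_mul_sum]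
    refine Finset.sum_congr rfl fun a _ => Finset.sum_congr rfl fun b _ => ?_
    rw [map_mul]; ring
  have h_int : ∀ a b, Integrable
      (fun z => c a * (starRingEnd ℂ) (c b) * (φ a z * (starRingEnd ℂ) (φ b z))) ν :=
    fun a b => integrable_of_continuous hν (by have := hφ a; have := hφ b; fun_prop)
  refine (integral_congr_ae (Filter.Eventually.of_forall h1)).trans ?_
  rw [integral_finsetSum _ fun a _ => integrable_finsetSum _ fun b _ => h_int a b]
  push_cast
  refine Finset.sum_congr rfl fun a ha => ?_
  rw [integral_finsetSum _ fun b _ => h_int a b]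
  simp only [integral_const_mul, hort]
  simp [mul_conj', ha]

/-- Bessel's inequality. -/
theorem sum_normSq_integral_le (hν : ∀ᵐ z ∂ν, ‖z‖ ≤ 1) (hφ : ∀ n, Continuous (φ n))
    (hγ : ∀ n, 0 < γ n)
    (hort : ∀ a b, ∫ z, φ a z * (starRingEnd ℂ) (φ b z) ∂ν = if a = b then (γ a : ℂ) else 0)
    {w : ℂ → ℂ} (hw : Continuous w) (s : Finset ℕ) :
    ∑ n ∈ s, (γ n)⁻¹ * ‖∫ z, w z * (starRingEnd ℂ) (φ n z) ∂ν‖ ^ 2 ≤ ∫ z, ‖w z‖ ^ 2 ∂ν := by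
  set b : ℕ → ℂ := fun n => ∫ z, w z * (starRingEnd ℂ) (φ n z) ∂ν
  set c : ℕ → ℂ := fun n => (γ n : ℂ)⁻¹ * b n with hc
  have hs : Continuous fun z => ∑ n ∈ s, c n * φ n z :=
    continuous_finsetSum _ fun n _ => continuous_const.mul (hφ n)
  have h0 : 0 ≤ ∫ z, ‖w z - ∑ n ∈ s, c n * φ n z‖ ^ 2 ∂ν := integral_nonneg fun z => by positivity
  have h1 : ∀ z, ‖w z - ∑ n ∈ s, c n * φ n z‖ ^ 2 = ‖w z‖ ^ 2 + ‖∑ n ∈ s, c n * φ n z‖ ^ 2 -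
      2 * (w z * (starRingEnd ℂ) (∑ n ∈ s, c n * φ n z)).re := fun z => by
    rw [← normSq_eq_norm_sq, normSq_sub, normSq_eq_norm_sq, normSq_eq_norm_sq]
  have h2 : ∫ z, (w z * (starRingEnd ℂ) (∑ n ∈ s, c n * φ n z)).re ∂ν =
      ∑ n ∈ s, (γ n)⁻¹ * ‖b n‖ ^ 2 := by
    have h3 : ∫ z, w z * (starRingEnd ℂ) (∑ n ∈ s, c n * φ n z) ∂ν =
        ((∑ n ∈ s, (γ n)⁻¹ * ‖b n‖ ^ 2 : ℝ) : ℂ) := by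
      have h4 : ∀ z, w z * (starRingEnd ℂ) (∑ n ∈ s, c n * φ n z) =
          ∑ n ∈ s, (starRingEnd ℂ) (c n) * (w z * (starRingEnd ℂ) (φ n z)) := fun z => by
        rw [map_sum, Finset.mul_sum]
        exact Finset.sum_congr rfl fun n _ => by rw [map_mul]; ring
      simp only [h4]
      rw [integral_finsetSum _ fun n _ => integrable_of_continuous hν
        (by have := hφ n; fun_prop)]
      push_cast
      refine Finset.sum_congr rfl fun n _ => ?_
      rw [integral_const_mul]
      change (starRingEnd ℂ) (c n) * b n = _
      rw [hc, map_mul, map_inv₀, conj_ofReal, mul_assoc, mul_comm _ (b n), mul_conj']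
    rw [← ofReal_re (∑ n ∈ s, (γ n)⁻¹ * ‖b n‖ ^ 2), ← h3]
    have i0 : Integrable (fun z => w z * (starRingEnd ℂ) (∑ n ∈ s, c n * φ n z)) ν :=
      integrable_of_continuous hν (by fun_prop)
    exact reCLM.integral_comp_comm i0
  have i1 : Integrable (fun z => ‖w z‖ ^ 2) ν := integrable_of_continuous hν (by fun_prop)
  have i2 : Integrable (fun z => ‖∑ n ∈ s, c n * φ n z‖ ^ 2) ν :=
    integrable_of_continuous hν (by fun_prop)
  have i3 : Integrable (fun z => 2 * (w z * (starRingEnd ℂ) (∑ n ∈ s, c n * φ n z)).re) ν :=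
    integrable_of_continuous hν (by fun_prop)
  simp only [h1] at h0
  rw [integral_sub (by exact i1.add i2) i3, integral_add i1 i2, integral_const_mul, h2,
    integral_normSq_sum hν hφ hort] at h0
  have h5 : ∑ n ∈ s, ‖c n‖ ^ 2 * γ n = ∑ n ∈ s, (γ n)⁻¹ * ‖b n‖ ^ 2 :=
    Finset.sum_congr rfl fun n _ => by
      have := (hγ n).ne'
      simp only [hc, norm_mul, norm_inv, norm_real, Real.norm_eq_abs, abs_of_pos (hγ n)]
      field_simp
  rw [h5] at h0
  linarith

end Orthogonal

theorem sum_arc_coeff_le {V : ℂ → ℂ} (hV : Continuous V) (N : ℕ) :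
    ∑ n ∈ Finset.range N, ‖∫ z, V z * (starRingEnd ℂ) z ^ n ∂arcMeasure‖ ^ 2 ≤
      ∫ z, ‖V z‖ ^ 2 ∂arcMeasure := by
  have := sum_normSq_integral_le (φ := fun n z => z ^ n) (γ := fun _ => 1) ae_arcMeasure_le
    (fun n => by fun_prop) (fun _ => one_pos)
    (fun a b => by simpa using integral_arc_pow_mul a b) hV (Finset.range N)
  simpa using this

theorem sum_disk_coeff_le {V : ℂ → ℂ} (hV : Continuous V) (N : ℕ) :
    ∑ n ∈ Finset.range N, ((n : ℝ) + 1) * ‖∫ z, V z * (starRingEnd ℂ) z ^ n ∂diskMeasure‖ ^ 2 ≤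
      ∫ z, ‖V z‖ ^ 2 ∂diskMeasure := by
  have := sum_normSq_integral_le (φ := fun n z => z ^ n) (γ := fun n => 1 / ((n : ℝ) + 1))
    ae_diskMeasure (fun n => by fun_prop) (fun _ => by positivity)
    (fun a b => by simpa using integral_disk_pow a b) hV (Finset.range N)
  simpa using this

theorem sum_disk_coeff_conj_le {V : ℂ → ℂ} (hV : Continuous V) (N : ℕ) :
    ∑ n ∈ Finset.range N, ((n : ℝ) + 1) * ‖∫ z, V z * z ^ n ∂diskMeasure‖ ^ 2 ≤
      ∫ z, ‖V z‖ ^ 2 ∂diskMeasure := by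
  have := sum_disk_coeff_le (V := fun z => (starRingEnd ℂ) (V z)) (by fun_prop) N
  simp only [norm_conj] at this
  refine le_of_eq_of_le (Finset.sum_congr rfl fun n _ => ?_) this
  rw [← norm_conj, ← integral_conj]
  simp

/-- The squared Dirichlet norm of a polynomial. -/
noncomputable def polyNormSq (p : Polynomial ℂ) : ℝ :=
  ∑ n ∈ Finset.range (p.natDegree + 1), ((n : ℝ) + 1) * ‖p.coeff n‖ ^ 2

theorem polyNormSq_eq {p : Polynomial ℂ} {N : ℕ} (h : p.natDegree < N) :
    polyNormSq p = ∑ n ∈ Finset.range N, ((n : ℝ) + 1) * ‖p.coeff n‖ ^ 2 := by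
  refine Finset.sum_subset (Finset.range_subset_range.2 h) fun n _ hn => ?_
  rw [Polynomial.coeff_eq_zero_of_natDegree_lt (by simpa using hn)]
  simp

theorem polyNormSq_nonneg (p : Polynomial ℂ) : 0 ≤ polyNormSq p :=
  Finset.sum_nonneg fun n _ => by positivity

theorem integral_arc_polynomial (p : Polynomial ℂ) {N : ℕ} (h : p.natDegree < N) :
    ∫ z, ‖p.eval z‖ ^ 2 ∂arcMeasure = ∑ n ∈ Finset.range N, ‖p.coeff n‖ ^ 2 := by
  simp only [Polynomial.eval_eq_sum_range' h]
  simpa using integral_normSq_sum (φ := fun n z => z ^ n) (γ := fun _ => 1) ae_arcMeasure_le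
    (fun n => by fun_prop) (fun a b => by simpa using integral_arc_pow_mul a b)
    p.coeff (Finset.range N)

theorem integral_disk_polynomial (p : Polynomial ℂ) {N : ℕ} (h : p.natDegree < N) :
    ∫ z, ‖p.eval z‖ ^ 2 ∂diskMeasure =
      ∑ n ∈ Finset.range N, ‖p.coeff n‖ ^ 2 * ((n : ℝ) + 1)⁻¹ := by
  simp only [Polynomial.eval_eq_sum_range' h]
  simpa using integral_normSq_sum (φ := fun n z => z ^ n) (γ := fun n => 1 / ((n : ℝ) + 1))
    ae_diskMeasure (fun n => by fun_prop) (fun a b => by simpa using integral_disk_pow a b)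
    p.coeff (Finset.range N)

theorem integral_derivative_add_integral (p : Polynomial ℂ) :
    ∫ z, ‖p.derivative.eval z‖ ^ 2 ∂diskMeasure + ∫ z, ‖p.eval z‖ ^ 2 ∂arcMeasure =
      polyNormSq p := by
  have h : p.natDegree < p.natDegree + 1 + 1 := by omega
  rw [integral_disk_polynomial p.derivative
    (N := p.natDegree + 1) (by have := p.natDegree_derivative_le; omega),
    integral_arc_polynomial p h, polyNormSq_eq h,
    Finset.sum_range_succ' _ (p.natDegree + 1), Finset.sum_range_succ' _ (p.natDegree + 1),
    ← add_assoc, ← Finset.sum_add_distrib]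
  congr 1
  · refine Finset.sum_congr rfl fun n _ => ?_
    have : (0 : ℝ) < (n : ℝ) + 1 := by positivity
    rw [Polynomial.coeff_derivative, norm_mul]
    have h1 : ‖((n : ℂ) + 1)‖ = (n : ℝ) + 1 := by
      rw [← Nat.cast_one (R := ℂ), ← Nat.cast_add, norm_natCast]; push_cast; rfl
    rw [h1]
    push_cast
    field_simp
  · simp

theorem integral_derivative_le (p : Polynomial ℂ) :
    ∫ z, ‖p.derivative.eval z‖ ^ 2 ∂diskMeasure ≤ polyNormSq p := by
  have : 0 ≤ ∫ z, ‖p.eval z‖ ^ 2 ∂arcMeasure := integral_nonneg fun z => by positivity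
  linarith [integral_derivative_add_integral p]

theorem integral_arc_le (p : Polynomial ℂ) :
    ∫ z, ‖p.eval z‖ ^ 2 ∂arcMeasure ≤ polyNormSq p := by
  have : 0 ≤ ∫ z, ‖p.derivative.eval z‖ ^ 2 ∂diskMeasure := integral_nonneg fun z => by positivity
  linarith [integral_derivative_add_integral p]

/-- The analytic projection of the boundary values of a smooth function has Dirichlet norm
controlled by the function and its `∂`-derivative. -/
theorem HasWirtinger.sum_coeff_le {V P Q : ℂ → ℂ} (h : HasWirtinger V P Q) (hP : Continuous P)
    (hQ : Continuous Q) (N : ℕ) :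
    ∑ n ∈ Finset.range N, ((n : ℝ) + 1) *
        ‖∫ z, V z * (starRingEnd ℂ) z ^ n ∂arcMeasure‖ ^ 2 ≤
      ∫ z, ‖V z‖ ^ 2 ∂arcMeasure + ∫ z, ‖P z‖ ^ 2 ∂diskMeasure := by
  have h1 := sum_arc_coeff_le h.continuous N
  have h2 := sum_disk_coeff_le hP N
  have h3 : ∀ m : ℕ, ∫ z, V z * (starRingEnd ℂ) z ^ (m + 1) ∂arcMeasure =
      ∫ z, P z * (starRingEnd ℂ) z ^ m ∂diskMeasure := fun m => by
    have h4 := (h.mul (hasWirtinger_pow m).conj).green_conj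
      (by have := h.continuous; fun_prop) (by have := h.continuous; fun_prop)
    simp only [map_zero, mul_zero, add_zero, map_pow] at h4
    rw [← h4]
    exact integral_congr_ae (Filter.Eventually.of_forall fun z => by simp only []; ring)
  have h5 : ∑ n ∈ Finset.range N, (n : ℝ) *
      ‖∫ z, V z * (starRingEnd ℂ) z ^ n ∂arcMeasure‖ ^ 2 ≤ ∫ z, ‖P z‖ ^ 2 ∂diskMeasure := by
    refine le_trans ?_ h2
    rcases N with _ | N
    · simp
    · rw [Finset.sum_range_succ']
      simp only [h3, Nat.cast_zero, zero_mul, add_zero]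
      push_cast
      exact Finset.sum_le_sum_of_subset_of_nonneg (Finset.range_subset_range.2 (Nat.le_succ N))
        fun n _ _ => by positivity
  simp only [add_mul, one_mul, Finset.sum_add_distrib]
  linarith

theorem normSq_eval_le {q : Polynomial ℂ} {K : ℕ} (hq : q.natDegree < K) (w : ℂ) :
    ‖q.eval w‖ ^ 2 ≤ (∑ n ∈ Finset.range K, ‖w‖ ^ (2 * n) / ((n : ℝ) + 1)) * polyNormSq q := by
  rw [Polynomial.eval_eq_sum_range' hq, polyNormSq_eq hq]
  refine (pow_le_pow_left₀ (norm_nonneg _) (norm_sum_le _ _) 2).trans ?_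
  refine le_of_eq_of_le ?_ ((Finset.sum_mul_sq_le_sq_mul_sq (Finset.range K)
    (fun n => ‖w‖ ^ n / √((n : ℝ) + 1)) fun n => √((n : ℝ) + 1) * ‖q.coeff n‖).trans_eq ?_)
  · congr 1
    refine Finset.sum_congr rfl fun n _ => ?_
    have : (0 : ℝ) < √((n : ℝ) + 1) := by positivity
    rw [norm_mul, norm_pow]
    field_simp
  · congr 1 <;> refine Finset.sum_congr rfl fun n _ => ?_
    · rw [div_pow, Real.sq_sqrt (by positivity)]; ring
    · rw [mul_pow, Real.sq_sqrt (by positivity)]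

/-- A bounded column of polynomial multipliers is pointwise bounded on the closed disk. -/
theorem sum_normSq_eval_le {ι : Type*} [Fintype ι] (f : ι → Polynomial ℂ) {A : ℝ} (hA : 0 ≤ A)
    (hf : ∀ p, ∑ j, polyNormSq (f j * p) ≤ A * polyNormSq p) {w : ℂ} (hw : ‖w‖ ≤ 1) :
    ∑ j, ‖(f j).eval w‖ ^ 2 ≤ A := by
  obtain ⟨D, hD⟩ : ∃ D : ℕ, ∀ j, (f j).natDegree ≤ D :=
    ⟨Finset.univ.sup fun j => (f j).natDegree, fun j =>
      Finset.le_sup (f := fun j => (f j).natDegree) (Finset.mem_univ j)⟩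
  set S := ∑ j, ‖(f j).eval w‖ ^ 2
  let k : ℕ → ℝ := fun K => ∑ n ∈ Finset.range K, ‖w‖ ^ (2 * n) / ((n : ℝ) + 1)
  have hk1 : ∀ K, 1 ≤ k (K + 1) := fun K => by
    have := Finset.single_le_sum (f := fun n : ℕ => ‖w‖ ^ (2 * n) / ((n : ℝ) + 1))
      (fun n _ => by positivity) (Finset.mem_range.2 (Nat.succ_pos K))
    simpa using this
  have hkD : ∀ K, k (K + 1 + D) ≤ k (K + 1) + D / ((K : ℝ) + 1) := fun K => by
    simp only [k]
    rw [Finset.sum_range_add]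
    gcongr
    refine (Finset.sum_le_card_nsmul _ _ (1 / ((K : ℝ) + 1)) fun n _ => ?_).trans_eq ?_
    · gcongr
      · exact pow_le_one₀ (norm_nonneg _) hw
      · linarith [Nat.cast_nonneg (α := ℝ) n]
    · simp [div_eq_mul_inv]
  have key : ∀ K : ℕ, S - A ≤ A * D / ((K : ℝ) + 1) := fun K => by
    let p : Polynomial ℂ := ∑ n ∈ Finset.range (K + 1),
      Polynomial.monomial n ((starRingEnd ℂ) w ^ n / ((n : ℂ) + 1))
    have hn : ∀ n : ℕ, ‖((n : ℂ) + 1)‖ = (n : ℝ) + 1 := fun n => by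
      rw [← Nat.cast_one (R := ℂ), ← Nat.cast_add, norm_natCast]; push_cast; rfl
    have hdeg : p.natDegree < K + 1 := by
      refine Nat.lt_succ_of_le (Polynomial.natDegree_sum_le_of_forall_le _ _ fun n hn => ?_)
      exact (Polynomial.natDegree_monomial_le _).trans (by simpa [Nat.lt_succ_iff] using hn)
    have hc : ∀ n ∈ Finset.range (K + 1), p.coeff n = (starRingEnd ℂ) w ^ n / ((n : ℂ) + 1) :=
      fun n hn => by
      simp only [p, Polynomial.finsetSum_coeff, Polynomial.coeff_monomial]
      rw [Finset.sum_ite_eq' , if_pos hn]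
    have hpn : polyNormSq p = k (K + 1) := by
      rw [polyNormSq_eq hdeg]
      refine Finset.sum_congr rfl fun n hn' => ?_
      have : (0 : ℝ) < (n : ℝ) + 1 := by positivity
      rw [hc n hn', norm_div, hn, norm_pow, norm_conj, pow_mul']
      field_simp
    have hpw : p.eval w = (k (K + 1) : ℂ) := by
      simp only [p, Polynomial.eval_finsetSum, Polynomial.eval_monomial, k]
      push_cast
      refine Finset.sum_congr rfl fun n _ => ?_
      rw [div_mul_eq_mul_div, ← mul_pow, conj_mul', pow_mul]
    have h1 : S * k (K + 1) ^ 2 ≤ k (K + 1 + D) * (A * k (K + 1)) := by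
      have h2 : ∀ j, ‖(f j).eval w‖ ^ 2 * k (K + 1) ^ 2 ≤ k (K + 1 + D) * polyNormSq (f j * p) :=
        fun j => by
        have h3 := normSq_eval_le (q := f j * p) (K := K + 1 + D)
          (by have := Polynomial.natDegree_mul_le (p := f j) (q := p); have := hD j; omega) w
        rwa [Polynomial.eval_mul, hpw, norm_mul, mul_pow, norm_real, Real.norm_eq_abs, sq_abs] at h3
      rw [Finset.sum_mul]
      refine (Finset.sum_le_sum fun j _ => h2 j).trans ?_
      rw [← Finset.mul_sum]
      refine mul_le_mul_of_nonneg_left ((hf p).trans_eq (by rw [hpn])) ?_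
      exact Finset.sum_nonneg fun n _ => by positivity
    have hk0 : 0 < k (K + 1) := one_pos.trans_le (hk1 K)
    have h4 : S * k (K + 1) ≤ A * (k (K + 1) + D / ((K : ℝ) + 1)) := by
      have h5 : S * k (K + 1) ≤ A * k (K + 1 + D) := by
        refine le_of_mul_le_mul_right ?_ hk0
        linarith
      exact h5.trans (mul_le_mul_of_nonneg_left (hkD K) hA)
    have h6 : (S - A) * k (K + 1) ≤ A * D / ((K : ℝ) + 1) := by
      rw [mul_div_assoc]; linarith
    rcases le_or_gt S A with h | h
    · have : 0 ≤ A * D / ((K : ℝ) + 1) := by positivity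
      linarith
    · nlinarith [hk1 K]
  have hlim : Filter.Tendsto (fun K : ℕ => A * D / ((K : ℝ) + 1)) Filter.atTop (nhds 0) := by
    simpa [div_eq_mul_inv] using tendsto_one_div_add_atTop_nhds_zero_nat.const_mul (A * (D : ℝ))
  linarith [ge_of_tendsto' hlim key]

/-- A bounded column of multipliers generates a Carleson measure. -/
theorem integral_derivative_mul_le {ι : Type*} [Fintype ι] (f : ι → Polynomial ℂ) {A B : ℝ}
    (hf : ∀ p, ∑ j, polyNormSq (f j * p) ≤ B * polyNormSq p)
    (hA : ∀ w, ‖w‖ ≤ 1 → ∑ j, ‖(f j).eval w‖ ^ 2 ≤ A) (p : Polynomial ℂ) :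
    ∫ z, (∑ j, ‖(f j).derivative.eval z‖ ^ 2) * ‖p.eval z‖ ^ 2 ∂diskMeasure ≤
      (2 * B + 2 * A) * polyNormSq p := by
  have hi : ∀ q : Polynomial ℂ, Integrable (fun z => ‖q.eval z‖ ^ 2) diskMeasure := fun q =>
    integrable_of_continuous ae_diskMeasure (by fun_prop)
  have h1 : ∫ z, (∑ j, ‖(f j).derivative.eval z‖ ^ 2) * ‖p.eval z‖ ^ 2 ∂diskMeasure ≤
      ∫ z, (2 * ∑ j, ‖(f j * p).derivative.eval z‖ ^ 2 +
        2 * A * ‖p.derivative.eval z‖ ^ 2) ∂diskMeasure := by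
    refine integral_mono_ae (integrable_of_continuous ae_diskMeasure (by fun_prop))
      (integrable_of_continuous ae_diskMeasure (by fun_prop)) ?_
    filter_upwards [ae_diskMeasure] with z hz
    have h2 : ∀ j, ‖(f j).derivative.eval z‖ ^ 2 * ‖p.eval z‖ ^ 2 ≤
        2 * ‖(f j * p).derivative.eval z‖ ^ 2 +
          2 * (‖(f j).eval z‖ ^ 2 * ‖p.derivative.eval z‖ ^ 2) := fun j => by
      have h3 : (f j).derivative.eval z * p.eval z =
          (f j * p).derivative.eval z - (f j).eval z * p.derivative.eval z := by
        simp
      rw [← mul_pow, ← norm_mul, h3, ← mul_pow ‖_‖ ‖_‖, ← norm_mul]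
      refine (pow_le_pow_left₀ (norm_nonneg _) (norm_sub_le _ _) 2).trans ?_
      nlinarith [sq_nonneg (‖(f j * p).derivative.eval z‖ - ‖(f j).eval z * p.derivative.eval z‖)]
    rw [Finset.sum_mul]
    refine (Finset.sum_le_sum fun j _ => h2 j).trans ?_
    rw [Finset.sum_add_distrib, ← Finset.mul_sum, ← Finset.mul_sum, ← Finset.sum_mul, mul_assoc 2 A]
    have := hA z hz
    gcongr
  refine h1.trans ?_
  rw [integral_add ((integrable_finsetSum _ fun j _ => hi _).const_mul _) ((hi _).const_mul _),
    integral_const_mul, integral_const_mul, integral_finsetSum _ fun j _ => hi _]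
  have hA0 : 0 ≤ A := (Finset.sum_nonneg fun j _ => by positivity).trans (hA 0 (by simp))
  have h4 := (Finset.sum_le_sum fun j _ => integral_derivative_le (f j * p)).trans (hf p)
  have h5 := mul_le_mul_of_nonneg_left (integral_derivative_le p) hA0
  linarith

/-- The two ways of distributing the indices above and below the diagonal. -/
theorem sum_split_diagonal {x y : ℕ → ℂ} {D : ℕ} (hy : ∀ n, D ≤ n → y n = 0)
    (κ : ℕ → ℂ) (l : ℕ) :
    ∑ k ∈ Finset.range D, ∑ b ∈ Finset.range D, x (l + 1 + k) * (y b * κ (b + k)) +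
      ∑ a ∈ Finset.range (l + 1), ∑ m ∈ Finset.range D, x a * (y (l - a + 1 + m) * κ m) =
    ∑ a ∈ Finset.range (l + 1 + D), ∑ b ∈ Finset.range (l + 1 + D),
      if l < a + b then x a * (y b * κ (a + b - l - 1)) else 0 := by
  have trunc : ∀ (R : ℕ) (g : ℕ → ℂ), D ≤ R → (∀ n, D ≤ n → g n = 0) →
      ∑ b ∈ Finset.range R, g b = ∑ b ∈ Finset.range D, g b := fun R g hR hg =>
    (Finset.sum_subset (Finset.range_subset_range.2 hR) fun n _ hn =>
      hg n (by simpa using hn)).symm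
  rw [Finset.sum_range_add _ (l + 1) D, add_comm]
  congr 1
  · refine Finset.sum_congr rfl fun a ha => ?_
    have ha' : a ≤ l := by simpa [Nat.lt_succ_iff] using ha
    rw [show l + 1 + D = (l - a + 1) + (a + D) by omega, Finset.sum_range_add,
      Finset.sum_eq_zero (s := Finset.range (l - a + 1)), zero_add, trunc (a + D) _ (by omega)]
    · refine Finset.sum_congr rfl fun m _ => ?_
      rw [if_pos (by omega)]
      congr 3
      omega
    · intro n hn
      rw [hy _ (by omega)]
      simp
    · intro b hb
      have := Finset.mem_range.1 hb
      rw [if_neg (by omega)]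
  · refine Finset.sum_congr rfl fun k _ => ?_
    rw [trunc (l + 1 + D) _ (by omega)]
    · refine Finset.sum_congr rfl fun b _ => ?_
      rw [if_pos (by omega)]
      congr 3
      omega
    · intro n hn
      rw [hy _ hn]
      simp

section Pointwise

variable {ι : Type*} [Fintype ι] {a b : ι → ℂ} {H H' h h' : ℂ} {A : ℝ}

theorem sum_mul_conj_eq (a : ι → ℂ) :
    ∑ j, a j * (starRingEnd ℂ) (a j) = ((∑ j, ‖a j‖ ^ 2 : ℝ) : ℂ) := by
  push_cast
  exact Finset.sum_congr rfl fun j _ => mul_conj' _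

theorem norm_sum_mul_sq_le (a b : ι → ℂ) :
    ‖∑ j, a j * b j‖ ^ 2 ≤ (∑ j, ‖a j‖ ^ 2) * ∑ j, ‖b j‖ ^ 2 := by
  refine (pow_le_pow_left₀ (norm_nonneg _) (norm_sum_le _ _) 2).trans ?_
  simp only [norm_mul]
  exact Finset.sum_mul_sq_le_sq_mul_sq _ _ _

theorem norm_sum_mul_conj_sq_le (a b : ι → ℂ) :
    ‖∑ j, b j * (starRingEnd ℂ) (a j)‖ ^ 2 ≤ (∑ j, ‖a j‖ ^ 2) * ∑ j, ‖b j‖ ^ 2 := by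
  simpa [mul_comm] using norm_sum_mul_sq_le (fun j => (starRingEnd ℂ) (a j)) b

theorem norm_cube_mul_sq_le (hH : ‖H‖ ^ 2 ≤ ∑ j, ‖a j‖ ^ 2) :
    ‖H ^ 3 * h‖ ^ 2 ≤ (∑ j, ‖a j‖ ^ 2) ^ 3 * ‖h‖ ^ 2 := by
  rw [norm_mul, mul_pow, norm_pow, ← pow_mul, mul_comm 3 2, pow_mul]
  gcongr

theorem sum_solution_le (hS : 0 < ∑ j, ‖a j‖ ^ 2) (hA : ∑ j, ‖a j‖ ^ 2 ≤ A)
    (hH : ‖H‖ ^ 2 ≤ ∑ j, ‖a j‖ ^ 2) :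
    ∑ i, ‖(starRingEnd ℂ) (a i) * (H ^ 3 * h / ∑ j, a j * (starRingEnd ℂ) (a j))‖ ^ 2 ≤
      A ^ 2 * ‖h‖ ^ 2 := by
  rw [sum_mul_conj_eq]
  have h1 := norm_cube_mul_sq_le (h := h) hH
  set S := ∑ j, ‖a j‖ ^ 2 with hSd
  simp only [norm_mul, norm_conj, mul_pow, norm_div] at h1 ⊢
  rw [← Finset.sum_mul, ← hSd, norm_real, Real.norm_eq_abs, abs_of_pos hS, div_pow, mul_pow]
  calc S * (‖H ^ 3‖ ^ 2 * ‖h‖ ^ 2 / S ^ 2) ≤ S * (S ^ 3 * ‖h‖ ^ 2 / S ^ 2) := by gcongr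
    _ = S ^ 2 * ‖h‖ ^ 2 := by field_simp
    _ ≤ _ := by gcongr

theorem sum_dWirtinger_solution_le (hS : 0 < ∑ j, ‖a j‖ ^ 2) (hA : ∑ j, ‖a j‖ ^ 2 ≤ A)
    (hH : ‖H‖ ^ 2 ≤ ∑ j, ‖a j‖ ^ 2) :
    ∑ i, ‖(starRingEnd ℂ) (a i) * ((3 * H ^ 2 * H' * h + H ^ 3 * h') /
        (∑ j, a j * (starRingEnd ℂ) (a j)) - H ^ 3 * h * (∑ j, b j * (starRingEnd ℂ) (a j)) /
        (∑ j, a j * (starRingEnd ℂ) (a j)) ^ 2)‖ ^ 2 ≤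
      18 * A * ‖H' * h‖ ^ 2 + 4 * A ^ 2 * ‖h'‖ ^ 2 +
        4 * A * ((∑ j, ‖b j‖ ^ 2) * ‖h‖ ^ 2) := by
  rw [sum_mul_conj_eq]
  have hT := norm_sum_mul_conj_sq_le a b
  have h1 := norm_cube_mul_sq_le (h := h) hH
  have h2 := norm_cube_mul_sq_le (h := h') hH
  set S := ∑ j, ‖a j‖ ^ 2 with hSd
  set B := ∑ j, ‖b j‖ ^ 2
  set T := ∑ j, b j * (starRingEnd ℂ) (a j)
  have hS' : (S : ℂ) ≠ 0 := by exact_mod_cast hS.ne'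
  have hSn : ‖(S : ℂ)‖ = S := by rw [norm_real, Real.norm_eq_abs, abs_of_pos hS]
  have hB : 0 ≤ B := Finset.sum_nonneg fun j _ => by positivity
  simp only [norm_mul (_ : ℂ) (_ - _), norm_conj, mul_pow ‖_‖ ‖_‖]
  rw [← Finset.sum_mul, ← hSd]
  have e1 : ‖3 * H ^ 2 * H' * h‖ ^ 2 ≤ 9 * S ^ 2 * ‖H' * h‖ ^ 2 := by
    have : ‖3 * H ^ 2 * H' * h‖ ^ 2 = 9 * (‖H‖ ^ 2) ^ 2 * ‖H' * h‖ ^ 2 := by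
      simp only [norm_mul, norm_pow]
      norm_num
      ring
    rw [this]
    gcongr
  have e3 : ‖H ^ 3 * h * T / S‖ ^ 2 ≤ S ^ 2 * (B * ‖h‖ ^ 2) := by
    rw [norm_div, norm_mul (_ * _) T, hSn, div_pow, mul_pow]
    calc _ ≤ S ^ 3 * ‖h‖ ^ 2 * (S * B) / S ^ 2 := by gcongr
      _ = _ := by field_simp
  have e4 : (3 * H ^ 2 * H' * h + H ^ 3 * h') / (S : ℂ) - H ^ 3 * h * T / (S : ℂ) ^ 2 =
      (3 * H ^ 2 * H' * h + H ^ 3 * h' - H ^ 3 * h * T / S) / S := by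
    field_simp
  have e5 : ∀ x y z : ℂ, ‖x + y - z‖ ^ 2 ≤ 2 * ‖x‖ ^ 2 + 4 * ‖y‖ ^ 2 + 4 * ‖z‖ ^ 2 :=
    fun x y z => by
    have : ‖x + y - z‖ ≤ ‖x‖ + ‖y‖ + ‖z‖ :=
      (norm_sub_le _ _).trans (by linarith [norm_add_le x y])
    refine (pow_le_pow_left₀ (norm_nonneg _) this 2).trans ?_
    nlinarith [sq_nonneg (‖x‖ - ‖y‖ - ‖z‖), sq_nonneg (‖y‖ - ‖z‖)]
  rw [e4, norm_div, hSn, div_pow]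
  have e6 := e5 (3 * H ^ 2 * H' * h) (H ^ 3 * h') (H ^ 3 * h * T / S)
  calc S * (‖3 * H ^ 2 * H' * h + H ^ 3 * h' - H ^ 3 * h * T / S‖ ^ 2 / S ^ 2)
      ≤ S * ((2 * (9 * S ^ 2 * ‖H' * h‖ ^ 2) + 4 * (S ^ 3 * ‖h'‖ ^ 2) +
          4 * (S ^ 2 * (B * ‖h‖ ^ 2))) / S ^ 2) := by
        gcongr
        linarith
    _ = 18 * S * ‖H' * h‖ ^ 2 + 4 * S ^ 2 * ‖h'‖ ^ 2 + 4 * S * (B * ‖h‖ ^ 2) := by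
        field_simp
        ring
    _ ≤ _ := by gcongr

theorem sum_koszul_le (hS : 0 < ∑ j, ‖a j‖ ^ 2) (hH : ‖H‖ ^ 2 ≤ ∑ j, ‖a j‖ ^ 2) :
    ∑ i, ∑ j, ‖H ^ 3 * h / (∑ j, a j * (starRingEnd ℂ) (a j)) ^ 2 *
        ((starRingEnd ℂ) (a j) * (starRingEnd ℂ) (b i) -
          (starRingEnd ℂ) (a i) * (starRingEnd ℂ) (b j))‖ ^ 2 ≤
      4 * ((∑ j, ‖b j‖ ^ 2) * ‖h‖ ^ 2) := by
  rw [sum_mul_conj_eq]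
  have h1 := norm_cube_mul_sq_le (h := h) hH
  set S := ∑ j, ‖a j‖ ^ 2 with hSd
  set B := ∑ j, ‖b j‖ ^ 2 with hBd
  have hSn : ‖(S : ℂ)‖ = S := by rw [norm_real, Real.norm_eq_abs, abs_of_pos hS]
  have hB : 0 ≤ B := Finset.sum_nonneg fun j _ => by positivity
  have h2 : ∑ i, ∑ j, ‖(starRingEnd ℂ) (a j) * (starRingEnd ℂ) (b i) -
      (starRingEnd ℂ) (a i) * (starRingEnd ℂ) (b j)‖ ^ 2 ≤ 4 * (S * B) := by
    have h3 : ∀ i j, ‖(starRingEnd ℂ) (a j) * (starRingEnd ℂ) (b i) -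
        (starRingEnd ℂ) (a i) * (starRingEnd ℂ) (b j)‖ ^ 2 ≤
        2 * (‖b i‖ ^ 2 * ‖a j‖ ^ 2) + 2 * (‖a i‖ ^ 2 * ‖b j‖ ^ 2) := fun i j => by
      refine (pow_le_pow_left₀ (norm_nonneg _) (norm_sub_le _ _) 2).trans ?_
      simp only [norm_mul, norm_conj]
      nlinarith [sq_nonneg (‖a j‖ * ‖b i‖ - ‖a i‖ * ‖b j‖)]
    refine (Finset.sum_le_sum fun i _ => Finset.sum_le_sum fun j _ => h3 i j).trans_eq ?_
    simp only [Finset.sum_add_distrib, ← Finset.mul_sum, ← Finset.sum_mul]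
    rw [← hSd, ← hBd]
    ring
  simp only [norm_mul (_ / _) _, mul_pow ‖_‖ ‖_‖, ← Finset.mul_sum]
  rw [norm_div, norm_pow _ 2, hSn, div_pow]
  have h4 : ‖H ^ 3 * h‖ ^ 2 / (S ^ 2) ^ 2 ≤ S ^ 3 * ‖h‖ ^ 2 / (S ^ 2) ^ 2 :=
    div_le_div_of_nonneg_right h1 (by positivity)
  refine (mul_le_mul h4 h2 (Finset.sum_nonneg fun i _ => Finset.sum_nonneg fun j _ =>
    by positivity) (by positivity)).trans_eq ?_
  field_simp

end Pointwise

theorem integral_arc_coeff (p : Polynomial ℂ) (n : ℕ) :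
    ∫ z, p.eval z * (starRingEnd ℂ) z ^ n ∂arcMeasure = p.coeff n := by
  simp only [Polynomial.eval_eq_sum_range' (Nat.lt_succ_self p.natDegree), Finset.sum_mul,
    mul_assoc]
  rw [integral_finsetSum _ fun a _ => integrable_of_continuous ae_arcMeasure_le (by fun_prop)]
  simp only [integral_const_mul, integral_arc_pow_mul, mul_ite, mul_one, mul_zero]
  rw [Finset.sum_ite_eq']
  split_ifs with h
  · rfl
  · exact (Polynomial.coeff_eq_zero_of_natDegree_lt (by simpa using h)).symm

theorem sum_hankel_le {ι : Type*} [Fintype ι] (f : ι → Polynomial ℂ) {A : ℝ} (hA : 0 ≤ A)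
    (hf : ∀ p, ∑ j, polyNormSq (f j * p) ≤ A * polyNormSq p) (κ : ι → ℕ → ℂ) (D N : ℕ) :
    ∑ n ∈ Finset.range N, ((n : ℝ) + 1) *
        ‖∑ j, ∑ m ∈ Finset.range D, κ j m * (f j).coeff (n + 1 + m)‖ ^ 2 ≤
      5 * A * ∑ j, ∑ m ∈ Finset.range D, ((m : ℝ) + 2) * ‖κ j m‖ ^ 2 := by
  have hS : ∀ w : ℂ, ‖w‖ ≤ 1 → ∑ j, ‖(f j).eval w‖ ^ 2 ≤ A := fun w hw =>
    sum_normSq_eval_le f hA hf hw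
  obtain ⟨k, hk⟩ : ∃ k : ι → Polynomial ℂ, ∀ j, k j = ∑ m ∈ Finset.range D,
      Polynomial.monomial (m + 1) ((starRingEnd ℂ) (κ j m)) := ⟨_, fun _ => rfl⟩
  have hkz : ∀ j z, (starRingEnd ℂ) ((k j).eval z) =
      ∑ m ∈ Finset.range D, κ j m * (starRingEnd ℂ) z ^ (m + 1) := fun j z => by
    simp [hk, Polynomial.eval_finsetSum]
  have hkn : ∀ j, polyNormSq (k j) = ∑ m ∈ Finset.range D, ((m : ℝ) + 2) * ‖κ j m‖ ^ 2 :=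
    fun j => by
    have hdeg : (k j).natDegree < D + 1 := by
      rw [hk]
      refine Nat.lt_succ_of_le (Polynomial.natDegree_sum_le_of_forall_le _ _ fun n hn => ?_)
      exact (Polynomial.natDegree_monomial_le _).trans (by simpa [Nat.lt_succ_iff] using hn)
    have hc0 : (k j).coeff 0 = 0 := by
      simp [hk, Polynomial.finsetSum_coeff, Polynomial.coeff_monomial]
    have hc : ∀ m ∈ Finset.range D, (k j).coeff (m + 1) = (starRingEnd ℂ) (κ j m) := fun m hm => by
      simp only [hk, Polynomial.finsetSum_coeff, Polynomial.coeff_monomial, add_left_inj]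
      rw [Finset.sum_ite_eq', if_pos hm]
    rw [polyNormSq_eq hdeg, Finset.sum_range_succ', hc0]
    simp only [norm_zero, ne_eq, OfNat.ofNat_ne_zero, not_false_eq_true, zero_pow, mul_zero,
      add_zero]
    refine Finset.sum_congr rfl fun m hm => ?_
    rw [hc m hm, norm_conj]
    push_cast
    ring
  have hW : HasWirtinger (fun z => ∑ j, (f j).eval z * (starRingEnd ℂ) ((k j).eval z))
      (fun z => ∑ j, (f j).derivative.eval z * (starRingEnd ℂ) ((k j).eval z))
      (fun z => ∑ j, (f j).eval z * (starRingEnd ℂ) ((k j).derivative.eval z)) :=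
    (HasWirtinger.sum Finset.univ fun j _ =>
      (HasWirtinger.polynomial (f j)).mul (HasWirtinger.polynomial (k j)).conj).congr
      (fun z => by simp) (fun z => by simp)
  have h1 := hW.sum_coeff_le (by fun_prop) (by fun_prop) N
  have h2 : ∀ n : ℕ, ∫ z, (∑ j, (f j).eval z * (starRingEnd ℂ) ((k j).eval z)) *
      (starRingEnd ℂ) z ^ n ∂arcMeasure =
      ∑ j, ∑ m ∈ Finset.range D, κ j m * (f j).coeff (n + 1 + m) := fun n => by
    have h3 : ∀ z, (∑ j, (f j).eval z * (starRingEnd ℂ) ((k j).eval z)) *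
        (starRingEnd ℂ) z ^ n = ∑ j, ∑ m ∈ Finset.range D,
          κ j m * ((f j).eval z * (starRingEnd ℂ) z ^ (n + 1 + m)) := fun z => by
      rw [Finset.sum_mul]
      refine Finset.sum_congr rfl fun j _ => ?_
      rw [hkz, Finset.mul_sum, Finset.sum_mul]
      exact Finset.sum_congr rfl fun m _ => by ring
    simp only [h3]
    rw [integral_finsetSum _ fun j _ => integrable_of_continuous ae_arcMeasure_le (by fun_prop)]
    refine Finset.sum_congr rfl fun j _ => ?_
    rw [integral_finsetSum _ fun j _ => integrable_of_continuous ae_arcMeasure_le (by fun_prop)]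
    simp only [integral_const_mul, integral_arc_coeff]
  simp only [h2, ← hkn] at h1 ⊢
  refine h1.trans ?_
  have h4 : ∫ z, ‖∑ j, (f j).eval z * (starRingEnd ℂ) ((k j).eval z)‖ ^ 2 ∂arcMeasure ≤
      A * ∑ j, polyNormSq (k j) := by
    have h5 : ∫ z, ‖∑ j, (f j).eval z * (starRingEnd ℂ) ((k j).eval z)‖ ^ 2 ∂arcMeasure ≤
        ∫ z, A * ∑ j, ‖(k j).eval z‖ ^ 2 ∂arcMeasure := by
      refine integral_mono_ae (integrable_of_continuous ae_arcMeasure_le (by fun_prop))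
        (integrable_of_continuous ae_arcMeasure_le (by fun_prop)) ?_
      filter_upwards [ae_arcMeasure_le] with z hz
      refine (norm_sum_mul_sq_le _ _).trans ?_
      simp only [norm_conj]
      exact mul_le_mul_of_nonneg_right (hS z hz) (Finset.sum_nonneg fun j _ => by positivity)
    refine h5.trans ?_
    rw [integral_const_mul, integral_finsetSum _ fun j _ =>
      integrable_of_continuous ae_arcMeasure_le (by fun_prop)]
    exact mul_le_mul_of_nonneg_left (Finset.sum_le_sum fun j _ => integral_arc_le _) hA
  have h6 : ∫ z, ‖∑ j, (f j).derivative.eval z * (starRingEnd ℂ) ((k j).eval z)‖ ^ 2 ∂diskMeasure ≤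
      4 * A * ∑ j, polyNormSq (k j) := by
    have h7 : ∫ z, ‖∑ j, (f j).derivative.eval z *
        (starRingEnd ℂ) ((k j).eval z)‖ ^ 2 ∂diskMeasure ≤
        ∫ z, ∑ i, (∑ j, ‖(f j).derivative.eval z‖ ^ 2) * ‖(k i).eval z‖ ^ 2 ∂diskMeasure := by
      refine integral_mono_ae (integrable_of_continuous ae_diskMeasure (by fun_prop))
        (integrable_of_continuous ae_diskMeasure (by fun_prop)) ?_
      refine Filter.Eventually.of_forall fun z => ?_
      refine (norm_sum_mul_sq_le _ _).trans_eq ?_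
      simp only [norm_conj, Finset.mul_sum]
    refine h7.trans ?_
    rw [integral_finsetSum _ fun j _ =>
      integrable_of_continuous ae_diskMeasure (by fun_prop), Finset.mul_sum]
    refine Finset.sum_le_sum fun j _ => ?_
    refine (integral_derivative_mul_le f hf hS (k j)).trans_eq ?_
    ring
  linarith

section Solution

variable {ι : Type*} [Fintype ι] (f : ι → Polynomial ℂ) (H h : Polynomial ℂ)

/-- The sum of the squared moduli of the generators. -/
noncomputable def colSum (z : ℂ) : ℂ := ∑ j, (f j).eval z * (starRingEnd ℂ) ((f j).eval z)

/-- The smooth solution of the Bezout equation. -/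
noncomputable def smoothSol (i : ι) (z : ℂ) : ℂ :=
  (starRingEnd ℂ) ((f i).eval z) * (H.eval z ^ 3 * h.eval z / colSum f z)

/-- The `∂`-derivative of `smoothSol`. -/
noncomputable def smoothSolDeriv (i : ι) (z : ℂ) : ℂ :=
  (starRingEnd ℂ) ((f i).eval z) * ((3 * H.eval z ^ 2 * H.derivative.eval z * h.eval z +
    H.eval z ^ 3 * h.derivative.eval z) / colSum f z - H.eval z ^ 3 * h.eval z *
      (∑ j, (f j).derivative.eval z * (starRingEnd ℂ) ((f j).eval z)) / colSum f z ^ 2)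

/-- The antisymmetric Koszul matrix expressing the `∂̄`-derivative of `smoothSol`. -/
noncomputable def koszul (i j : ι) (z : ℂ) : ℂ :=
  H.eval z ^ 3 * h.eval z / colSum f z ^ 2 *
    ((starRingEnd ℂ) ((f j).eval z) * (starRingEnd ℂ) ((f i).derivative.eval z) -
      (starRingEnd ℂ) ((f i).eval z) * (starRingEnd ℂ) ((f j).derivative.eval z))

variable {f}

theorem continuous_colSum : Continuous (colSum f) := by unfold colSum; fun_prop

theorem continuous_smoothSolDeriv (h0 : ∀ z, colSum f z ≠ 0) (i : ι) :
    Continuous (smoothSolDeriv f H h i) := by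
  have := continuous_colSum (f := f)
  unfold smoothSolDeriv
  exact .mul (by fun_prop) (.sub (.div (by fun_prop) this h0)
    (.div (by fun_prop) (this.pow 2) fun z => pow_ne_zero 2 (h0 z)))

theorem continuous_koszul (h0 : ∀ z, colSum f z ≠ 0) (i j : ι) :
    Continuous (koszul f H h i j) := by
  have := continuous_colSum (f := f)
  unfold koszul
  exact .mul (.div (by fun_prop) (this.pow 2) fun z => pow_ne_zero 2 (h0 z)) (by fun_prop)

theorem hasWirtinger_smoothSol (h0 : ∀ z, colSum f z ≠ 0) (i : ι) :
    HasWirtinger (smoothSol f H h i) (smoothSolDeriv f H h i)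
      (fun z => ∑ j, (f j).eval z * koszul f H h i j z) := by
  have h1 : HasWirtinger (colSum f)
      (fun z => ∑ j, (f j).derivative.eval z * (starRingEnd ℂ) ((f j).eval z))
      (fun z => ∑ j, (f j).eval z * (starRingEnd ℂ) ((f j).derivative.eval z)) :=
    (HasWirtinger.sum Finset.univ fun j _ =>
      (HasWirtinger.polynomial (f j)).mul (HasWirtinger.polynomial (f j)).conj).congr
      (fun z => by simp) (fun z => by simp)
  have h2 := (HasWirtinger.polynomial (f i)).conj.mul
    ((HasWirtinger.polynomial (H ^ 3 * h)).mul (h1.inv h0))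
  have h3 : smoothSol f H h i = fun z => (starRingEnd ℂ) ((f i).eval z) *
      ((H ^ 3 * h).eval z * (colSum f z)⁻¹) := by
    ext z
    simp [smoothSol, div_eq_mul_inv]
  rw [h3]
  refine h2.congr (fun z => ?_) fun z => ?_
  · have := h0 z
    simp only [smoothSolDeriv, Polynomial.derivative_mul, Polynomial.derivative_pow,
      Polynomial.eval_add, Polynomial.eval_mul, Polynomial.eval_pow]
    simp [-mul_eq_mul_left_iff]
    field_simp
    ring
  · have := h0 z
    have h4 : ∑ j, (f j).eval z * koszul f H h i j z = H.eval z ^ 3 * h.eval z / colSum f z ^ 2 *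
        (colSum f z * (starRingEnd ℂ) ((f i).derivative.eval z) -
          (starRingEnd ℂ) ((f i).eval z) *
            ∑ j, (f j).eval z * (starRingEnd ℂ) ((f j).derivative.eval z)) := by
      have h5 : colSum f z * (starRingEnd ℂ) ((f i).derivative.eval z) =
          ∑ j, (f j).eval z * (starRingEnd ℂ) ((f j).eval z) *
            (starRingEnd ℂ) ((f i).derivative.eval z) := by
        rw [colSum, Finset.sum_mul]
      rw [h5, Finset.mul_sum, ← Finset.sum_sub_distrib, Finset.mul_sum]
      refine Finset.sum_congr rfl fun j _ => ?_
      rw [koszul]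
      ring
    rw [h4]
    simp [-mul_eq_mul_left_iff]
    field_simp
    ring

end Solution

section Solution

variable {ι : Type*} [Fintype ι] {f : ι → Polynomial ℂ} (H h : Polynomial ℂ)

theorem colSum_ne_zero (hpos : ∀ z, 0 < ∑ j, ‖(f j).eval z‖ ^ 2) (z : ℂ) : colSum f z ≠ 0 := by
  rw [colSum, sum_mul_conj_eq]
  exact_mod_cast (hpos z).ne'

theorem sum_integral_smoothSol_le {A M : ℝ} (hA0 : 0 ≤ A)
    (hf : ∀ p, ∑ j, polyNormSq (f j * p) ≤ A * polyNormSq p)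
    (hM : ∀ p, polyNormSq (H * p) ≤ M ^ 2 * polyNormSq p)
    (hpos : ∀ z, 0 < ∑ j, ‖(f j).eval z‖ ^ 2)
    (hH : ∀ z : ℂ, ‖z‖ ≤ 1 → ‖H.eval z‖ ^ 2 ≤ ∑ j, ‖(f j).eval z‖ ^ 2) (N : ℕ) :
    ∑ i, ∑ n ∈ Finset.range N, ((n : ℝ) + 1) *
        ‖∫ z, smoothSol f H h i z * (starRingEnd ℂ) z ^ n ∂arcMeasure‖ ^ 2 ≤
      (36 * A * M ^ 2 + 57 * A ^ 2) * polyNormSq h := by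
  have h0 := colSum_ne_zero hpos
  have hS : ∀ w : ℂ, ‖w‖ ≤ 1 → ∑ j, ‖(f j).eval w‖ ^ 2 ≤ A := fun w hw =>
    sum_normSq_eval_le f hA0 hf hw
  have hv := fun i => (hasWirtinger_smoothSol H h h0 i).continuous
  have hP := continuous_smoothSolDeriv H h h0
  have hK := continuous_koszul H h h0
  refine (Finset.sum_le_sum fun i _ => (hasWirtinger_smoothSol H h h0 i).sum_coeff_le (hP i)
    (by fun_prop) N).trans ?_
  rw [Finset.sum_add_distrib, ← integral_finsetSum _ fun i _ =>
    integrable_of_continuous ae_arcMeasure_le (by fun_prop), ← integral_finsetSum _ fun i _ =>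
    integrable_of_continuous ae_diskMeasure (by fun_prop)]
  have h1 : ∫ z, ∑ i, ‖smoothSol f H h i z‖ ^ 2 ∂arcMeasure ≤ A ^ 2 * polyNormSq h := by
    have h2 : ∫ z, ∑ i, ‖smoothSol f H h i z‖ ^ 2 ∂arcMeasure ≤
        ∫ z, A ^ 2 * ‖h.eval z‖ ^ 2 ∂arcMeasure := by
      refine integral_mono_ae (integrable_of_continuous ae_arcMeasure_le (by fun_prop))
        (integrable_of_continuous ae_arcMeasure_le (by fun_prop)) ?_
      filter_upwards [ae_arcMeasure_le] with z hz
      exact sum_solution_le (hpos z) (hS z hz) (hH z hz)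
    refine h2.trans ?_
    rw [integral_const_mul]
    exact mul_le_mul_of_nonneg_left (integral_arc_le h) (by positivity)
  have h3 : ∫ z, ∑ i, ‖smoothSolDeriv f H h i z‖ ^ 2 ∂diskMeasure ≤
      18 * A * ((2 * M ^ 2 + 2 * A) * polyNormSq h) + 4 * A ^ 2 * polyNormSq h +
        4 * A * ((2 * A + 2 * A) * polyNormSq h) := by
    have h4 : ∫ z, ∑ i, ‖smoothSolDeriv f H h i z‖ ^ 2 ∂diskMeasure ≤
        ∫ z, (18 * A * ‖H.derivative.eval z * h.eval z‖ ^ 2 +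
          4 * A ^ 2 * ‖h.derivative.eval z‖ ^ 2 +
          4 * A * ((∑ j, ‖(f j).derivative.eval z‖ ^ 2) * ‖h.eval z‖ ^ 2)) ∂diskMeasure := by
      refine integral_mono_ae (integrable_of_continuous ae_diskMeasure (by fun_prop))
        (integrable_of_continuous ae_diskMeasure (by fun_prop)) ?_
      filter_upwards [ae_diskMeasure] with z hz
      exact sum_dWirtinger_solution_le (hpos z) (hS z hz) (hH z hz)
    refine h4.trans ?_
    have i1 : Integrable (fun z => 18 * A * ‖H.derivative.eval z * h.eval z‖ ^ 2) diskMeasure :=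
      integrable_of_continuous ae_diskMeasure (by fun_prop)
    have i2 : Integrable (fun z => 4 * A ^ 2 * ‖h.derivative.eval z‖ ^ 2) diskMeasure :=
      integrable_of_continuous ae_diskMeasure (by fun_prop)
    have i3 : Integrable (fun z => 4 * A * ((∑ j, ‖(f j).derivative.eval z‖ ^ 2) *
        ‖h.eval z‖ ^ 2)) diskMeasure :=
      integrable_of_continuous ae_diskMeasure (by fun_prop)
    rw [integral_add (by exact i1.add i2) i3, integral_add i1 i2, integral_const_mul,
      integral_const_mul, integral_const_mul]
    have h5 := integral_derivative_mul_le (fun _ : Unit => H) (A := A) (B := M ^ 2)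
      (fun p => by simpa using hM p)
      (fun w hw => by simpa using (hH w hw).trans (hS w hw)) h
    simp only [Finset.univ_unique, Finset.sum_const, Finset.card_singleton, one_smul,
      ← mul_pow, ← norm_mul] at h5
    have h6 := integral_derivative_le h
    have h7 := integral_derivative_mul_le f hf hS h
    gcongr
  refine (add_le_add h1 h3).trans_eq ?_
  ring

theorem sum_integral_koszul_le {A : ℝ} (hA0 : 0 ≤ A)
    (hf : ∀ p, ∑ j, polyNormSq (f j * p) ≤ A * polyNormSq p)
    (hpos : ∀ z, 0 < ∑ j, ‖(f j).eval z‖ ^ 2)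
    (hH : ∀ z : ℂ, ‖z‖ ≤ 1 → ‖H.eval z‖ ^ 2 ≤ ∑ j, ‖(f j).eval z‖ ^ 2) (D : ℕ) :
    ∑ i, ∑ j, ∑ m ∈ Finset.range D, ((m : ℝ) + 2) *
        ‖∫ z, koszul f H h i j z * z ^ m ∂diskMeasure‖ ^ 2 ≤ 32 * A * polyNormSq h := by
  have h0 := colSum_ne_zero hpos
  have hK := continuous_koszul H h h0
  have hS : ∀ w : ℂ, ‖w‖ ≤ 1 → ∑ j, ‖(f j).eval w‖ ^ 2 ≤ A := fun w hw =>
    sum_normSq_eval_le f hA0 hf hw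
  have h1 : ∀ i j, ∑ m ∈ Finset.range D, ((m : ℝ) + 2) *
        ‖∫ z, koszul f H h i j z * z ^ m ∂diskMeasure‖ ^ 2 ≤
      2 * ∫ z, ‖koszul f H h i j z‖ ^ 2 ∂diskMeasure := fun i j => by
    refine le_trans ?_ (mul_le_mul_of_nonneg_left (sum_disk_coeff_conj_le (hK i j) D) zero_le_two)
    rw [Finset.mul_sum]
    refine Finset.sum_le_sum fun m _ => ?_
    rw [← mul_assoc]
    gcongr
    linarith [Nat.cast_nonneg (α := ℝ) m]
  refine (Finset.sum_le_sum fun i _ => Finset.sum_le_sum fun j _ => h1 i j).trans ?_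
  simp only [← Finset.mul_sum]
  have h2 : ∑ i, ∑ j, ∫ z, ‖koszul f H h i j z‖ ^ 2 ∂diskMeasure =
      ∫ z, ∑ i, ∑ j, ‖koszul f H h i j z‖ ^ 2 ∂diskMeasure := by
    rw [integral_finsetSum _ fun i _ => integrable_of_continuous ae_diskMeasure (by fun_prop)]
    refine Finset.sum_congr rfl fun i _ => ?_
    rw [integral_finsetSum _ fun i _ => integrable_of_continuous ae_diskMeasure (by fun_prop)]
  have h3 : ∫ z, ∑ i, ∑ j, ‖koszul f H h i j z‖ ^ 2 ∂diskMeasure ≤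
      ∫ z, 4 * ((∑ j, ‖(f j).derivative.eval z‖ ^ 2) * ‖h.eval z‖ ^ 2) ∂diskMeasure := by
    refine integral_mono_ae (integrable_of_continuous ae_diskMeasure (by fun_prop))
      (integrable_of_continuous ae_diskMeasure (by fun_prop)) ?_
    filter_upwards [ae_diskMeasure] with z hz
    exact sum_koszul_le (hpos z) (hH z hz)
  rw [integral_const_mul] at h3
  have h4 := integral_derivative_mul_le f hf hS h
  rw [h2]
  linarith

theorem integral_smoothSol_mul_pow (h0 : ∀ z, colSum f z ≠ 0) {D : ℕ}
    (hD : ∀ j, (f j).natDegree < D) (i : ι) (k : ℕ) :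
    ∫ z, z * (smoothSol f H h i z * z ^ k) ∂arcMeasure =
      ∑ j, ∑ b ∈ Finset.range D, (f j).coeff b *
        ∫ z, koszul f H h i j z * z ^ (b + k) ∂diskMeasure := by
  have hv := fun i => (hasWirtinger_smoothSol H h h0 i).continuous
  have hP := continuous_smoothSolDeriv H h h0
  have hK := continuous_koszul H h h0
  have h1 := ((hasWirtinger_smoothSol H h h0 i).mul (hasWirtinger_pow k)).green
    (by fun_prop) (by fun_prop)
  rw [h1]
  have h2 : ∀ z, (∑ j, (f j).eval z * koszul f H h i j z) * z ^ k + smoothSol f H h i z * 0 =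
      ∑ j, ∑ b ∈ Finset.range D, (f j).coeff b * (koszul f H h i j z * z ^ (b + k)) :=
    fun z => by
    rw [mul_zero, add_zero, Finset.sum_mul]
    refine Finset.sum_congr rfl fun j _ => ?_
    rw [Polynomial.eval_eq_sum_range' (hD j), Finset.sum_mul, Finset.sum_mul]
    exact Finset.sum_congr rfl fun b _ => by ring
  simp only [h2]
  rw [integral_finsetSum _ fun i _ => integrable_of_continuous ae_diskMeasure (by fun_prop)]
  refine Finset.sum_congr rfl fun j _ => ?_
  rw [integral_finsetSum _ fun i _ => integrable_of_continuous ae_diskMeasure (by fun_prop)]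
  simp only [integral_const_mul]

theorem sum_antisymm_eq_zero {x : ι → ℕ → ℂ} {κ : ι → ι → ℕ → ℂ} (hκ : ∀ i j m, κ j i m = -κ i j m)
    (l R : ℕ) : ∑ i, ∑ j, ∑ a ∈ Finset.range R, ∑ b ∈ Finset.range R,
      (if l < a + b then x i a * (x j b * κ i j (a + b - l - 1)) else 0) = 0 := by
  have h1 : ∀ X : ℂ, X = -X → X = 0 := fun X hX => by
    have : 2 * X = 0 := by linear_combination hX
    simpa using this
  refine h1 _ ?_
  conv_lhs => rw [Finset.sum_comm]
  simp only [← Finset.sum_neg_distrib]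
  refine Finset.sum_congr rfl fun j _ => Finset.sum_congr rfl fun i _ => ?_
  rw [Finset.sum_comm]
  refine Finset.sum_congr rfl fun a _ => Finset.sum_congr rfl fun b _ => ?_
  rw [add_comm b a, hκ j i]
  split_ifs <;> ring

theorem bezout_identity (h0 : ∀ z, colSum f z ≠ 0) {D : ℕ}
    (hD : ∀ j, (f j).natDegree < D) (l : ℕ) :
    ∑ i, ∑ p ∈ antidiagonal l, (f i).coeff p.1 *
      (∫ z, smoothSol f H h i z * (starRingEnd ℂ) z ^ p.2 ∂arcMeasure -
        ∑ j, ∑ m ∈ Finset.range D,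
          (∫ z, koszul f H h i j z * z ^ m ∂diskMeasure) * (f j).coeff (p.2 + 1 + m)) =
      (H ^ 3 * h).coeff l := by
  have hv := fun i => (hasWirtinger_smoothSol H h h0 i).continuous
  obtain ⟨κ, hκ⟩ : ∃ κ : ι → ι → ℕ → ℂ, ∀ i j m,
      ∫ z, koszul f H h i j z * z ^ m ∂diskMeasure = κ i j m := ⟨_, fun _ _ _ => rfl⟩
  have hanti : ∀ i j m, κ j i m = -κ i j m := fun i j m => by
    rw [← hκ, ← hκ, ← integral_neg]
    exact integral_congr_ae (Filter.Eventually.of_forall fun z => by simp only [koszul]; ring)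
  have hG := integral_smoothSol_mul_pow H h h0 hD
  simp only [hκ] at hG ⊢
  have hf0 : ∀ j n, D ≤ n → (f j).coeff n = 0 := fun j n hn =>
    Polynomial.coeff_eq_zero_of_natDegree_lt ((hD j).trans_le hn)
  have hzz : ∀ (a : ℕ) (z : ℂ), ‖z‖ = 1 → z ^ a * (starRingEnd ℂ) z ^ a = 1 :=
    fun a z hz => by
    rw [← mul_pow, mul_conj, normSq_eq_norm_sq, hz]; simp
  have h1 : (H ^ 3 * h).coeff l = ∑ i, ∑ a ∈ Finset.range (l + 1 + D),
      (f i).coeff a * ∫ z, smoothSol f H h i z * z ^ a * (starRingEnd ℂ) z ^ l ∂arcMeasure := by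
    rw [← integral_arc_coeff]
    have h2 : ∀ z, (H ^ 3 * h).eval z * (starRingEnd ℂ) z ^ l =
        ∑ i, ∑ a ∈ Finset.range (l + 1 + D),
          (f i).coeff a * (smoothSol f H h i z * z ^ a * (starRingEnd ℂ) z ^ l) := fun z => by
      have h3 : (H ^ 3 * h).eval z = ∑ i, (f i).eval z * smoothSol f H h i z := by
        simp only [smoothSol, ← mul_assoc, ← Finset.sum_mul]
        change _ = colSum f z * _
        rw [mul_div_cancel₀ _ (h0 z)]
        simp
      rw [h3, Finset.sum_mul]
      refine Finset.sum_congr rfl fun i _ => ?_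
      rw [Polynomial.eval_eq_sum_range' (n := l + 1 + D) (by have := hD i; omega),
        Finset.sum_mul, Finset.sum_mul]
      exact Finset.sum_congr rfl fun b _ => by ring
    simp only [h2]
    rw [integral_finsetSum _ fun i _ => integrable_of_continuous ae_arcMeasure_le (by fun_prop)]
    refine Finset.sum_congr rfl fun j _ => ?_
    rw [integral_finsetSum _ fun i _ => integrable_of_continuous ae_arcMeasure_le (by fun_prop)]
    simp only [integral_const_mul]
  have h4 : ∀ i, ∑ a ∈ Finset.range (l + 1 + D), (f i).coeff a *
      ∫ z, smoothSol f H h i z * z ^ a * (starRingEnd ℂ) z ^ l ∂arcMeasure =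
      ∑ a ∈ Finset.range (l + 1), (f i).coeff a *
        ∫ z, smoothSol f H h i z * (starRingEnd ℂ) z ^ (l - a) ∂arcMeasure +
      ∑ j, ∑ k ∈ Finset.range D, ∑ b ∈ Finset.range D,
        (f i).coeff (l + 1 + k) * ((f j).coeff b * κ i j (b + k)) := fun i => by
    rw [Finset.sum_range_add]
    congr 1
    · refine Finset.sum_congr rfl fun a ha => ?_
      have ha' : a ≤ l := by simpa [Nat.lt_succ_iff] using ha
      congr 1
      refine integral_congr_ae ?_
      filter_upwards [ae_arcMeasure] with z hz
      obtain ⟨k, rfl⟩ := Nat.exists_eq_add_of_le ha'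
      rw [Nat.add_sub_cancel_left, pow_add]
      linear_combination smoothSol f H h i z * (starRingEnd ℂ) z ^ k * hzz a z hz
    · rw [Finset.sum_comm]
      refine Finset.sum_congr rfl fun k _ => ?_
      simp only [← Finset.mul_sum]
      rw [← hG]
      congr 1
      refine integral_congr_ae ?_
      filter_upwards [ae_arcMeasure] with z hz
      linear_combination smoothSol f H h i z * z ^ (k + 1) * hzz l z hz
  have h5 := sum_antisymm_eq_zero (x := fun i n => (f i).coeff n) hanti l (l + 1 + D)
  simp only [← sum_split_diagonal (hf0 _)] at h5
  have h6 : ∀ i, ∑ p ∈ antidiagonal l, (f i).coeff p.1 *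
      (∫ z, smoothSol f H h i z * (starRingEnd ℂ) z ^ p.2 ∂arcMeasure -
        ∑ j, ∑ m ∈ Finset.range D, κ i j m * (f j).coeff (p.2 + 1 + m)) =
      ∑ a ∈ Finset.range (l + 1), (f i).coeff a *
        ∫ z, smoothSol f H h i z * (starRingEnd ℂ) z ^ (l - a) ∂arcMeasure -
      ∑ j, ∑ a ∈ Finset.range (l + 1), ∑ m ∈ Finset.range D,
        (f i).coeff a * ((f j).coeff (l - a + 1 + m) * κ i j m) := fun i => by
    rw [← sum_range_eq_sum_antidiagonal (fun a n => (f i).coeff a *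
      (∫ z, smoothSol f H h i z * (starRingEnd ℂ) z ^ n ∂arcMeasure -
        ∑ j, ∑ m ∈ Finset.range D, κ i j m * (f j).coeff (n + 1 + m))), Finset.sum_comm,
      ← Finset.sum_sub_distrib]
    refine Finset.sum_congr rfl fun a _ => ?_
    rw [mul_sub, Finset.mul_sum]
    congr 1
    refine Finset.sum_congr rfl fun j _ => ?_
    rw [Finset.mul_sum]
    exact Finset.sum_congr rfl fun m _ => by ring
  rw [h1]
  simp only [h4, h6, Finset.sum_add_distrib, Finset.sum_sub_distrib] at h5 ⊢
  linear_combination -h5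

/-- The Bezout equation for polynomial multipliers with uniform estimates. -/
theorem exists_bezout_of_polynomial {A M : ℝ} (hA0 : 0 ≤ A) (hA : A ≤ 3 / 2)
    (hf : ∀ p, ∑ j, polyNormSq (f j * p) ≤ A * polyNormSq p)
    (hM : ∀ p, polyNormSq (H * p) ≤ M ^ 2 * polyNormSq p)
    (hpos : ∀ z, 0 < ∑ j, ‖(f j).eval z‖ ^ 2)
    (hH : ∀ z : ℂ, ‖z‖ ≤ 1 → ‖H.eval z‖ ^ 2 ≤ ∑ j, ‖(f j).eval z‖ ^ 2) :
    ∃ u : ι → ℕ → ℂ, (∀ N, ∑ i, ∑ n ∈ Finset.range N, ((n : ℝ) + 1) * ‖u i n‖ ^ 2 ≤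
        (144 * M ^ 2 + 73104) * polyNormSq h) ∧
      ∀ l, ∑ i, ∑ p ∈ antidiagonal l, (f i).coeff p.1 * u i p.2 = (H ^ 3 * h).coeff l := by
  obtain ⟨D, hD⟩ : ∃ D : ℕ, ∀ j, (f j).natDegree < D :=
    ⟨(Finset.univ.sup fun j => (f j).natDegree) + 1, fun j => Nat.lt_succ_of_le
      (Finset.le_sup (f := fun j => (f j).natDegree) (Finset.mem_univ j))⟩
  have h0 := bezout_identity H h (colSum_ne_zero hpos) hD
  obtain ⟨v, hv⟩ : ∃ v : ι → ℕ → ℂ, ∀ i n,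
    ∫ z, smoothSol f H h i z * (starRingEnd ℂ) z ^ n ∂arcMeasure = v i n := ⟨_, fun _ _ => rfl⟩
  obtain ⟨κ, hκ⟩ : ∃ κ : ι → ι → ℕ → ℂ, ∀ i j m,
    ∫ z, koszul f H h i j z * z ^ m ∂diskMeasure = κ i j m := ⟨_, fun _ _ _ => rfl⟩
  obtain ⟨q, hq⟩ : ∃ q : ι → ℕ → ℂ, ∀ i n,
    ∑ j, ∑ m ∈ Finset.range D, κ i j m * (f j).coeff (n + 1 + m) = q i n := ⟨_, fun _ _ => rfl⟩
  simp only [hv, hκ, hq] at h0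
  refine ⟨fun i n => v i n - q i n, fun N => ?_, h0⟩
  have h1 := sum_integral_smoothSol_le H h hA0 hf hM hpos hH N
  have h2 := Finset.sum_le_sum fun i (_ : i ∈ Finset.univ) => sum_hankel_le f hA0 hf
    (κ i) D N
  rw [← Finset.mul_sum] at h2
  have h3 := sum_integral_koszul_le H h hA0 hf hpos hH D
  simp only [hv, hκ, hq] at h1 h2 h3
  have h4 : ∀ x y : ℂ, ‖x - y‖ ^ 2 ≤ 2 * ‖x‖ ^ 2 + 2 * ‖y‖ ^ 2 := fun x y => by
    refine (pow_le_pow_left₀ (norm_nonneg _) (norm_sub_le _ _) 2).trans ?_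
    nlinarith [sq_nonneg (‖x‖ - ‖y‖)]
  refine (Finset.sum_le_sum fun i _ => Finset.sum_le_sum fun n _ =>
    mul_le_mul_of_nonneg_left (h4 _ _) (by positivity)).trans ?_
  simp only [mul_add, Finset.sum_add_distrib, mul_left_comm _ (2 : ℝ), ← Finset.mul_sum]
  have h5 := mul_le_mul_of_nonneg_left h3 (show 0 ≤ 5 * A by positivity)
  have h6 : 2 * ((36 * A * M ^ 2 + 57 * A ^ 2) * polyNormSq h) +
      2 * (5 * A * (32 * A * polyNormSq h)) ≤ (144 * M ^ 2 + 73104) * polyNormSq h := by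
    have h7 : 2 * (36 * A * M ^ 2 + 57 * A ^ 2) + 2 * (5 * A * (32 * A)) ≤
        144 * M ^ 2 + 73104 := by nlinarith [sq_nonneg M]
    have := mul_le_mul_of_nonneg_right h7 (polyNormSq_nonneg h)
    linarith
  linarith

end Solution

/-- The finite column of power series `a` multiplies the Dirichlet space with squared norm at
most `A`. -/
def ColBound {ι : Type*} [Fintype ι] (a : ι → ℕ → ℂ) (A : ℝ) : Prop :=
  ∀ (N : ℕ) (h : ℕ → ℂ), ∑ i, ∑ n ∈ Finset.range N, ((n : ℝ) + 1) *
    ‖∑ p ∈ antidiagonal n, a i p.1 * h p.2‖ ^ 2 ≤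
      A * ∑ n ∈ Finset.range N, ((n : ℝ) + 1) * ‖h n‖ ^ 2

/-- Schur multiplication by a positive semidefinite Toeplitz kernel preserves column bounds. -/
theorem ColBound.schur {ι : Type*} [Fintype ι] {a : ι → ℕ → ℂ} {A : ℝ} (ha : ColBound a A)
    (hA : 0 ≤ A) {c : ℕ → ℝ}
    (hc : ∀ N : ℕ, ∃ (R : ℕ) (x : ℕ → ℕ → ℝ), (∀ n < N, ∑ s ∈ Finset.range R, x s n ^ 2 ≤ 1) ∧
      ∀ n < N, ∀ m ≤ n, c (n - m) = ∑ s ∈ Finset.range R, x s n * x s m) :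
    ColBound (fun i l => (c l : ℂ) * a i l) A := by
  intro N h
  obtain ⟨R, x, hx1, hx2⟩ := hc N
  have h1 : ∀ i, ∀ n < N, ‖∑ p ∈ antidiagonal n, (c p.1 : ℂ) * a i p.1 * h p.2‖ ^ 2 ≤
      ∑ s ∈ Finset.range R, ‖∑ p ∈ antidiagonal n, a i p.1 * ((x s p.2 : ℂ) * h p.2)‖ ^ 2 :=
    fun i n hn => by
    have h2 : ∑ p ∈ antidiagonal n, (c p.1 : ℂ) * a i p.1 * h p.2 = ∑ s ∈ Finset.range R,
        (x s n : ℂ) * ∑ p ∈ antidiagonal n, a i p.1 * ((x s p.2 : ℂ) * h p.2) := by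
      simp only [Finset.mul_sum]
      rw [Finset.sum_comm]
      refine Finset.sum_congr rfl fun p hp => ?_
      have hp' := mem_antidiagonal.1 hp
      rw [show p.1 = n - p.2 by omega, hx2 n hn p.2 (by omega)]
      push_cast
      rw [Finset.sum_mul, Finset.sum_mul]
      exact Finset.sum_congr rfl fun s _ => by ring
    rw [h2]
    refine (pow_le_pow_left₀ (norm_nonneg _) (norm_sum_le _ _) 2).trans ?_
    simp only [norm_mul ((x _ n : ℝ) : ℂ), norm_real]
    refine (Finset.sum_mul_sq_le_sq_mul_sq _ _ _).trans ?_
    simp only [Real.norm_eq_abs, sq_abs]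
    exact mul_le_of_le_one_left (Finset.sum_nonneg fun s _ => by positivity) (hx1 n hn)
  have h3 : ∑ i, ∑ n ∈ Finset.range N, ((n : ℝ) + 1) *
      ‖∑ p ∈ antidiagonal n, (c p.1 : ℂ) * a i p.1 * h p.2‖ ^ 2 ≤
      ∑ s ∈ Finset.range R, ∑ i, ∑ n ∈ Finset.range N, ((n : ℝ) + 1) *
        ‖∑ p ∈ antidiagonal n, a i p.1 * ((x s p.2 : ℂ) * h p.2)‖ ^ 2 := by
    rw [Finset.sum_comm (s := Finset.range R)]
    refine Finset.sum_le_sum fun i _ => ?_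
    rw [Finset.sum_comm (s := Finset.range R)]
    refine Finset.sum_le_sum fun n hn => ?_
    rw [← Finset.mul_sum]
    exact mul_le_mul_of_nonneg_left (h1 i n (Finset.mem_range.1 hn)) (by positivity)
  refine h3.trans ((Finset.sum_le_sum fun s _ => ha N fun n => (x s n : ℂ) * h n).trans ?_)
  rw [← Finset.mul_sum, Finset.sum_comm]
  refine mul_le_mul_of_nonneg_left (Finset.sum_le_sum fun n hn => ?_) hA
  simp only [norm_mul, norm_real, mul_pow, Real.norm_eq_abs, sq_abs, ← Finset.mul_sum,
    ← Finset.sum_mul]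
  refine mul_le_mul_of_nonneg_left ?_ (by positivity)
  exact mul_le_of_le_one_left (by positivity) (hx1 n (Finset.mem_range.1 hn))

theorem ColBound.norm_le {ι : Type*} [Fintype ι] {a : ι → ℕ → ℂ} {A : ℝ} (ha : ColBound a A)
    (l : ℕ) : ∑ i, ‖a i l‖ ^ 2 ≤ A := by
  have h1 := ha (l + 1) (fun n => if n = 0 then 1 else 0)
  have h2 : ∀ i n, ∑ p ∈ antidiagonal n, a i p.1 * (if p.2 = 0 then 1 else 0) = a i n :=
    fun i n => by
    rw [Finset.sum_eq_single (n, 0)]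
    · simp
    · rintro ⟨p, q⟩ hp hne
      have := mem_antidiagonal.1 hp
      simp only at this
      rw [if_neg, mul_zero]
      rintro rfl
      exact hne (by simp at this; simp [this])
    · intro h
      exact absurd (mem_antidiagonal.2 (by simp)) h
  have h3 : ∑ n ∈ Finset.range (l + 1), ((n : ℝ) + 1) * ‖(if n = 0 then 1 else 0 : ℂ)‖ ^ 2 = 1 := by
    rw [Finset.sum_range_succ', Finset.sum_eq_zero] <;> simp
  simp only [h2] at h1
  rw [h3, mul_one] at h1
  refine le_trans (Finset.sum_le_sum fun i _ => ?_) h1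
  have h4 := Finset.single_le_sum (f := fun n : ℕ => ((n : ℝ) + 1) * ‖a i n‖ ^ 2)
    (fun n _ => by positivity) (Finset.mem_range.2 (Nat.lt_succ_self l))
  refine le_trans ?_ h4
  exact le_mul_of_one_le_left (by positivity) (by simp)

/-- The normalized autocorrelation sequence of `1, r, …, r ^ (K - 1)`. -/
noncomputable def autoCorr (r : ℝ) (K l : ℕ) : ℝ :=
  r ^ l * (∑ s ∈ Finset.range (K - l), r ^ (2 * s)) / ∑ s ∈ Finset.range K, r ^ (2 * s)

section AutoCorr

variable {r : ℝ} {K : ℕ}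

theorem sum_pow_pos (hr : 0 < r) (hK : 0 < K) : 0 < ∑ s ∈ Finset.range K, r ^ (2 * s) :=
  Finset.sum_pos (fun s _ => by positivity) (Finset.nonempty_range_iff.2 hK.ne')

theorem autoCorr_nonneg (hr : 0 < r) (l : ℕ) : 0 ≤ autoCorr r K l :=
  div_nonneg (mul_nonneg (by positivity) (Finset.sum_nonneg fun s _ => by positivity))
    (Finset.sum_nonneg fun s _ => by positivity)

theorem autoCorr_le (hr : 0 < r) (hK : 0 < K) (l : ℕ) : autoCorr r K l ≤ r ^ l := by
  rw [autoCorr, div_le_iff₀ (sum_pow_pos hr hK)]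
  refine mul_le_mul_of_nonneg_left ?_ (by positivity)
  exact Finset.sum_le_sum_of_subset_of_nonneg (Finset.range_subset_range.2 (Nat.sub_le _ _))
    fun s _ _ => by positivity

theorem autoCorr_eq_zero {l : ℕ} (h : K ≤ l) : autoCorr r K l = 0 := by
  simp [autoCorr, Nat.sub_eq_zero_of_le h]

theorem tendsto_autoCorr (hr : 0 < r) (hr1 : r < 1) (l : ℕ) :
    Filter.Tendsto (fun K => autoCorr r K l) Filter.atTop (nhds (r ^ l)) := by
  have h1 : HasSum (fun s : ℕ => r ^ (2 * s)) (1 - r ^ 2)⁻¹ := by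
    simpa only [pow_mul] using hasSum_geometric_of_lt_one (by positivity) (by nlinarith : r ^ 2 < 1)
  have h2 := h1.tendsto_sum_nat
  have h3 := h2.comp (Filter.tendsto_sub_atTop_nat l)
  have h4 : (1 - r ^ 2)⁻¹ ≠ 0 := inv_ne_zero (by nlinarith)
  have h5 := (h3.const_mul (r ^ l)).div h2 h4
  rw [mul_div_assoc, div_self h4, mul_one] at h5
  exact h5

theorem autoCorr_kernel (hr : 0 < r) (hK : 0 < K) (N : ℕ) : ∃ (R : ℕ) (x : ℕ → ℕ → ℝ),
    (∀ n < N, ∑ s ∈ Finset.range R, x s n ^ 2 ≤ 1) ∧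
      ∀ n < N, ∀ m ≤ n, autoCorr r K (n - m) = ∑ s ∈ Finset.range R, x s n * x s m := by
  have hpos := sum_pow_pos hr hK
  set Γ := ∑ s ∈ Finset.range K, r ^ (2 * s) with hΓ
  let x : ℕ → ℕ → ℝ := fun s n => if n ≤ s ∧ s < n + K then r ^ (s - n) / √Γ else 0
  have h1 : ∀ n < N, ∀ m ≤ n, autoCorr r K (n - m) =
      ∑ s ∈ Finset.range (N + K), x s n * x s m := fun n hn m hm => by
    have h2 : ∀ s, x s n * x s m =
        if n ≤ s ∧ s < m + K then r ^ (s - n) * r ^ (s - m) / Γ else 0 := fun s => by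
      by_cases h : n ≤ s ∧ s < m + K
      · simp only [x]
        rw [if_pos h, if_pos (by omega), if_pos (by omega), div_mul_div_comm,
          Real.mul_self_sqrt hpos.le]
      · rw [if_neg h]
        simp only [x]
        by_cases h' : n ≤ s ∧ s < n + K
        · rw [if_neg (c := m ≤ s ∧ s < m + K) (by omega), mul_zero]
        · rw [if_neg h', zero_mul]
    have h3 : (Finset.range (N + K)).filter (fun s => n ≤ s ∧ s < m + K) =
        Finset.Ico n (m + K) := by
      ext s
      simp only [Finset.mem_filter, Finset.mem_range, Finset.mem_Ico]
      omega
    simp only [h2]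
    rw [← Finset.sum_filter, h3, Finset.sum_Ico_eq_sum_range, autoCorr, Finset.mul_sum,
      Finset.sum_div, show m + K - n = K - (n - m) by omega]
    refine Finset.sum_congr rfl fun s _ => ?_
    rw [← hΓ]
    congr 1
    rw [← pow_add, ← pow_add]
    congr 1
    omega
  refine ⟨N + K, x, fun n hn => ?_, h1⟩
  have := h1 n hn n le_rfl
  simp only [sq]
  rw [← this, Nat.sub_self]
  simpa using autoCorr_le hr hK 0

end AutoCorr

/-- The polynomial with coefficients `autoCorr r K l * a l`. -/
noncomputable def smoothed (r : ℝ) (K : ℕ) (a : ℕ → ℂ) : Polynomial ℂ :=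
  ∑ l ∈ Finset.range K, Polynomial.monomial l ((autoCorr r K l : ℂ) * a l)

theorem coeff_smoothed (r : ℝ) (K : ℕ) (a : ℕ → ℂ) (l : ℕ) :
    (smoothed r K a).coeff l = (autoCorr r K l : ℂ) * a l := by
  simp only [smoothed, Polynomial.finsetSum_coeff, Polynomial.coeff_monomial]
  rw [Finset.sum_ite_eq']
  split_ifs with h
  · rfl
  · rw [autoCorr_eq_zero (by simpa using h)]; simp

theorem eval_smoothed (r : ℝ) (K : ℕ) (a : ℕ → ℂ) (z : ℂ) :
    (smoothed r K a).eval z = ∑ l ∈ Finset.range K, (autoCorr r K l : ℂ) * a l * z ^ l := by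
  simp [smoothed, Polynomial.eval_finsetSum]

theorem ColBound.polyNormSq_le {ι : Type*} [Fintype ι] {f : ι → Polynomial ℂ} {A : ℝ}
    (hf : ColBound (fun i => (f i).coeff) A) (p : Polynomial ℂ) :
    ∑ i, polyNormSq (f i * p) ≤ A * polyNormSq p := by
  obtain ⟨D, hD⟩ : ∃ D : ℕ, ∀ j, (f j).natDegree ≤ D :=
    ⟨Finset.univ.sup fun j => (f j).natDegree, fun j =>
      Finset.le_sup (f := fun j => (f j).natDegree) (Finset.mem_univ j)⟩
  have h1 := hf (D + p.natDegree + 1) p.coeff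
  rw [← polyNormSq_eq (by omega)] at h1
  refine le_of_eq_of_le (Finset.sum_congr rfl fun i _ => ?_) h1
  rw [polyNormSq_eq (N := D + p.natDegree + 1)
    (by have := Polynomial.natDegree_mul_le (p := f i) (q := p); have := hD i; omega)]
  simp only [Polynomial.coeff_mul]

theorem sum_antidiagonal_eq_sum_range_ite {M : Type*} [AddCommMonoid M] (f : ℕ → ℕ → M) {n N : ℕ}
    (h : n < N) : ∑ p ∈ antidiagonal n, f p.1 p.2 =
      ∑ l ∈ Finset.range N, if l ≤ n then f (n - l) l else 0 := by
  rw [sum_antidiagonal_comm, ← sum_range_eq_sum_antidiagonal (fun a b => f b a),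
    ← Finset.sum_filter]
  refine Finset.sum_congr ?_ fun _ _ => rfl
  ext l
  simp only [Finset.mem_range, Finset.mem_filter]
  omega

theorem norm_sum_conv_sq_le {ι : Type*} [Fintype ι] (a u : ι → ℕ → ℂ) (q c : ℕ → ℂ) {B : ℝ} (N : ℕ)
    (hu : ∑ i, ∑ n ∈ Finset.range N, ((n : ℝ) + 1) * ‖u i n‖ ^ 2 ≤ B)
    (hq : ∀ l, ∑ i, ∑ p ∈ antidiagonal l, a i p.1 * u i p.2 = q l) :
    ‖∑ n ∈ Finset.range N, c n * q n‖ ^ 2 ≤ B * ∑ l ∈ Finset.range N, 1 / ((l : ℝ) + 1) *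
      ∑ i, ‖∑ n ∈ Finset.range N, if l ≤ n then c n * a i (n - l) else 0‖ ^ 2 := by
  have h1 : ∑ n ∈ Finset.range N, c n * q n = ∑ l ∈ Finset.range N, ∑ i,
      u i l * ∑ n ∈ Finset.range N, if l ≤ n then c n * a i (n - l) else 0 := by
    simp only [Finset.mul_sum]
    refine Eq.trans ?_ (Finset.sum_congr rfl fun l _ =>
      Finset.sum_comm (s := Finset.range N) (t := Finset.univ))
    rw [Finset.sum_comm (s := Finset.range N)]
    refine Finset.sum_congr rfl fun n hn => ?_
    rw [← hq, Finset.sum_comm (s := Finset.range N), Finset.mul_sum]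
    refine Finset.sum_congr rfl fun i _ => ?_
    rw [sum_antidiagonal_eq_sum_range_ite (fun k l => a i k * u i l) (Finset.mem_range.1 hn),
      Finset.mul_sum]
    refine Finset.sum_congr rfl fun l _ => ?_
    split_ifs <;> ring
  set y : ι → ℕ → ℂ := fun i l => ∑ n ∈ Finset.range N, if l ≤ n then c n * a i (n - l) else 0
  have h2 : ‖∑ n ∈ Finset.range N, c n * q n‖ ≤ ∑ x ∈ Finset.range N ×ˢ Finset.univ,
      (√((x.1 : ℝ) + 1) * ‖u x.2 x.1‖) * (‖y x.2 x.1‖ / √((x.1 : ℝ) + 1)) := by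
    rw [h1, Finset.sum_product]
    refine (norm_sum_le _ _).trans (Finset.sum_le_sum fun l _ => ?_)
    refine (norm_sum_le _ _).trans (Finset.sum_le_sum fun i _ => le_of_eq ?_)
    have : √((l : ℝ) + 1) ≠ 0 := by positivity
    rw [norm_mul]
    field_simp
    rfl
  refine (pow_le_pow_left₀ (norm_nonneg _) h2 2).trans ?_
  refine (Finset.sum_mul_sq_le_sq_mul_sq _ _ _).trans ?_
  simp only [mul_pow, div_pow]
  rw [Finset.sum_product, Finset.sum_product]
  have h3 : ∀ l : ℕ, √((l : ℝ) + 1) ^ 2 = (l : ℝ) + 1 := fun l => Real.sq_sqrt (by positivity)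
  simp only [h3]
  refine mul_le_mul ?_ (le_of_eq ?_) (Finset.sum_nonneg fun l _ => Finset.sum_nonneg fun i _ => by
    positivity) ((Finset.sum_nonneg fun i _ => Finset.sum_nonneg fun n _ => by positivity).trans hu)
  · rw [Finset.sum_comm]
    exact hu
  · refine Finset.sum_congr rfl fun l _ => ?_
    rw [Finset.mul_sum]
    exact Finset.sum_congr rfl fun i _ => by ring

theorem lp.hasSum_norm_sq (x : lp (fun _ : ℕ => ℂ) 2) : HasSum (fun j => ‖x j‖ ^ 2) (‖x‖ ^ 2) := by
  have := lp.hasSum_norm (p := 2) (by norm_num) x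
  simpa using this

theorem lp.sum_norm_sq_le (x : lp (fun _ : ℕ => ℂ) 2) (J : ℕ) :
    ∑ j : Fin J, ‖x j‖ ^ 2 ≤ ‖x‖ ^ 2 := by
  rw [Fin.sum_univ_eq_sum_range (fun j => ‖x j‖ ^ 2)]
  exact sum_le_hasSum _ (fun _ _ => by positivity) (lp.hasSum_norm_sq x)

theorem lp.norm_sum_smul_sq_le (v : ℕ → lp (fun _ : ℕ => ℂ) 2) {c : ℕ → ℂ} (hc : ∀ l, ‖c l‖ ≤ 1)
    (K J : ℕ) : ‖∑ l ∈ Finset.range K, c l • v l‖ ^ 2 ≤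
      ∑ j : Fin J, ‖(∑ l ∈ Finset.range K, c l • v l) j‖ ^ 2 +
        K * ∑ l ∈ Finset.range K, (‖v l‖ ^ 2 - ∑ j ∈ Finset.range J, ‖v l j‖ ^ 2) := by
  set x := ∑ l ∈ Finset.range K, c l • v l with hx
  have h1 : ∀ j, ‖x j‖ ^ 2 ≤ K * ∑ l ∈ Finset.range K, ‖v l j‖ ^ 2 := fun j => by
    have h2 : x j = ∑ l ∈ Finset.range K, c l * v l j := by
      rw [hx]
      simp only [lp.coeFn_sum, Finset.sum_apply, lp.coeFn_smul, Pi.smul_apply, smul_eq_mul]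
    rw [h2]
    refine (pow_le_pow_left₀ (norm_nonneg _) (norm_sum_le _ _) 2).trans ?_
    refine (sq_sum_le_card_mul_sum_sq).trans ?_
    rw [Finset.card_range]
    gcongr with l
    rw [norm_mul]
    exact mul_le_of_le_one_left (norm_nonneg _) (hc l)
  have h2 := (((hasSum_sum fun l (_ : l ∈ Finset.range K) => lp.hasSum_norm_sq (v l)).mul_left
    (K : ℝ)).sub (lp.hasSum_norm_sq x))
  have h3 := sum_le_hasSum (Finset.range J) (fun j _ => sub_nonneg.2 (h1 j)) h2
  rw [Finset.sum_sub_distrib, ← Finset.mul_sum, Finset.sum_comm] at h3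
  rw [Fin.sum_univ_eq_sum_range (fun j => ‖x j‖ ^ 2), Finset.sum_sub_distrib, mul_sub]
  linarith

section AutoCorr

variable {r : ℝ} {K : ℕ}

theorem summable_sub_autoCorr (hr : 0 < r) (hr1 : r < 1) (K : ℕ) :
    Summable fun l => r ^ l - autoCorr r K l := by
  refine (summable_geometric_of_lt_one hr.le hr1).sub (summable_of_ne_finset_zero
    (s := Finset.range K) fun l hl => autoCorr_eq_zero (by simpa using hl))

theorem tendsto_tsum_sub_autoCorr (hr : 0 < r) (hr1 : r < 1) :
    Filter.Tendsto (fun K => ∑' l, (r ^ l - autoCorr r K l)) Filter.atTop (nhds 0) := by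
  have h := tendsto_tsum_of_dominated_convergence (𝓕 := Filter.atTop)
    (f := fun K l => r ^ l - autoCorr r K l) (g := fun _ => (0 : ℝ))
    (summable_geometric_of_lt_one hr.le hr1) (fun l => by
      simpa using (tendsto_const_nhds (x := r ^ l)).sub (tendsto_autoCorr hr hr1 l)) ?_
  · simpa using h
  · filter_upwards [Filter.eventually_gt_atTop 0] with K hK l
    rw [Real.norm_of_nonneg (sub_nonneg.2 (autoCorr_le hr hK l))]
    linarith [autoCorr_nonneg (K := K) hr l]

theorem norm_tsum_sub_autoCorr_le {E : Type*} [NormedAddCommGroup E] [NormedSpace ℂ E]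
    [CompleteSpace E] (hr : 0 < r) (hr1 : r < 1) (hK : 0 < K) {v : ℕ → E} {B : ℝ}
    (hv : ∀ l, ‖v l‖ ≤ B) {z : ℂ} (hz : ‖z‖ ≤ 1) :
    ‖∑' l, (r * z) ^ l • v l - ∑ l ∈ Finset.range K, ((autoCorr r K l : ℂ) * z ^ l) • v l‖ ≤
      B * ∑' l, (r ^ l - autoCorr r K l) := by
  have hB : 0 ≤ B := (norm_nonneg _).trans (hv 0)
  have hzl : ∀ l, ‖z ^ l‖ ≤ 1 := fun l => by
    rw [norm_pow]
    exact pow_le_one₀ (norm_nonneg _) hz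
  have h1 : Summable fun l => (r * z) ^ l • v l := by
    refine Summable.of_norm_bounded ((summable_geometric_of_lt_one hr.le hr1).mul_right B)
      fun l => ?_
    rw [norm_smul, mul_pow, norm_mul, norm_pow, norm_real, Real.norm_of_nonneg hr.le]
    exact mul_le_mul (mul_le_of_le_one_right (by positivity) (hzl l)) (hv l) (norm_nonneg _)
      (by positivity)
  have h2 : HasSum (fun l => ((autoCorr r K l : ℂ) * z ^ l) • v l)
      (∑ l ∈ Finset.range K, ((autoCorr r K l : ℂ) * z ^ l) • v l) :=
    hasSum_sum_of_ne_finset_zero fun l hl => by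
      rw [autoCorr_eq_zero (by simpa using hl)]
      simp
  rw [← h2.tsum_eq, ← h1.tsum_sub h2.summable, ← tsum_mul_left]
  refine tsum_of_norm_bounded ((summable_sub_autoCorr hr hr1 K).mul_left B).hasSum fun l => ?_
  have h3 : (r * z) ^ l • v l - ((autoCorr r K l : ℂ) * z ^ l) • v l =
      (((r ^ l - autoCorr r K l : ℝ) : ℂ) * z ^ l) • v l := by
    rw [← sub_smul]
    push_cast
    ring_nf
  have h4 := sub_nonneg.2 (autoCorr_le hr hK l)
  rw [h3, norm_smul, norm_mul, norm_real, Real.norm_of_nonneg h4, mul_comm B]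
  exact mul_le_mul (mul_le_of_le_one_right h4 (hzl l)) (hv l) (norm_nonneg _) h4

end AutoCorr

theorem eventually_normSq_smoothed_le {η : ℕ → ℂ} {a : ℕ → ℕ → ℂ} {v : ℕ → lp (fun _ : ℕ => ℂ) 2}
    (hva : ∀ l j, v l j = star (a j l)) (hv : ∀ l, ‖v l‖ ≤ 1) {B : ℝ} (hη : ∀ l, ‖η l‖ ≤ B)
    (hpt : ∀ z : ℂ, ‖z‖ < 1 → ‖∑' l, z ^ l • η l‖ ≤ ‖∑' l, star z ^ l • v l‖)
    {r ε : ℝ} (hr : 0 < r) (hr1 : r < 1) (hε : 0 < ε) :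
    ∀ᶠ K in Filter.atTop, ∃ J : ℕ, ∀ z : ℂ, ‖z‖ ≤ 1 →
      ‖(smoothed r K η).eval z‖ ^ 2 ≤ ε + ∑ j : Fin J, ‖(smoothed r K (a j)).eval z‖ ^ 2 := by
  have hB : 0 ≤ B := (norm_nonneg _).trans (hη 0)
  have h1 : Filter.Tendsto (fun K => ((B + 1) * ∑' l, (r ^ l - autoCorr r K l)) ^ 2 +
      2 * (1 - r)⁻¹ * ((B + 1) * ∑' l, (r ^ l - autoCorr r K l))) Filter.atTop (nhds 0) := by
    have h := (tendsto_tsum_sub_autoCorr hr hr1).const_mul (B + 1)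
    simpa using (h.pow 2).add (h.const_mul (2 * (1 - r)⁻¹))
  filter_upwards [h1.eventually (gt_mem_nhds (half_pos hε)), Filter.eventually_gt_atTop 0]
    with K hK1 hK
  generalize hδ : (B + 1) * ∑' l, (r ^ l - autoCorr r K l) = δ at hK1
  have h2 : Filter.Tendsto (fun J => (K : ℝ) * ∑ l ∈ Finset.range K,
      (‖v l‖ ^ 2 - ∑ j ∈ Finset.range J, ‖v l j‖ ^ 2)) Filter.atTop (nhds 0) := by
    have h : Filter.Tendsto (fun J => (K : ℝ) * ∑ l ∈ Finset.range K,
      (‖v l‖ ^ 2 - ∑ j ∈ Finset.range J, ‖v l j‖ ^ 2)) Filter.atTop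
      (nhds ((K : ℝ) * ∑ l ∈ Finset.range K, (‖v l‖ ^ 2 - ‖v l‖ ^ 2))) :=
      (tendsto_finsetSum _ fun l _ => tendsto_const_nhds.sub
        (lp.hasSum_norm_sq (v l)).tendsto_sum_nat).const_mul _
    simpa using h
  obtain ⟨J, hJ⟩ := (h2.eventually (gt_mem_nhds (half_pos hε))).exists
  refine ⟨J, fun z hz => ?_⟩
  have hzs : ‖star z‖ ≤ 1 := by rwa [norm_star]
  obtain ⟨x, hx⟩ : ∃ x, x = ∑ l ∈ Finset.range K, ((autoCorr r K l : ℂ) * star z ^ l) • v l :=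
    ⟨_, rfl⟩
  have hτ : ∀ l, ‖(autoCorr r K l : ℂ) * star z ^ l‖ ≤ r ^ l := fun l => by
    rw [norm_mul, norm_real, Real.norm_of_nonneg (autoCorr_nonneg hr l), norm_pow]
    exact (mul_le_of_le_one_right (autoCorr_nonneg hr l) (pow_le_one₀ (norm_nonneg _) hzs)).trans
      (autoCorr_le hr hK l)
  have h3 := lp.norm_sum_smul_sq_le v (fun l => (hτ l).trans (pow_le_one₀ hr.le hr1.le)) K J
  rw [← hx] at h3
  have h4 : ∀ j, x j = star ((smoothed r K (a j)).eval z) := fun j => by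
    rw [hx, eval_smoothed]
    simp only [lp.coeFn_sum, Finset.sum_apply, lp.coeFn_smul, Pi.smul_apply, smul_eq_mul, hva,
      star_sum, star_mul', star_pow]
    refine Finset.sum_congr rfl fun l _ => ?_
    simp
    ring
  simp only [h4, norm_star] at h3
  have h5 : ‖x‖ ≤ (1 - r)⁻¹ := by
    rw [hx, ← tsum_geometric_of_lt_one hr.le hr1]
    refine (norm_sum_le _ _).trans ((Finset.sum_le_sum fun l _ => ?_).trans
      ((summable_geometric_of_lt_one hr.le hr1).sum_le_tsum _ fun _ _ => by positivity))
    rw [norm_smul]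
    exact (mul_le_of_le_one_right (norm_nonneg _) (hv l)).trans (hτ l)
  have h6 := norm_tsum_sub_autoCorr_le hr hr1 hK hη hz
  have h7 := norm_tsum_sub_autoCorr_le hr hr1 hK hv hzs
  rw [← hx] at h7
  have h8 : ∑ l ∈ Finset.range K, ((autoCorr r K l : ℂ) * z ^ l) • η l =
      (smoothed r K η).eval z := by
    rw [eval_smoothed]
    exact Finset.sum_congr rfl fun l _ => by rw [smul_eq_mul]; ring
  rw [h8] at h6
  have h9 := hpt (r * z) (by
    rw [norm_mul, norm_real, Real.norm_of_nonneg hr.le]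
    exact (mul_le_of_le_one_right hr.le hz).trans_lt hr1)
  have h10 : star ((r : ℂ) * z) = r * star z := by simp
  rw [h10] at h9
  have h11 := norm_sub_norm_le ((smoothed r K η).eval z) (∑' l, (r * z) ^ l • η l)
  rw [norm_sub_rev] at h11
  have h12 := norm_sub_norm_le (∑' l, (r * star z) ^ l • v l) x
  have h13 : ‖(smoothed r K η).eval z‖ ≤ ‖x‖ + δ := by
    rw [← hδ]
    linarith
  have h14 : 0 ≤ δ := by
    rw [← hδ]
    exact mul_nonneg (by linarith) (tsum_nonneg fun l => sub_nonneg.2 (autoCorr_le hr hK l))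
  have h15 := pow_le_pow_left₀ (norm_nonneg _) h13 2
  nlinarith [mul_le_mul_of_nonneg_right h5 h14]

/-- The coefficients of the cube of the power series with coefficients `b`. -/
noncomputable def cauchyCube (b : ℕ → ℂ) (n : ℕ) : ℂ :=
  ∑ p ∈ antidiagonal n, (∑ q ∈ antidiagonal p.1, b q.1 * b q.2) * b p.2

theorem coeff_cube_mul (H h : Polynomial ℂ) (n : ℕ) : (H ^ 3 * h).coeff n =
    ∑ p ∈ antidiagonal n, cauchyCube H.coeff p.1 * h.coeff p.2 := by
  rw [Polynomial.coeff_mul]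
  refine Finset.sum_congr rfl fun p _ => ?_
  rw [pow_succ, pow_two, Polynomial.coeff_mul]
  simp only [Polynomial.coeff_mul, cauchyCube]

theorem polyNormSq_C_mul (e : ℂ) (p : Polynomial ℂ) :
    polyNormSq (Polynomial.C e * p) = ‖e‖ ^ 2 * polyNormSq p := by
  rw [polyNormSq_eq (p := p) (Nat.lt_succ_self _), polyNormSq_eq (N := p.natDegree.succ)
    (Nat.lt_succ_of_le (Polynomial.natDegree_C_mul_le _ _)), Finset.mul_sum]
  refine Finset.sum_congr rfl fun n _ => ?_
  rw [Polynomial.coeff_C_mul, norm_mul]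
  ring

section Approximation

variable {η : ℕ → ℂ} {a : ℕ → ℕ → ℂ} {v : ℕ → lp (fun _ : ℕ => ℂ) 2} {M : ℝ}

/-- The range inequality for the series with coefficients `s l * η l` and `s l • v l`, tested
against `c` and `h` and regularized by `ε`. -/
def RangeIneq (η : ℕ → ℂ) (v : ℕ → lp (fun _ : ℕ => ℂ) 2) (B : ℝ) (c h : ℕ → ℂ) (N : ℕ)
    (s : ℕ → ℝ) (ε : ℝ) : Prop :=
  ‖∑ n ∈ Finset.range N, star (c n) *
      ∑ p ∈ antidiagonal n, cauchyCube (fun l => (s l : ℂ) * η l) p.1 * h p.2‖ ^ 2 ≤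
    B * ∑ l ∈ Finset.range N, 1 / ((l : ℝ) + 1) * (ε ^ 2 * ‖c l‖ ^ 2 +
      ‖∑ n ∈ Finset.range N, if l ≤ n then (c n * (s (n - l) : ℂ)) • v (n - l) else 0‖ ^ 2)

theorem isClosed_rangeIneq (η : ℕ → ℂ) (v : ℕ → lp (fun _ : ℕ => ℂ) 2) (B : ℝ) (c h : ℕ → ℂ)
    (N : ℕ) : IsClosed {x : (ℕ → ℝ) × ℝ | RangeIneq η v B c h N x.1 x.2} := by
  unfold RangeIneq cauchyCube
  refine isClosed_le (by fun_prop) ?_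
  refine continuous_const.mul (continuous_finsetSum _ fun l _ => continuous_const.mul
    (Continuous.add (by fun_prop) (Continuous.pow (Continuous.norm
      (continuous_finsetSum _ fun n _ => ?_)) 2)))
  split_ifs
  · fun_prop
  · exact continuous_const

theorem rangeIneq_autoCorr (hva : ∀ l j, v l j = star (a j l))
    (hcol : ∀ J : ℕ, ColBound (fun j : Fin J => a j) 1)
    (hη : ColBound (fun _ : Unit => η) (M ^ 2)) {r ε : ℝ} (hr : 0 < r) (hε : 0 < ε)
    (hε1 : ε ^ 2 ≤ 1 / 2) {K J : ℕ} (hK : 0 < K)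
    (hJ : ∀ z : ℂ, ‖z‖ ≤ 1 → ‖(smoothed r K η).eval z‖ ^ 2 ≤
      ε ^ 2 + ∑ j : Fin J, ‖(smoothed r K (a j)).eval z‖ ^ 2)
    (c : ℕ → ℂ) (h : Polynomial ℂ) (N : ℕ) :
    RangeIneq η v ((144 * M ^ 2 + 73104) * polyNormSq h) c h.coeff N (autoCorr r K) ε := by
  obtain ⟨f, hf⟩ : ∃ f : Option (Fin J) → Polynomial ℂ, f = fun o =>
    o.elim (Polynomial.C (ε : ℂ)) fun j => smoothed r K (a j) := ⟨_, rfl⟩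
  have hfn : f none = Polynomial.C (ε : ℂ) := by rw [hf]; rfl
  have hfs : ∀ j : Fin J, f (some j) = smoothed r K (a j) := fun j => by rw [hf]; rfl
  have hc : ∀ b : ℕ → ℂ, (smoothed r K b).coeff = fun l => (autoCorr r K l : ℂ) * b l :=
    fun b => funext fun l => coeff_smoothed r K b l
  have h1 : ∀ p : Polynomial ℂ, ∑ j, polyNormSq (f j * p) ≤ (1 + ε ^ 2) * polyNormSq p :=
    fun p => by
    rw [Fintype.sum_option, hfn, polyNormSq_C_mul, norm_real, Real.norm_eq_abs, sq_abs]
    simp only [hfs]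
    have h2 : ColBound (fun j : Fin J => (smoothed r K (a j)).coeff) 1 := by
      simp only [hc]
      exact (hcol J).schur zero_le_one (autoCorr_kernel hr hK)
    linarith [h2.polyNormSq_le p]
  have h2 : ∀ p : Polynomial ℂ, polyNormSq (smoothed r K η * p) ≤ M ^ 2 * polyNormSq p :=
    fun p => by
    have h3 : ColBound (fun _ : Unit => (smoothed r K η).coeff) (M ^ 2) := by
      simp only [hc]
      exact hη.schur (sq_nonneg M) (autoCorr_kernel hr hK)
    simpa using ColBound.polyNormSq_le (f := fun _ : Unit => smoothed r K η) h3 p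
  obtain ⟨u, hu1, hu2⟩ := exists_bezout_of_polynomial (f := f) (smoothed r K η) h
    (A := 1 + ε ^ 2) (M := M) (by positivity) (by linarith) h1 h2 (fun z => by
      rw [Fintype.sum_option, hfn]
      have : 0 ≤ ∑ j : Fin J, ‖(f (some j)).eval z‖ ^ 2 :=
        Finset.sum_nonneg fun _ _ => by positivity
      have h3 : 0 < ‖(Polynomial.C (ε : ℂ)).eval z‖ ^ 2 := by
        rw [Polynomial.eval_C, norm_real]
        have := norm_pos_iff.2 hε.ne'
        positivity
      linarith) (fun z hz => by
      rw [Fintype.sum_option, hfn, Polynomial.eval_C, norm_real, Real.norm_eq_abs, sq_abs]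
      simp only [hfs]
      exact hJ z hz)
  have h3 := norm_sum_conv_sq_le (fun i => (f i).coeff) u _ (fun n => star (c n)) N (hu1 N) hu2
  unfold RangeIneq
  simp only [coeff_cube_mul, hc] at h3
  refine h3.trans (mul_le_mul_of_nonneg_left (Finset.sum_le_sum fun l hl =>
    mul_le_mul_of_nonneg_left ?_ (by positivity))
      (mul_nonneg (by positivity) (polyNormSq_nonneg h)))
  rw [Fintype.sum_option, hfn]
  refine add_le_add (le_of_eq ?_) ?_
  · have h4 : ∀ n, (if l ≤ n then star (c n) * (Polynomial.C (ε : ℂ)).coeff (n - l) else 0) =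
        if n = l then star (c l) * ε else 0 := fun n => by
      rcases lt_trichotomy n l with h5 | rfl | h5
      · rw [if_neg (by omega), if_neg (by omega)]
      · simp
      · rw [if_pos h5.le, if_neg (by omega), Polynomial.coeff_C_of_ne_zero (by omega), mul_zero]
    simp only [h4]
    rw [Finset.sum_ite_eq', if_pos hl, norm_mul, norm_star, norm_real, Real.norm_eq_abs, mul_pow,
      sq_abs, mul_comm]
  · refine le_of_eq_of_le (Finset.sum_congr rfl fun j _ => ?_) (lp.sum_norm_sq_le _ J)
    rw [← norm_star, hfs, hc]
    congr 2
    simp only [lp.coeFn_sum, Finset.sum_apply, star_sum]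
    refine Finset.sum_congr rfl fun n _ => ?_
    split_ifs
    · simp [hva, mul_assoc]
    · simp

theorem RangeIneq.of_tendsto {α : Type*} {f : Filter α} [f.NeBot] {B : ℝ} {c h : ℕ → ℂ} {N : ℕ}
    {s : α → ℕ → ℝ} {e : α → ℝ} {s' : ℕ → ℝ} {e' : ℝ}
    (hs : ∀ l, Filter.Tendsto (fun x => s x l) f (nhds (s' l))) (he : Filter.Tendsto e f (nhds e'))
    (H : ∀ᶠ x in f, RangeIneq η v B c h N (s x) (e x)) : RangeIneq η v B c h N s' e' := by
  have h1 : Filter.Tendsto (fun x => (s x, e x)) f (nhds (s', e')) :=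
    (tendsto_pi_nhds.2 hs).prodMk_nhds he
  have h2 := isClosed_rangeIneq η v B c h N
  generalize hS : {x : (ℕ → ℝ) × ℝ | RangeIneq η v B c h N x.1 x.2} = S at h2
  have h3 : ∀ x : (ℕ → ℝ) × ℝ, x ∈ S ↔ RangeIneq η v B c h N x.1 x.2 := fun x => by
    rw [← hS, Set.mem_ofPred_eq]
  exact (h3 (s', e')).1 (h2.mem_of_tendsto h1 (H.mono fun x hx => (h3 _).2 hx))

theorem rangeIneq_one (hva : ∀ l j, v l j = star (a j l)) (hv : ∀ l, ‖v l‖ ≤ 1)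
    (hcol : ∀ J : ℕ, ColBound (fun j : Fin J => a j) 1)
    (hη : ColBound (fun _ : Unit => η) (M ^ 2))
    (hpt : ∀ z : ℂ, ‖z‖ < 1 → ‖∑' l, z ^ l • η l‖ ≤ ‖∑' l, star z ^ l • v l‖)
    (c : ℕ → ℂ) (h : Polynomial ℂ) (N : ℕ) :
    RangeIneq η v ((144 * M ^ 2 + 73104) * polyNormSq h) c h.coeff N (fun _ => 1) 0 := by
  have h1 : ∀ r ε : ℝ, 0 < r → r < 1 → 0 < ε → ε ^ 2 ≤ 1 / 2 →
      RangeIneq η v ((144 * M ^ 2 + 73104) * polyNormSq h) c h.coeff N (fun l => r ^ l) ε :=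
    fun r ε hr hr1 hε hε1 => by
    refine RangeIneq.of_tendsto (f := Filter.atTop) (s := autoCorr r) (e := fun _ => ε)
      (tendsto_autoCorr hr hr1) tendsto_const_nhds ?_
    have hηb : ∀ l, ‖η l‖ ≤ |M| := fun l => by
      have := hη.norm_le l
      simp only [Finset.univ_unique, Finset.sum_singleton] at this
      exact abs_norm (η l) ▸ sq_le_sq.1 this
    filter_upwards [eventually_normSq_smoothed_le hva hv hηb hpt hr hr1 (pow_pos hε 2),
      Filter.eventually_gt_atTop 0] with K hK hK0
    obtain ⟨J, hJ⟩ := hK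
    exact rangeIneq_autoCorr hva hcol hη hr hε hε1 hK0 hJ c h N
  have h2 := tendsto_one_div_add_atTop_nhds_zero_nat (𝕜 := ℝ)
  refine RangeIneq.of_tendsto (f := Filter.atTop)
    (s := fun (k l : ℕ) => (1 - 1 / ((k : ℝ) + 1)) ^ l) (fun l => ?_) h2 ?_
  · simpa using (h2.const_sub 1).pow l
  filter_upwards [Filter.eventually_ge_atTop 1] with k hk
  have hk' : (1 : ℝ) ≤ k := by exact_mod_cast hk
  have h3 : 1 / ((k : ℝ) + 1) ≤ 1 / 2 := one_div_le_one_div_of_le two_pos (by linarith)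
  have h4 : 0 < 1 / ((k : ℝ) + 1) := by positivity
  exact h1 _ _ (by linarith) (by linarith) h4 (by nlinarith)

theorem range_inclusion (hva : ∀ l j, v l j = star (a j l)) (hv : ∀ l, ‖v l‖ ≤ 1)
    (hcol : ∀ J : ℕ, ColBound (fun j : Fin J => a j) 1)
    (hη : ColBound (fun _ : Unit => η) (M ^ 2))
    (hpt : ∀ z : ℂ, ‖z‖ < 1 → ‖∑' l, z ^ l • η l‖ ≤ ‖∑' l, star z ^ l • v l‖)
    (N : ℕ) (c : ℕ → ℂ) :
    ∑ l ∈ Finset.range N, 1 / ((l : ℝ) + 1) * ‖∑ n ∈ Finset.range N,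
        c n • (if l ≤ n then star (cauchyCube η (n - l)) else 0)‖ ^ 2 ≤
      (144 * M ^ 2 + 73104) * ∑ l ∈ Finset.range N, 1 / ((l : ℝ) + 1) *
        ‖∑ n ∈ Finset.range N, c n • (if l ≤ n then v (n - l) else 0)‖ ^ 2 := by
  obtain ⟨d, hd⟩ : ∃ d : ℕ → ℂ, ∀ l, ∑ n ∈ Finset.range N,
    c n • (if l ≤ n then star (cauchyCube η (n - l)) else 0) = d l := ⟨_, fun _ => rfl⟩
  simp only [hd]
  obtain ⟨h, hh⟩ : ∃ h : Polynomial ℂ, h = ∑ l ∈ Finset.range N,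
    Polynomial.monomial l (d l / ((l : ℂ) + 1)) := ⟨_, rfl⟩
  have hcoeff : ∀ l, h.coeff l = if l < N then d l / ((l : ℂ) + 1) else 0 := fun l => by
    simp only [hh, Polynomial.finsetSum_coeff, Polynomial.coeff_monomial, Finset.sum_ite_eq',
      Finset.mem_range]
  have hl1 : ∀ l : ℕ, ((l : ℂ) + 1) ≠ 0 := fun l => Nat.cast_add_one_ne_zero l
  have hl2 : ∀ l : ℕ, ‖(l : ℂ) + 1‖ = (l : ℝ) + 1 := fun l => by
    rw [← Nat.cast_add_one, norm_natCast]
    push_cast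
    ring
  have h1 : polyNormSq h = ∑ l ∈ Finset.range N, 1 / ((l : ℝ) + 1) * ‖d l‖ ^ 2 := by
    rw [polyNormSq_eq (N := N + h.natDegree + 1) (by omega), add_assoc,
      Finset.sum_range_add, add_eq_left.2]
    · refine Finset.sum_congr rfl fun l hl => ?_
      rw [hcoeff, if_pos (Finset.mem_range.1 hl), norm_div, hl2]
      have : (l : ℝ) + 1 ≠ 0 := by positivity
      field_simp
    · exact Finset.sum_eq_zero fun l _ => by rw [hcoeff, if_neg (by omega)]; simp
  have h2 := rangeIneq_one hva hv hcol hη hpt c h N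
  have h3 : ∑ n ∈ Finset.range N, star (c n) * ∑ p ∈ antidiagonal n,
      cauchyCube η p.1 * h.coeff p.2 = ((polyNormSq h : ℝ) : ℂ) := by
    have h4 : ∑ n ∈ Finset.range N, star (c n) * ∑ p ∈ antidiagonal n,
      cauchyCube η p.1 * h.coeff p.2 = ∑ l ∈ Finset.range N, h.coeff l * star (d l) := by
      simp only [← hd, star_sum, Finset.mul_sum (Finset.range N)]
      rw [Finset.sum_comm]
      refine Finset.sum_congr rfl fun n hn => ?_
      rw [sum_antidiagonal_eq_sum_range_ite (fun k l => cauchyCube η k * h.coeff l)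
        (Finset.mem_range.1 hn), Finset.mul_sum]
      refine Finset.sum_congr rfl fun l _ => ?_
      split_ifs
      · simp
        ring
      · simp
    rw [h4, h1]
    push_cast
    refine Finset.sum_congr rfl fun l hl => ?_
    rw [hcoeff, if_pos (Finset.mem_range.1 hl), ← mul_conj']
    change d l / ((l : ℂ) + 1) * (starRingEnd ℂ) (d l) = _
    ring
  unfold RangeIneq at h2
  simp only [ofReal_one, one_mul, mul_one, ne_eq, OfNat.ofNat_ne_zero, not_false_eq_true,
    zero_pow, zero_mul, zero_add, h3] at h2
  rw [norm_real, Real.norm_of_nonneg (polyNormSq_nonneg h)] at h2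
  rw [← h1]
  simp only [smul_ite, smul_zero]
  rcases (polyNormSq_nonneg h).eq_or_lt with h4 | h4
  · rw [← h4]
    exact mul_nonneg (by positivity) (Finset.sum_nonneg fun _ _ => by positivity)
  · refine le_of_mul_le_mul_left ?_ h4
    refine le_of_eq_of_le (by ring) (h2.trans (le_of_eq (by ring)))

end Approximation

section PowerSeries

variable {f g : ℂ → ℂ} {b c : ℕ → ℂ}

theorem hasSum_dirCoeff (hf : DifferentiableOn ℂ f (ball (0 : ℂ) 1)) {z : ℂ}
    (hz : z ∈ ball (0 : ℂ) 1) : HasSum (fun n => dirCoeff f n * z ^ n) (f z) := by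
  have h := Complex.hasSum_taylorSeries_on_ball hf hz
  refine h.congr_fun fun n => ?_
  rw [dirCoeff, sub_zero, smul_eq_mul, smul_eq_mul]
  ring

theorem hasFPowerSeriesOnBall_of_hasSum
    (h : ∀ z ∈ ball (0 : ℂ) 1, HasSum (fun n => b n * z ^ n) (f z)) :
    HasFPowerSeriesOnBall f (FormalMultilinearSeries.ofScalars ℂ b) 0 1 where
  r_le := by
    refine ENNReal.le_of_forall_nnreal_lt fun ρ hρ => ?_
    have hρ' : ((ρ : ℝ) : ℂ) ∈ ball (0 : ℂ) 1 := by
      rw [mem_ball_zero_iff, norm_real, NNReal.norm_eq]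
      exact_mod_cast hρ
    obtain ⟨C, hC⟩ := ((h _ hρ').summable.tendsto_atTop_zero.norm).bddAbove_range
    refine FormalMultilinearSeries.le_radius_of_bound _ C fun n => ?_
    have := hC ⟨n, rfl⟩
    simpa using this
  r_pos := one_pos
  hasSum {y} hy := by
    rw [zero_add]
    have hy' : y ∈ ball (0 : ℂ) 1 := by
      rw [← Metric.eball_ofReal]
      simpa using hy
    refine (h y hy').congr_fun fun n => ?_
    rw [FormalMultilinearSeries.ofScalars_apply_eq, smul_eq_mul]

theorem differentiableOn_of_hasSum (h : ∀ z ∈ ball (0 : ℂ) 1, HasSum (fun n => b n * z ^ n) (f z)) :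
    DifferentiableOn ℂ f (ball (0 : ℂ) 1) := by
  have := (hasFPowerSeriesOnBall_of_hasSum h).differentiableOn
  rwa [← ENNReal.ofReal_one, Metric.eball_ofReal] at this

theorem dirCoeff_eq_of_hasSum (h : ∀ z ∈ ball (0 : ℂ) 1, HasSum (fun n => b n * z ^ n) (f z)) :
    dirCoeff f = b := by
  have h1 := (hasFPowerSeriesOnBall_of_hasSum h).hasFPowerSeriesAt
  exact (FormalMultilinearSeries.ofScalars_series_eq_iff ℂ _ _).1
    (h1.analyticAt.hasFPowerSeriesAt.eq_formalMultilinearSeries h1)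

theorem dirCoeff_mul (hf : DifferentiableOn ℂ f (ball (0 : ℂ) 1))
    (hg : DifferentiableOn ℂ g (ball (0 : ℂ) 1)) (n : ℕ) : dirCoeff (fun z => f z * g z) n =
      ∑ p ∈ antidiagonal n, dirCoeff f p.1 * dirCoeff g p.2 := by
  refine congrFun (dirCoeff_eq_of_hasSum
    (b := fun n => ∑ p ∈ antidiagonal n, dirCoeff f p.1 * dirCoeff g p.2) fun z hz => ?_) n
  have h1 := hasSum_dirCoeff hf hz
  have h2 := hasSum_dirCoeff hg hz
  have h3 := h1.summable.norm
  have h4 := h2.summable.norm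
  have h5 := (summable_norm_sum_mul_antidiagonal_of_summable_norm h3 h4).of_norm.hasSum
  rw [← tsum_mul_tsum_eq_tsum_sum_antidiagonal_of_summable_norm h3 h4, h1.tsum_eq,
    h2.tsum_eq] at h5
  refine h5.congr_fun fun n => ?_
  rw [Finset.sum_mul]
  refine Finset.sum_congr rfl fun p hp => ?_
  rw [← mem_antidiagonal.1 hp, pow_add]
  ring

/-- The sum of the power series with coefficients `b`. -/
noncomputable def powerSum (b : ℕ → ℂ) (z : ℂ) : ℂ := ∑' n, b n * z ^ n

theorem hasSum_powerSum {B : ℝ} (hb : ∀ n, ‖b n‖ ≤ B) {z : ℂ} (hz : z ∈ ball (0 : ℂ) 1) :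
    HasSum (fun n => b n * z ^ n) (powerSum b z) := by
  refine Summable.hasSum (Summable.of_norm_bounded
    ((summable_geometric_of_lt_one (norm_nonneg z) (mem_ball_zero_iff.1 hz)).mul_left B)
      fun n => ?_)
  rw [norm_mul, norm_pow]
  exact mul_le_mul_of_nonneg_right (hb n) (by positivity)

theorem dirCoeff_powerSum {B : ℝ} (hb : ∀ n, ‖b n‖ ≤ B) : dirCoeff (powerSum b) = b :=
  dirCoeff_eq_of_hasSum fun _ => hasSum_powerSum hb

theorem differentiableOn_powerSum {B : ℝ} (hb : ∀ n, ‖b n‖ ≤ B) :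
    DifferentiableOn ℂ (powerSum b) (ball (0 : ℂ) 1) :=
  differentiableOn_of_hasSum fun _ => hasSum_powerSum hb

theorem norm_le_of_summable (hb : Summable fun n : ℕ => ((n : ℝ) + 1) * ‖b n‖ ^ 2) (n : ℕ) :
    ‖b n‖ ≤ √(∑' n : ℕ, ((n : ℝ) + 1) * ‖b n‖ ^ 2) := by
  refine Real.le_sqrt_of_sq_le (le_trans ?_ (hb.le_tsum n fun m _ => by positivity))
  exact le_mul_of_one_le_left (by positivity) (by simp)

theorem memDirichlet_powerSum (hb : Summable fun n : ℕ => ((n : ℝ) + 1) * ‖b n‖ ^ 2) :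
    MemDirichlet (powerSum b) := by
  refine ⟨differentiableOn_powerSum (norm_le_of_summable hb), ?_⟩
  rwa [dirCoeff_powerSum (norm_le_of_summable hb)]

theorem dirNormSq_powerSum (hb : Summable fun n : ℕ => ((n : ℝ) + 1) * ‖b n‖ ^ 2) :
    dirNormSq (powerSum b) = ∑' n : ℕ, ((n : ℝ) + 1) * ‖b n‖ ^ 2 := by
  rw [dirNormSq, dirCoeff_powerSum (norm_le_of_summable hb)]

theorem sum_le_dirNormSq (hf : MemDirichlet f) (N : ℕ) :
    ∑ n ∈ Finset.range N, ((n : ℝ) + 1) * ‖dirCoeff f n‖ ^ 2 ≤ dirNormSq f :=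
  hf.2.sum_le_tsum _ fun n _ => by positivity

end PowerSeries

section Multiplier

variable {F G : ℕ → ℂ → ℂ} {H : ℂ → ℂ}

theorem exists_memDirichlet_truncation (h : ℕ → ℂ) (N : ℕ) : ∃ f, MemDirichlet f ∧
    (∀ n < N, dirCoeff f n = h n) ∧
      dirNormSq f = ∑ n ∈ Finset.range N, ((n : ℝ) + 1) * ‖h n‖ ^ 2 := by
  obtain ⟨b, hb⟩ : ∃ b : ℕ → ℂ, ∀ n, b n = if n < N then h n else 0 := ⟨_, fun _ => rfl⟩
  have h1 : ∀ n ∉ Finset.range N, ((n : ℝ) + 1) * ‖b n‖ ^ 2 = 0 := fun n hn => by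
    rw [hb, if_neg (by simpa using hn)]
    simp
  have h2 : Summable fun n : ℕ => ((n : ℝ) + 1) * ‖b n‖ ^ 2 := summable_of_ne_finset_zero h1
  refine ⟨powerSum b, memDirichlet_powerSum h2, fun n hn => ?_, ?_⟩
  · rw [dirCoeff_powerSum (norm_le_of_summable h2), hb, if_pos hn]
  · rw [dirNormSq_powerSum h2, tsum_eq_sum h1]
    exact Finset.sum_congr rfl fun n hn => by rw [hb, if_pos (Finset.mem_range.1 hn)]

theorem sum_dirCoeff_mul_le (hH : IsMultiplier H) {f : ℂ → ℂ} (hf : MemDirichlet f) {h : ℕ → ℂ}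
    {N : ℕ} (hfh : ∀ n < N, dirCoeff f n = h n) :
    ∑ n ∈ Finset.range N, ((n : ℝ) + 1) * ‖∑ p ∈ antidiagonal n, dirCoeff H p.1 * h p.2‖ ^ 2 ≤
      dirNormSq (fun z => H z * f z) := by
  refine le_of_eq_of_le (Finset.sum_congr rfl fun n hn => ?_) (sum_le_dirNormSq (hH.2 f hf) N)
  rw [dirCoeff_mul hH.1 hf.1]
  congr 3
  refine Finset.sum_congr rfl fun p hp => ?_
  have := mem_antidiagonal.1 hp
  have := Finset.mem_range.1 hn
  rw [hfh _ (by omega)]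

theorem ColNormLE.colBound (hF : ∀ j, IsMultiplier (F j)) {C : ℝ} (ha : ColNormLE F C) (J : ℕ) :
    ColBound (fun j : Fin J => dirCoeff (F j)) (C ^ 2) := by
  intro N h
  obtain ⟨f, hf, hfh, hfn⟩ := exists_memDirichlet_truncation h N
  obtain ⟨h1, h2⟩ := ha f hf
  rw [← hfn]
  refine (Finset.sum_le_sum fun (j : Fin J) _ => sum_dirCoeff_mul_le (hF j) hf hfh).trans
    (le_trans ?_ h2)
  rw [Fin.sum_univ_eq_sum_range (fun j => dirNormSq fun z => F j z * f z)]
  exact h1.sum_le_tsum _ fun j _ => tsum_nonneg fun n => by positivity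

/-- The Dirichlet function whose orthonormal coordinates are `x`. -/
noncomputable def ofCoord (x : lp (fun _ : ℕ => ℂ) 2) : ℂ → ℂ :=
  powerSum fun n => x n / (√((n : ℝ) + 1) : ℝ)

theorem coord_normSq (n : ℕ) (w : ℂ) :
    ((n : ℝ) + 1) * ‖w / (√((n : ℝ) + 1) : ℝ)‖ ^ 2 = ‖w‖ ^ 2 := by
  have h1 : (0 : ℝ) < (n : ℝ) + 1 := by positivity
  rw [norm_div, norm_real, Real.norm_of_nonneg (Real.sqrt_nonneg _), div_pow, Real.sq_sqrt h1.le]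
  field_simp

theorem coord_normSq' (n : ℕ) (w : ℂ) :
    ‖(√((n : ℝ) + 1) : ℝ) * w‖ ^ 2 = ((n : ℝ) + 1) * ‖w‖ ^ 2 := by
  rw [norm_mul, norm_real, Real.norm_of_nonneg (Real.sqrt_nonneg _), mul_pow,
    Real.sq_sqrt (by positivity)]

theorem summable_ofCoord (x : lp (fun _ : ℕ => ℂ) 2) :
    Summable fun n : ℕ => ((n : ℝ) + 1) * ‖x n / (√((n : ℝ) + 1) : ℝ)‖ ^ 2 := by
  simp only [coord_normSq]
  exact (lp.hasSum_norm_sq x).summable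

theorem memDirichlet_ofCoord (x : lp (fun _ : ℕ => ℂ) 2) : MemDirichlet (ofCoord x) :=
  memDirichlet_powerSum (summable_ofCoord x)

theorem dirCoeff_ofCoord (x : lp (fun _ : ℕ => ℂ) 2) :
    dirCoeff (ofCoord x) = fun n => x n / (√((n : ℝ) + 1) : ℝ) :=
  dirCoeff_powerSum (norm_le_of_summable (summable_ofCoord x))

theorem exists_ofCoord {f : ℂ → ℂ} (hf : MemDirichlet f) :
    ∃ x : lp (fun _ : ℕ => ℂ) 2, (∀ n, x n = (√((n : ℝ) + 1) : ℝ) * dirCoeff f n) ∧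
      ‖x‖ ^ 2 = dirNormSq f := by
  have h1 : Memℓp (fun n : ℕ => (√((n : ℝ) + 1) : ℝ) * dirCoeff f n) 2 := by
    refine memℓp_gen ?_
    simp only [ENNReal.toReal_ofNat, Real.rpow_ofNat, coord_normSq']
    exact hf.2
  refine ⟨⟨_, h1⟩, fun n => rfl, ?_⟩
  rw [← (lp.hasSum_norm_sq _).tsum_eq]
  exact tsum_congr fun n => coord_normSq' n _

theorem IsMultiplier.exists_bound (hH : IsMultiplier H) : ∃ C : ℝ, 0 ≤ C ∧ ∀ f, MemDirichlet f →
    dirNormSq (fun z => H z * f z) ≤ C ^ 2 * dirNormSq f := by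
  choose T hT1 hT2 using fun x => exists_ofCoord (hH.2 _ (memDirichlet_ofCoord x))
  have hT3 : ∀ x n, T x n = (√((n : ℝ) + 1) : ℝ) * ∑ p ∈ antidiagonal n,
      dirCoeff H p.1 * (x p.2 / (√((p.2 : ℝ) + 1) : ℝ)) := fun x n => by
    rw [hT1, dirCoeff_mul hH.1 (memDirichlet_ofCoord x).1, dirCoeff_ofCoord]
  obtain ⟨L, hL⟩ : ∃ L : lp (fun _ : ℕ => ℂ) 2 →ₗ[ℂ] lp (fun _ : ℕ => ℂ) 2, ∀ x, L x = T x :=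
    ⟨{ toFun := T
       map_add' := fun x y => by
        ext n
        rw [lp.coeFn_add, Pi.add_apply, hT3, hT3, hT3, ← mul_add, ← Finset.sum_add_distrib]
        congr 1
        refine Finset.sum_congr rfl fun p _ => ?_
        rw [lp.coeFn_add, Pi.add_apply]
        ring
       map_smul' := fun c x => by
        ext n
        rw [RingHom.id_apply, lp.coeFn_smul, Pi.smul_apply, hT3, hT3, smul_eq_mul, mul_left_comm,
          Finset.mul_sum (a := c)]
        congr 1
        refine Finset.sum_congr rfl fun p _ => ?_
        rw [lp.coeFn_smul, Pi.smul_apply, smul_eq_mul]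
        ring }, fun x => rfl⟩
  have hcoord : ∀ n, Continuous fun x : lp (fun _ : ℕ => ℂ) 2 => x n := fun n =>
    (lp.evalCLM (𝕜 := ℂ) (E := fun _ : ℕ => ℂ) (p := 2) n).continuous
  obtain ⟨A, hA⟩ : ∃ A : lp (fun _ : ℕ => ℂ) 2 →L[ℂ] lp (fun _ : ℕ => ℂ) 2, ∀ x, A x = T x := by
    refine ⟨ContinuousLinearMap.ofSeqClosedGraph (g := L) fun u x y hu hy => ?_, hL⟩
    ext n
    have h1 : Filter.Tendsto (fun k => T (u k) n) Filter.atTop (nhds (y n)) := by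
      refine (((hcoord n).tendsto y).comp hy).congr fun k => ?_
      simp only [Function.comp_apply, hL]
    have h2 : Filter.Tendsto (fun k => T (u k) n) Filter.atTop (nhds (T x n)) := by
      simp only [hT3]
      refine (tendsto_finsetSum _ fun p _ => ?_).const_mul _
      exact ((((hcoord p.2).tendsto x).comp hu).div_const _).const_mul _
    rw [hL]
    exact tendsto_nhds_unique h1 h2
  refine ⟨‖A‖, norm_nonneg _, fun f hf => ?_⟩
  obtain ⟨x, hx1, hx2⟩ := exists_ofCoord hf
  have h1 : dirCoeff (ofCoord x) = dirCoeff f := by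
    rw [dirCoeff_ofCoord]
    funext n
    rw [hx1, mul_div_cancel_left₀]
    exact ofReal_ne_zero.2 (by positivity)
  have h2 : dirNormSq (fun z => H z * ofCoord x z) = dirNormSq fun z => H z * f z := by
    simp only [dirNormSq, dirCoeff_mul hH.1 hf.1, dirCoeff_mul hH.1 (memDirichlet_ofCoord x).1, h1]
  rw [← h2, ← hT2, ← hx2, ← hA, ← mul_pow]
  exact pow_le_pow_left₀ (norm_nonneg _) (A.le_opNorm x) 2

theorem IsMultiplier.dirNormSq_mul_le (hH : IsMultiplier H) {f : ℂ → ℂ} (hf : MemDirichlet f) :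
    dirNormSq (fun z => H z * f z) ≤ multNorm H ^ 2 * dirNormSq f := by
  have h1 : IsClosed {C : ℝ | 0 ≤ C ∧ ∀ f, MemDirichlet f →
      dirNormSq (fun z => H z * f z) ≤ C ^ 2 * dirNormSq f} := by
    simp only [Set.ofPred_and, Set.ofPred_forall]
    exact isClosed_Ici.inter (isClosed_iInter fun f => isClosed_iInter fun _ =>
      isClosed_le continuous_const (by fun_prop))
  exact (h1.csInf_mem hH.exists_bound ⟨0, fun C hC => hC.1⟩).2 f hf

theorem IsMultiplier.colBound (hH : IsMultiplier H) :
    ColBound (fun _ : Unit => dirCoeff H) (multNorm H ^ 2) := by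
  intro N h
  obtain ⟨f, hf, hfh, hfn⟩ := exists_memDirichlet_truncation h N
  rw [← hfn]
  simpa using (sum_dirCoeff_mul_le hH hf hfh).trans (hH.dirNormSq_mul_le hf)

theorem colNormLE_of_colBound (hG : ∀ j, DifferentiableOn ℂ (G j) (ball (0 : ℂ) 1)) {C : ℝ}
    (hC : ∀ J : ℕ, ColBound (fun j : Fin J => dirCoeff (G j)) (C ^ 2)) :
    (∀ j, IsMultiplier (G j)) ∧ ColNormLE G C := by
  have h1 : ∀ h, MemDirichlet h → ∀ J N : ℕ, ∑ j ∈ Finset.range J, ∑ n ∈ Finset.range N,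
      ((n : ℝ) + 1) * ‖dirCoeff (fun z => G j z * h z) n‖ ^ 2 ≤ C ^ 2 * dirNormSq h :=
    fun h hh J N => by
    rw [← Fin.sum_univ_eq_sum_range (fun j => ∑ n ∈ Finset.range N,
      ((n : ℝ) + 1) * ‖dirCoeff (fun z => G j z * h z) n‖ ^ 2)]
    simp only [dirCoeff_mul (hG _) hh.1]
    exact (hC J N (dirCoeff h)).trans (mul_le_mul_of_nonneg_left (sum_le_dirNormSq hh N)
      (sq_nonneg C))
  have h2 : ∀ j, IsMultiplier (G j) := fun j => by
    refine ⟨hG j, fun h hh => ⟨(hG j).mul hh.1, ?_⟩⟩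
    refine summable_of_sum_range_le (fun n => by positivity) fun N =>
      le_trans ?_ (h1 h hh (j + 1) N)
    exact Finset.single_le_sum (f := fun j => ∑ n ∈ Finset.range N,
      ((n : ℝ) + 1) * ‖dirCoeff (fun z => G j z * h z) n‖ ^ 2)
      (fun i _ => Finset.sum_nonneg fun n _ => by positivity) (Finset.self_mem_range_succ j)
  refine ⟨h2, fun h hh => ?_⟩
  have h3 : ∀ J, ∑ j ∈ Finset.range J, dirNormSq (fun z => G j z * h z) ≤ C ^ 2 * dirNormSq h :=
    fun J => by
    refine le_of_tendsto' (x := Filter.atTop) (tendsto_finsetSum _ fun j _ => ?_) (h1 h hh J)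
    exact ((h2 j).2 h hh).2.hasSum.tendsto_sum_nat
  have h4 : ∀ j, 0 ≤ dirNormSq (fun z => G j z * h z) := fun j =>
    tsum_nonneg fun n => by positivity
  exact ⟨summable_of_sum_range_le h4 h3, Real.tsum_le_of_sum_range_le h4 h3⟩

end Multiplier

theorem summable_pow_smul {E : Type*} [NormedAddCommGroup E] [NormedSpace ℂ E] [CompleteSpace E]
    {v : ℕ → E} (hv : ∀ l, ‖v l‖ ≤ 1) {z : ℂ} (hz : ‖z‖ < 1) : Summable fun l => z ^ l • v l := by
  refine Summable.of_norm_bounded (summable_geometric_of_lt_one (norm_nonneg z) hz) fun l => ?_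
  rw [norm_smul, norm_pow]
  exact mul_le_of_le_one_right (by positivity) (hv l)

theorem lp.hasSum_apply {f : ℕ → lp (fun _ : ℕ => ℂ) 2} (hf : Summable f) (j : ℕ) :
    HasSum (fun l => f l j) ((∑' l, f l) j) :=
  (lp.evalCLM (𝕜 := ℂ) (E := fun _ : ℕ => ℂ) (p := 2) j).hasSum hf.hasSum

theorem inner_tsum_pow_smul {E : Type*} [NormedAddCommGroup E] [InnerProductSpace ℂ E]
    [CompleteSpace E] {v w : ℕ → E} (hv : ∀ l, ‖v l‖ ≤ 1) (hw : ∀ l, ‖w l‖ ≤ 1) {z : ℂ}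
    (hz : ‖z‖ < 1) : inner ℂ (∑' l, star z ^ l • v l) (∑' l, z ^ l • w l) =
      ∑' n, ∑ p ∈ antidiagonal n, z ^ n * inner ℂ (v p.1) (w p.2) := by
  have hz' : ‖star z‖ < 1 := by rwa [norm_star]
  have h1 := summable_pow_smul hv hz'
  have h2 := summable_pow_smul hw hz
  have h3 : Summable fun x : ℕ × ℕ => z ^ (x.1 + x.2) * inner ℂ (v x.1) (w x.2) := by
    have hg := summable_geometric_of_lt_one (norm_nonneg z) hz
    refine Summable.of_norm_bounded (hg.mul_of_nonneg hg (fun _ => by positivity)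
      fun _ => by positivity) fun x => ?_
    rw [norm_mul, norm_pow, pow_add]
    exact mul_le_of_le_one_right (by positivity) ((norm_inner_le_norm _ _).trans
      (mul_le_one₀ (hv _) (norm_nonneg _) (hw _)))
  have h4 : inner ℂ (∑' l, star z ^ l • v l) (∑' l, z ^ l • w l) =
      ∑' x : ℕ × ℕ, z ^ (x.1 + x.2) * inner ℂ (v x.1) (w x.2) := by
    rw [h3.tsum_prod, ← inner_conj_symm, ← innerSL_apply_apply ℂ, ContinuousLinearMap.map_tsum _ h1,
      conj_tsum]
    refine tsum_congr fun l => ?_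
    rw [innerSL_apply_apply, inner_conj_symm, ← innerSL_apply_apply ℂ,
      ContinuousLinearMap.map_tsum _ h2]
    refine tsum_congr fun m => ?_
    rw [innerSL_apply_apply, inner_smul_left, inner_smul_right]
    simp
    ring
  rw [h4, ← Finset.HasAntidiagonal.sigmaAntidiagonalEquivProd.tsum_eq]
  have h5 : Summable fun x : (Σ n : ℕ, antidiagonal n) =>
      z ^ ((Finset.HasAntidiagonal.sigmaAntidiagonalEquivProd x).1 +
        (Finset.HasAntidiagonal.sigmaAntidiagonalEquivProd x).2) *
        inner ℂ (v (Finset.HasAntidiagonal.sigmaAntidiagonalEquivProd x).1)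
          (w (Finset.HasAntidiagonal.sigmaAntidiagonalEquivProd x).2) :=
    (Finset.HasAntidiagonal.sigmaAntidiagonalEquivProd (A := ℕ)).summable_iff.2 h3
  rw [h5.tsum_sigma' fun n => (hasSum_fintype _).summable]
  refine tsum_congr fun n => ?_
  rw [tsum_fintype, ← Finset.sum_coe_sort (antidiagonal n)
    fun p => z ^ n * inner ℂ (v p.1) (w p.2)]
  refine Finset.sum_congr rfl fun p _ => ?_
  have := mem_antidiagonal.1 p.2
  change z ^ (p.1.1 + p.1.2) * inner ℂ (v p.1.1) (w p.1.2) = _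
  rw [this]

theorem norm_le_one_of_conv_le {E : Type*} [NormedAddCommGroup E] [NormedSpace ℂ E] {w : ℕ → E}
    (hw : ∀ (h : ℕ → ℂ) (N : ℕ), ∑ n ∈ Finset.range N, ((n : ℝ) + 1) *
      ‖∑ p ∈ antidiagonal n, h p.1 • w p.2‖ ^ 2 ≤
        ∑ n ∈ Finset.range N, ((n : ℝ) + 1) * ‖h n‖ ^ 2) (n : ℕ) : ‖w n‖ ≤ 1 := by
  have h1 := hw (fun n => if n = 0 then 1 else 0) (n + 1)
  have h2 : ∑ p ∈ antidiagonal n, (if p.1 = 0 then (1 : ℂ) else 0) • w p.2 = w n := by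
    rw [← sum_range_eq_sum_antidiagonal (fun i j => (if i = 0 then (1 : ℂ) else 0) • w j),
      Finset.sum_range_succ', Finset.sum_eq_zero] <;> simp
  have h3 : ∑ n ∈ Finset.range (n + 1), ((n : ℝ) + 1) * ‖(if n = 0 then 1 else 0 : ℂ)‖ ^ 2 = 1 := by
    rw [Finset.sum_range_succ', Finset.sum_eq_zero] <;> simp
  rw [h3] at h1
  have h4 := (Finset.single_le_sum (f := fun n : ℕ => ((n : ℝ) + 1) *
    ‖∑ p ∈ antidiagonal n, (if p.1 = 0 then (1 : ℂ) else 0) • w p.2‖ ^ 2)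
    (fun n _ => by positivity) (Finset.self_mem_range_succ n)).trans h1
  simp only [h2] at h4
  nlinarith [norm_nonneg (w n), mul_nonneg (Nat.cast_nonneg (α := ℝ) n) (sq_nonneg ‖w n‖)]

/-- The coefficient columns of a bounded column are the entries of vectors in the unit ball. -/
theorem exists_coeff_vectors {a : ℕ → ℕ → ℂ} (hcol : ∀ J : ℕ, ColBound (fun j : Fin J => a j) 1) :
    ∃ v : ℕ → lp (fun _ : ℕ => ℂ) 2, (∀ l j, v l j = star (a j l)) ∧ ∀ l, ‖v l‖ ≤ 1 := by
  have h1 : ∀ l J, ∑ j ∈ Finset.range J, ‖star (a j l)‖ ^ 2 ≤ 1 := fun l J => by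
    rw [← Fin.sum_univ_eq_sum_range (fun j => ‖star (a j l)‖ ^ 2)]
    simpa using (hcol J).norm_le l
  have h2 : ∀ l, Memℓp (fun j => star (a j l)) 2 := fun l => by
    refine memℓp_gen ?_
    simp only [ENNReal.toReal_ofNat, Real.rpow_ofNat]
    exact summable_of_sum_range_le (fun j => by positivity) (h1 l)
  refine ⟨fun l => ⟨_, h2 l⟩, fun l j => rfl, fun l => ?_⟩
  refine abs_norm (_ : lp (fun _ : ℕ => ℂ) 2) ▸ (sq_le_one_iff_abs_le_one _).1 ?_
  rw [← (lp.hasSum_norm_sq _).tsum_eq]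
  exact Real.tsum_le_of_sum_range_le (fun j => by positivity) (h1 l)

theorem hasSum_cauchyCube {H : ℂ → ℂ} (hH : DifferentiableOn ℂ H (ball (0 : ℂ) 1)) {z : ℂ}
    (hz : z ∈ ball (0 : ℂ) 1) : HasSum (fun n => cauchyCube (dirCoeff H) n * z ^ n) (H z ^ 3) := by
  have h1 := hasSum_dirCoeff ((hH.mul hH).mul hH) hz
  have h2 : dirCoeff (fun z => H z * H z * H z) = cauchyCube (dirCoeff H) := by
    funext n
    have h3 : DifferentiableOn ℂ (fun z => H z * H z) (ball 0 1) := hH.mul hH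
    rw [dirCoeff_mul (f := fun z => H z * H z) h3 hH]
    simp only [dirCoeff_mul hH hH, cauchyCube]
  rw [show H z ^ 3 = H z * H z * H z by ring, ← h2]
  exact h1

theorem colBound_of_conv_le {w : ℕ → lp (fun _ : ℕ => ℂ) 2}
    (hw : ∀ (h : ℕ → ℂ) (N : ℕ), ∑ n ∈ Finset.range N, ((n : ℝ) + 1) *
      ‖∑ p ∈ antidiagonal n, h p.1 • w p.2‖ ^ 2 ≤
        ∑ n ∈ Finset.range N, ((n : ℝ) + 1) * ‖h n‖ ^ 2) (C : ℝ) (J : ℕ) :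
    ColBound (fun (j : Fin J) n => (C : ℂ) * w n j) (C ^ 2) := by
  intro N h
  have h1 : ∀ (j n : ℕ), ∑ p ∈ antidiagonal n, (C : ℂ) * w p.1 j * h p.2 =
      C * (∑ p ∈ antidiagonal n, h p.1 • w p.2) j := fun j n => by
    rw [sum_antidiagonal_comm (fun k l => (C : ℂ) * w k j * h l)]
    simp only [lp.coeFn_sum, Finset.sum_apply, lp.coeFn_smul, Pi.smul_apply, smul_eq_mul,
      Finset.mul_sum]
    exact Finset.sum_congr rfl fun p _ => by ring
  simp only [h1, norm_mul, norm_real, mul_pow, Real.norm_eq_abs, sq_abs]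
  refine le_trans ?_ (mul_le_mul_of_nonneg_left (hw h N) (sq_nonneg C))
  rw [Finset.sum_comm, Finset.mul_sum]
  refine Finset.sum_le_sum fun n _ => ?_
  rw [← Finset.mul_sum, ← Finset.mul_sum, mul_left_comm]
  exact mul_le_mul_of_nonneg_left (mul_le_mul_of_nonneg_left (lp.sum_norm_sq_le _ J)
    (by positivity)) (sq_nonneg C)

/-- Wolff's theorem for the multiplier algebra of the Dirichlet space
(infinitely many generators). -/
theorem wolff_dirichlet_infinitely_many
    (H : ℂ → ℂ) (F : ℕ → ℂ → ℂ)
    (hH : IsMultiplier H) (hF : ∀ j, IsMultiplier (F j))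
    (ha : ColNormLE F 1)
    (hb : ∀ z ∈ ball (0:ℂ) 1, ‖H z‖ ^ 2 ≤ ∑' j : ℕ, ‖F j z‖ ^ 2) :
    ∃ G : ℕ → ℂ → ℂ, (∀ j, IsMultiplier (G j)) ∧
      ColNormLE G (Real.sqrt (144 * multNorm H ^ 2 + 73104)) ∧
      ∀ z ∈ ball (0:ℂ) 1,
        (Summable fun j : ℕ => F j z * G j z) ∧
        (∑' j : ℕ, F j z * G j z) = (H z) ^ 3 := by
  obtain ⟨C, hC⟩ : ∃ C, C = √(144 * multNorm H ^ 2 + 73104) := ⟨_, rfl⟩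
  have hC2 : C ^ 2 = 144 * multNorm H ^ 2 + 73104 := by
    rw [hC, Real.sq_sqrt (by positivity)]
  have hC0 : 0 ≤ C := hC ▸ Real.sqrt_nonneg _
  have hcol : ∀ J : ℕ, ColBound (fun j : Fin J => dirCoeff (F j)) 1 := fun J => by
    simpa using ha.colBound hF J
  obtain ⟨v, hva, hv⟩ := exists_coeff_vectors (a := fun j => dirCoeff (F j)) hcol
  have hFz : ∀ z : ℂ, ‖z‖ < 1 → ∀ j, (∑' l, star z ^ l • v l) j = star (F j z) := fun z hz j => by
    refine (lp.hasSum_apply (summable_pow_smul hv (by rwa [norm_star])) j).unique ?_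
    refine ((hasSum_dirCoeff (hF j).1 (mem_ball_zero_iff.2 hz)).star).congr_fun fun l => ?_
    rw [lp.coeFn_smul, Pi.smul_apply, hva, smul_eq_mul, star_mul, star_pow]
  have hpt : ∀ z : ℂ, ‖z‖ < 1 → ‖∑' l, z ^ l • dirCoeff H l‖ ≤ ‖∑' l, star z ^ l • v l‖ :=
    fun z hz => by
    have hz' := mem_ball_zero_iff.2 hz
    refine (sq_le_sq₀ (norm_nonneg _) (norm_nonneg _)).1 ?_
    rw [← (lp.hasSum_norm_sq _).tsum_eq]
    simp only [hFz z hz, norm_star]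
    have h : ∑' l, z ^ l • dirCoeff H l = H z := by
      rw [← (hasSum_dirCoeff hH.1 hz').tsum_eq]
      exact tsum_congr fun n => by rw [smul_eq_mul, mul_comm]
    rw [h]
    exact hb z hz'
  obtain ⟨w, hw1, hw2⟩ := exists_multiplier_of_range_inclusion v (cauchyCube (dirCoeff H)) C
    fun N c => by
      rw [hC2]
      exact range_inclusion hva hv hcol hH.colBound hpt N c
  have hw := norm_le_one_of_conv_le hw2
  have hbd : ∀ j n, ‖(C : ℂ) * w n j‖ ≤ C := fun j n => by
    rw [norm_mul, norm_real, Real.norm_of_nonneg hC0]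
    exact mul_le_of_le_one_right hC0 ((lp.norm_apply_le_norm two_ne_zero (w n) j).trans (hw n))
  obtain ⟨hG1, hG2⟩ := colNormLE_of_colBound (G := fun j => powerSum fun n => (C : ℂ) * w n j)
    (C := C) (fun j => differentiableOn_powerSum (hbd j)) fun J => by
      simp only [dirCoeff_powerSum (hbd _)]
      exact colBound_of_conv_le hw2 C J
  refine ⟨_, hG1, hC ▸ hG2, fun z hz => ?_⟩
  have hz' := mem_ball_zero_iff.1 hz
  have h1 : ∀ j, powerSum (fun n => (C : ℂ) * w n j) z = C * (∑' l, z ^ l • w l) j := fun j => by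
    refine (hasSum_powerSum (hbd j) hz).unique ?_
    refine ((lp.hasSum_apply (summable_pow_smul hw hz') j).mul_left (C : ℂ)).congr_fun fun n => ?_
    rw [lp.coeFn_smul, Pi.smul_apply, smul_eq_mul]
    ring
  have h2 := (lp.hasSum_inner (𝕜 := ℂ) (∑' l, star z ^ l • v l)
    (∑' l, z ^ l • w l)).mul_left (C : ℂ)
  have h3 : C * inner ℂ (∑' l, star z ^ l • v l) (∑' l, z ^ l • w l) = H z ^ 3 := by
    rw [inner_tsum_pow_smul hv hw hz', ← tsum_mul_left, ← (hasSum_cauchyCube hH.1 hz).tsum_eq]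
    refine tsum_congr fun n => ?_
    rw [← hw1, Finset.mul_sum, Finset.sum_mul]
    exact Finset.sum_congr rfl fun p _ => by ring
  rw [h3] at h2
  have h4 : HasSum (fun j => F j z * powerSum (fun n => (C : ℂ) * w n j) z) (H z ^ 3) := by
    refine h2.congr_fun fun j => ?_
    rw [h1, hFz z hz', RCLike.inner_apply]
    simp
    ring
  exact ⟨h4.summable, h4.tsum_eq⟩
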